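/- Assume the Generalized Riemann hypothesis. Fix y > 0, δ ∈ (3/4, 1), and let Φ : ℝ → ℝ be a smooth Schwartz function with compact support satisfying Φ ≥ 0. Then the limit as X → ∞ of M_Φ(y, X, δ) := (log X / X^{1+δ}) · Σ_{p prime, yX ≤ p ≤ yX + X^δ} Σ_{d ∈ 𝒢} Φ(d/X) · (8d/p) · √p exists and equals (1/2) · Σ_{a ≥ 1, a odd} (μ(a)/a²) · Σ_{m ≥ 1} (−1)^m · Φ̃(m²/(2a²y)). -/

import Mathlib

open Filter Topology Finset

/-- The Generalized Riemann hypothesis: for every positive modulus `q` and every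
Dirichlet character `χ` mod `q`, every zero of `L(s, χ)` with real part strictly
between `0` and `1` has real part `1/2`. -/
def GeneralizedRiemannHypothesis : Prop :=
  ∀ (q : ℕ) [NeZero q] (χ : DirichletCharacter ℂ q) (s : ℂ),
    DirichletCharacter.LFunction χ s = 0 → 0 < s.re → s.re < 1 → s.re = 1 / 2

/-- The transform `Φ̃(ξ) = ∫ (cos(2πξx) + sin(2πξx)) Φ(x) dx`. -/
noncomputable def cosSinTransform (Φ : ℝ → ℝ) (ξ : ℝ) : ℝ :=
  ∫ x : ℝ, (Real.cos (2 * Real.pi * ξ * x) + Real.sin (2 * Real.pi * ξ * x)) * Φ x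

/-- `M_Φ(y, X, δ)`: the weighted average of `(8d/p)·√p` over odd squarefree `d`
and primes `p ∈ [yX, yX + X^δ]`. -/
noncomputable def MPhi (Φ : ℝ → ℝ) (y X δ : ℝ) : ℝ :=
  (Real.log X / X ^ (1 + δ)) *
    ∑ p ∈ (Finset.range (Nat.floor (y * X + X ^ δ) + 1)).filter
        (fun p : ℕ => p.Prime ∧ y * X ≤ (p : ℝ) ∧ (p : ℝ) ≤ y * X + X ^ δ),
      ∑ᶠ d ∈ {d : ℤ | Odd d ∧ Squarefree d},
        Φ ((d : ℝ) / X) * (jacobiSym (8 * d) p : ℝ) * Real.sqrt p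

/-- A quantitative bound for the logarithmic derivative of a zero-free function on a disc. -/
theorem norm_logDeriv_le_of_ball {f : ℂ → ℂ} {c s : ℂ} {R r M m : ℝ} (hr : 0 < r) (hrR : r < R)
    (hf : DifferentiableOn ℂ f (Metric.ball c R)) (hf0 : ∀ z ∈ Metric.ball c R, f z ≠ 0)
    (hM : ∀ z ∈ Metric.ball c R, ‖f z‖ ≤ M) (hm : 0 < m) (hmc : m ≤ ‖f c‖) (hmM : m < M)
    (hs : s ∈ Metric.closedBall c r) :
    ‖deriv f s / f s‖ ≤ 4 * (R + r) / (R - r) ^ 2 * Real.log (M / m) := by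
  have hR : 0 < R := hr.trans hrR
  have hL : 0 < Real.log (M / m) := Real.log_pos ((one_lt_div hm).2 hmM)
  have hcR : c ∈ Metric.ball c R := Metric.mem_ball_self hR
  have hdf : DifferentiableOn ℂ (fun z => deriv f z / f z) (Metric.ball c R) :=
    (hf.deriv Metric.isOpen_ball).div hf hf0
  obtain ⟨g0, hg0⟩ := hdf.isExactOn_ball
  set g : ℂ → ℂ := fun z => g0 z - g0 c with hgdef
  have hg : ∀ z ∈ Metric.ball c R, HasDerivAt g (deriv f z / f z) z := fun z hz =>
    (hg0 z hz).sub_const _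
  have hgc : g c = 0 := by simp [hgdef]
  -- `exp g = f / f c`
  have hexp : ∀ z ∈ Metric.ball c R, Complex.exp (g z) * f c = f z := by
    have hder : ∀ z ∈ Metric.ball c R,
        HasDerivAt (fun z => Complex.exp (-g z) * f z) 0 z := by
      intro z hz
      have h1 := (hg z hz).neg.cexp
      have h2 := (hf.differentiableAt (Metric.isOpen_ball.mem_nhds hz)).hasDerivAt
      refine (h1.mul h2).congr_deriv ?_
      have := hf0 z hz
      simp only [Pi.neg_apply]
      field_simp
      ring
    intro z hz
    have hconst : (fun z => Complex.exp (-g z) * f z) z = (fun z => Complex.exp (-g z) * f z) c := by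
      apply (convex_ball c R).is_const_of_fderivWithin_eq_zero (𝕜 := ℂ) (s := Metric.ball c R)
        (f := fun z => Complex.exp (-g z) * f z) _ _ hz hcR
      · intro w hw
        exact (hder w hw).differentiableAt.differentiableWithinAt
      · intro w hw
        have := (hder w hw).hasDerivWithinAt (s := Metric.ball c R)
        rw [this.hasFDerivWithinAt.fderivWithin (Metric.isOpen_ball.uniqueDiffWithinAt hw)]
        ext; simp
    simp only [hgc, neg_zero, Complex.exp_zero, one_mul] at hconst
    rw [← hconst, ← mul_assoc, ← Complex.exp_add]
    simp
  have hre : ∀ z ∈ Metric.ball c R, (g z).re ≤ Real.log (M / m) := by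
    intro z hz
    have h1 := hexp z hz
    have h2 : Real.exp (g z).re * ‖f c‖ ≤ M := by
      rw [← Complex.norm_exp, ← norm_mul, h1]; exact hM z hz
    have h3 : Real.exp (g z).re * m ≤ M :=
      (mul_le_mul_of_nonneg_left hmc (Real.exp_pos _).le).trans h2
    rw [Real.le_log_iff_exp_le (div_pos (hm.trans hmM) hm), le_div_iff₀ hm]
    exact h3
  set ρ := (R + r) / 2 with hρ
  have hgb : ∀ z ∈ Metric.closedBall c ρ, ‖g z‖ ≤ 2 * Real.log (M / m) * ρ / (R - ρ) := by
    intro z hz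
    have hz' : ‖z - c‖ ≤ ρ := by simpa [dist_eq_norm] using hz
    have hρR : ρ < R := by rw [hρ]; linarith
    have hmaps : ∀ w ∈ Metric.ball (0 : ℂ) R, w + c ∈ Metric.ball c R := by
      intro w hw; simpa [dist_eq_norm] using hw
    have hb := Complex.borelCaratheodory_zero (f := fun w => g (w + c)) (R := R) (z := z - c) hL
      (by
        intro w hw
        have := (hg _ (hmaps w hw)).differentiableAt
        exact (this.comp w (by fun_prop : DifferentiableAt ℂ (fun w => w + c) w)).differentiableWithinAt)
      (fun w hw => hre _ (hmaps w hw)) hR (by simpa using hz'.trans_lt hρR) (by simp [hgc])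
    simp only [sub_add_cancel] at hb
    refine hb.trans ?_
    have : 0 < R - ρ := by linarith
    gcongr
  have hsub : Metric.closedBall s ((R - r) / 2) ⊆ Metric.closedBall c ρ := by
    apply Metric.closedBall_subset_closedBall'
    have : dist s c ≤ r := hs
    rw [hρ]; linarith
  have hsub2 : Metric.closedBall c ρ ⊆ Metric.ball c R := by
    apply Metric.closedBall_subset_ball; rw [hρ]; linarith
  have hd : 0 < (R - r) / 2 := by linarith
  have hdc : DiffContOnCl ℂ g (Metric.ball s ((R - r) / 2)) := by
    apply DifferentiableOn.diffContOnCl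
    rw [closure_ball _ hd.ne']
    intro z hz
    exact (hg z (hsub2 (hsub hz))).differentiableAt.differentiableWithinAt
  have hfin := Complex.norm_deriv_le_of_forall_mem_sphere_norm_le hd hdc
    (fun z hz => hgb z (hsub (Metric.sphere_subset_closedBall hz)))
  have hss : s ∈ Metric.ball c R := hsub2 (hsub (Metric.mem_closedBall_self hd.le))
  rw [(hg s hss).deriv] at hfin
  refine hfin.trans (le_of_eq ?_)
  have : R - r ≠ 0 := by linarith
  have h2 : R - ρ = (R - r) / 2 := by rw [hρ]; ring
  rw [h2, hρ]
  field_simp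
  ring

theorem norm_logDeriv_le_of_halfplane {η : ℝ} (hη : 0 < η) (hη' : η < 3 / 2) :
    ∃ C : ℝ, 0 < C ∧ ∀ (f : ℂ → ℂ) (Q : ℝ), 1 ≤ Q →
      DifferentiableOn ℂ f {s | 1 / 2 < s.re} → (∀ s : ℂ, 1 / 2 < s.re → f s ≠ 0) →
      (∀ s : ℂ, 1 / 2 < s.re → s.re < 7 / 2 → ‖f s‖ ≤ Q * (|s.im| + 4) ^ 2) →
      (∀ t : ℝ, 1 / 4 ≤ ‖f (2 + t * Complex.I)‖) →
      ∀ s : ℂ, 1 / 2 + η ≤ s.re → s.re ≤ 2 →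
        ‖deriv f s / f s‖ ≤ C * Real.log (4 * Q * (|s.im| + 6) ^ 2) := by
  refine ⟨4 * (3 / 2 + (3 / 2 - η)) / (3 / 2 - (3 / 2 - η)) ^ 2, ?_, ?_⟩
  · have : 3 / 2 - (3 / 2 - η) = η := by ring
    rw [this]
    have : 0 < 3 / 2 + (3 / 2 - η) := by linarith
    positivity
  intro f Q hQ hf hf0 hfb hfl s hs hs2
  set c : ℂ := 2 + s.im * Complex.I with hc
  have hcre : c.re = 2 := by simp [hc]
  have hcim : c.im = s.im := by simp [hc]
  have hball : ∀ z ∈ Metric.ball c (3 / 2), 1 / 2 < z.re ∧ z.re < 7 / 2 ∧ |z.im| ≤ |s.im| + 2 := by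
    intro z hz
    have h1 : ‖z - c‖ < 3 / 2 := by simpa [dist_eq_norm] using hz
    have h2 := (Complex.abs_re_le_norm (z - c)).trans_lt h1
    have h3 := (Complex.abs_im_le_norm (z - c)).trans_lt h1
    rw [Complex.sub_re, hcre, abs_lt] at h2
    rw [Complex.sub_im, hcim] at h3
    refine ⟨by linarith, by linarith, ?_⟩
    have := abs_sub_abs_le_abs_sub z.im s.im
    linarith
  have key := norm_logDeriv_le_of_ball (f := f) (c := c) (s := s) (R := 3 / 2) (r := 3 / 2 - η)
    (M := Q * (|s.im| + 6) ^ 2) (m := 1 / 4) (by linarith) (by linarith)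
    (hf.mono fun z hz => (hball z hz).1) (fun z hz => hf0 z (hball z hz).1)
    (fun z hz => by
      obtain ⟨h1, h2, h3⟩ := hball z hz
      refine (hfb z h1 h2).trans ?_
      exact mul_le_mul_of_nonneg_left (pow_le_pow_left₀ (by positivity) (by linarith) 2)
        (by linarith)) (by norm_num) (hfl s.im)
    (by nlinarith [abs_nonneg s.im]) (by
      rw [Metric.mem_closedBall, dist_eq_norm]
      have : s - c = ((s.re - 2 : ℝ) : ℂ) := by
        apply Complex.ext <;> simp [hcre, hcim]
      rw [this, Complex.norm_real, Real.norm_eq_abs, abs_of_nonpos (by linarith)]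
      linarith)
  convert key using 3
  ring

/-- The Mellin-type integral of a bounded function on `(1, ∞)` is holomorphic for `re s > 0`. -/
theorem differentiableAt_integral_Ioi_one {S : ℝ → ℂ} (hSm : Measurable S) {B : ℝ}
    (hS : ∀ t, 1 < t → ‖S t‖ ≤ B) {s : ℂ} (hs : 0 < s.re) :
    DifferentiableAt ℂ (fun s : ℂ => ∫ t in Set.Ioi (1 : ℝ), S t * (t : ℂ) ^ (-(s + 1))) s := by
  set f : ℝ → ℂ := (Set.Ioi (1 : ℝ)).indicator S with hf
  have hfb : ∀ t, ‖f t‖ ≤ |B| := by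
    intro t
    by_cases ht : t ∈ Set.Ioi (1 : ℝ)
    · rw [hf, Set.indicator_of_mem ht]; exact (hS t ht).trans (le_abs_self _)
    · rw [hf, Set.indicator_of_notMem ht]; simp
  have hfm : Measurable f := hSm.indicator measurableSet_Ioi
  have hloc : MeasureTheory.LocallyIntegrableOn f (Set.Ioi 0) := by
    have : MeasureTheory.LocallyIntegrable f := by
      apply (MeasureTheory.locallyIntegrable_const |B|).mono hfm.aestronglyMeasurable
      filter_upwards with t
      rw [Real.norm_eq_abs, abs_abs]; exact hfb t
    exact this.locallyIntegrableOn _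
  have htop : f =O[atTop] (fun t : ℝ => t ^ (-(0 : ℝ))) := by
    simp only [neg_zero, Real.rpow_zero]
    exact Asymptotics.IsBigO.of_bound |B| (Eventually.of_forall fun t => by simpa using hfb t)
  have hbot : f =O[𝓝[>] 0] (fun t : ℝ => t ^ (-(-s.re - 1))) := by
    apply Asymptotics.IsBigO.of_bound 0
    have : ∀ᶠ t : ℝ in 𝓝[>] 0, t < 1 := nhdsWithin_le_nhds (eventually_lt_nhds one_pos)
    filter_upwards [this] with t ht
    rw [hf, Set.indicator_of_notMem (by simp [ht.le])]
    simp
  have hm := mellin_differentiableAt_of_isBigO_rpow (s := -s) hloc htop (by simpa using hs) hbot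
    (by simp)
  have heq : (fun s : ℂ => ∫ t in Set.Ioi (1 : ℝ), S t * (t : ℂ) ^ (-(s + 1))) =
      fun s => mellin f (-s) := by
    ext s
    rw [mellin, ← MeasureTheory.integral_indicator measurableSet_Ioi,
      ← MeasureTheory.integral_indicator measurableSet_Ioi]
    congr 1
    ext t
    by_cases ht : 1 < t
    · rw [Set.indicator_of_mem (Set.mem_Ioi.2 ht),
        Set.indicator_of_mem (Set.mem_Ioi.2 (zero_lt_one.trans ht)), hf,
        Set.indicator_of_mem (Set.mem_Ioi.2 ht), smul_eq_mul, mul_comm]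
      congr 2
      ring
    · rw [Set.indicator_of_notMem (by simpa using ht)]
      simp only [Set.indicator]
      split_ifs with h1
      · simp [hf, Set.indicator_of_notMem (show t ∉ Set.Ioi (1 : ℝ) by simpa using ht)]
      · rfl
  rw [heq]
  exact hm.comp s (by fun_prop)

theorem norm_integral_Ioi_one_le {S : ℝ → ℂ} {B : ℝ}
    (hS : ∀ t, 1 < t → ‖S t‖ ≤ B) {s : ℂ} (hs : 0 < s.re) :
    ‖∫ t in Set.Ioi (1 : ℝ), S t * (t : ℂ) ^ (-(s + 1))‖ ≤ B / s.re := by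
  have hint : MeasureTheory.IntegrableOn (fun t : ℝ => B * t ^ (-(s.re + 1))) (Set.Ioi 1) :=
    (integrableOn_Ioi_rpow_of_lt (by linarith) one_pos).const_mul B
  refine (MeasureTheory.norm_integral_le_of_norm_le hint ?_).trans (le_of_eq ?_)
  · filter_upwards [MeasureTheory.ae_restrict_mem measurableSet_Ioi] with t ht
    rw [norm_mul, Complex.norm_cpow_eq_rpow_re_of_pos (zero_lt_one.trans ht)]
    simp only [Complex.neg_re, Complex.add_re, Complex.one_re]
    exact mul_le_mul_of_nonneg_right (hS t ht) (Real.rpow_nonneg (zero_lt_one.trans ht).le _)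
  · rw [MeasureTheory.integral_const_mul, integral_Ioi_rpow_of_lt (by linarith) one_pos]
    have := hs.ne'
    rw [Real.one_rpow, show -(s.re + 1) + 1 = -s.re by ring]
    field_simp

theorem eq_of_eqOn_one_lt_re {f g : ℂ → ℂ} (hf : DifferentiableOn ℂ f {s | 0 < s.re})
    (hg : DifferentiableOn ℂ g {s | 0 < s.re}) (h : ∀ s : ℂ, 1 < s.re → f s = g s) {s : ℂ}
    (hs : 0 < s.re) : f s = g s := by
  have hopen : IsOpen {s : ℂ | 0 < s.re} := isOpen_lt continuous_const Complex.continuous_re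
  have hpre : IsPreconnected {s : ℂ | 0 < s.re} := (convex_halfSpace_re_gt 0).isPreconnected
  have h2 : (2 : ℂ) ∈ {s : ℂ | 0 < s.re} := by simp
  refine (hf.analyticOnNhd hopen).eqOn_of_preconnected_of_eventuallyEq (hg.analyticOnNhd hopen)
    hpre h2 ?_ hs
  have : {s : ℂ | 1 < s.re} ∈ 𝓝 (2 : ℂ) :=
    (isOpen_lt continuous_const Complex.continuous_re).mem_nhds (by simp)
  filter_upwards [this] with s hs using h s hs

theorem norm_sum_dirichletCharacter_le {q : ℕ} [NeZero q] {χ : DirichletCharacter ℂ q}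
    (hχ : χ ≠ 1) (n : ℕ) : ‖∑ k ∈ Finset.Icc 1 n, χ k‖ ≤ q := by
  have hq : 0 < q := Nat.pos_of_ne_zero (NeZero.ne q)
  have hper : ∀ m : ℕ, ∑ k ∈ Finset.range q, χ ((m * q + k : ℕ) : ZMod q) = 0 := by
    intro m
    rw [← χ.sum_eq_zero_of_ne_one hχ]
    refine Finset.sum_nbij' (fun k => ((k : ℕ) : ZMod q)) (fun a => a.val) ?_ ?_ ?_ ?_ ?_
    · simp
    · intro a _; simpa using ZMod.val_lt a
    · intro k hk; exact ZMod.val_cast_of_lt (Finset.mem_range.1 hk)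
    · intro a _; simp
    · intro k _; simp
  have hmul : ∀ m : ℕ, ∑ k ∈ Finset.range (m * q), χ (k : ZMod q) = 0 := by
    intro m
    induction m with
    | zero => simp
    | succ m ih => rw [add_mul, one_mul, Finset.sum_range_add, ih, hper, add_zero]
  have hrange : ∀ N : ℕ, ‖∑ k ∈ Finset.range N, χ (k : ZMod q)‖ ≤ (N % q : ℕ) := by
    intro N
    conv_lhs => rw [← Nat.div_add_mod' N q, Finset.sum_range_add, hmul, zero_add]
    refine (norm_sum_le _ _).trans ?_
    refine (Finset.sum_le_sum fun i _ => χ.norm_le_one _).trans ?_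
    simp
  have h0 : χ ((0 : ℕ) : ZMod q) = 0 := by
    rw [Nat.cast_zero]
    refine χ.map_zero' ?_
    rintro rfl
    exact hχ (χ.level_one)
  have : ∑ k ∈ Finset.Icc 1 n, χ (k : ZMod q) = ∑ k ∈ Finset.range (n + 1), χ (k : ZMod q) := by
    rw [Finset.range_eq_Ico, Finset.sum_eq_sum_Ico_succ_bot (by omega), h0, zero_add]
    rfl
  rw [this]
  refine (hrange _).trans ?_
  exact_mod_cast (Nat.mod_lt _ hq).le

theorem norm_LFunction_le {q : ℕ} [NeZero q] {χ : DirichletCharacter ℂ q} (hχ : χ ≠ 1) {s : ℂ}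
    (hs : 0 < s.re) : ‖DirichletCharacter.LFunction χ s‖ ≤ ‖s‖ * (q / s.re) := by
  set S : ℝ → ℂ := fun t => ∑ k ∈ Finset.Icc 1 ⌊t⌋₊, χ k with hS
  have hSm : Measurable S :=
    (measurable_from_nat (f := fun n : ℕ => ∑ k ∈ Finset.Icc 1 n, χ k)).comp Nat.measurable_floor
  have hSb : ∀ t, 1 < t → ‖S t‖ ≤ q := fun t _ => norm_sum_dirichletCharacter_le hχ _
  have heq : DirichletCharacter.LFunction χ s =
      s * ∫ t in Set.Ioi (1 : ℝ), S t * (t : ℂ) ^ (-(s + 1)) := by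
    refine eq_of_eqOn_one_lt_re (f := DirichletCharacter.LFunction χ)
      (g := fun s => s * ∫ t in Set.Ioi (1 : ℝ), S t * (t : ℂ) ^ (-(s + 1)))
      (DirichletCharacter.differentiable_LFunction hχ).differentiableOn ?_ ?_ hs
    · intro z hz
      exact (differentiableAt_id.mul
        (differentiableAt_integral_Ioi_one hSm hSb hz)).differentiableWithinAt
    · intro z hz
      rw [DirichletCharacter.LFunction_eq_LSeries χ hz]
      refine LSeries_eq_mul_integral _ le_rfl (zero_lt_one.trans hz)
        (DirichletCharacter.LSeriesSummable_of_one_lt_re χ hz) ?_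
      refine Asymptotics.IsBigO.of_bound q (Eventually.of_forall fun n => ?_)
      simpa using norm_sum_dirichletCharacter_le hχ n
  rw [heq, norm_mul]
  exact mul_le_mul_of_nonneg_left (norm_integral_Ioi_one_le hSb hs) (norm_nonneg _)

/-- `(s - 1) ζ(s)` as an entire function. -/
noncomputable def subOneMulZeta (s : ℂ) : ℂ := DirichletCharacter.LFunctionTrivChar₁ 1 s

theorem differentiable_subOneMulZeta : Differentiable ℂ subOneMulZeta :=
  DirichletCharacter.differentiable_LFunctionTrivChar₁ 1

theorem subOneMulZeta_of_ne_one {s : ℂ} (hs : s ≠ 1) :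
    subOneMulZeta s = (s - 1) * riemannZeta s := by
  rw [subOneMulZeta, DirichletCharacter.LFunctionTrivChar₁, Function.update_of_ne hs]
  rw [DirichletCharacter.LFunctionTrivChar, DirichletCharacter.LFunction_modOne_eq]

theorem norm_subOneMulZeta_le {s : ℂ} (hs : 0 < s.re) :
    ‖subOneMulZeta s‖ ≤ ‖s‖ + ‖s‖ * ‖s - 1‖ / s.re := by
  set S : ℝ → ℂ := fun t => ((⌊t⌋₊ : ℝ) - t : ℝ) with hS
  have hSm : Measurable S := by
    apply Complex.measurable_ofReal.comp
    exact (measurable_from_nat.comp Nat.measurable_floor).sub measurable_id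
  have hSb : ∀ t, 1 < t → ‖S t‖ ≤ 1 := by
    intro t ht
    rw [hS, Complex.norm_real, Real.norm_eq_abs, abs_le]
    have h1 := Nat.floor_le (zero_le_one.trans ht.le)
    have h2 := Nat.lt_floor_add_one t
    constructor <;> linarith
  have heq : subOneMulZeta s =
      s + s * (s - 1) * ∫ t in Set.Ioi (1 : ℝ), S t * (t : ℂ) ^ (-(s + 1)) := by
    refine eq_of_eqOn_one_lt_re (f := subOneMulZeta)
      (g := fun s => s + s * (s - 1) * ∫ t in Set.Ioi (1 : ℝ), S t * (t : ℂ) ^ (-(s + 1)))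
      differentiable_subOneMulZeta.differentiableOn ?_ ?_ hs
    · intro z hz
      have := differentiableAt_integral_Ioi_one hSm hSb hz
      exact (differentiableAt_id.add
        ((differentiableAt_id.mul (differentiableAt_id.sub_const 1)).mul
          this)).differentiableWithinAt
    · intro z hz
      have hz1 : z ≠ 1 := by rintro rfl; simp at hz
      have hz1' : z - 1 ≠ 0 := sub_ne_zero.2 hz1
      rw [subOneMulZeta_of_ne_one hz1, ← LSeries_one_eq_riemannZeta hz,
        LSeries_eq_mul_integral (r := 1) _ zero_le_one hz (LSeriesSummable_one_iff.2 hz) (by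
          refine Asymptotics.IsBigO.of_bound 1 (Eventually.of_forall fun n => ?_)
          simp)]
      have hfl : ∀ t : ℝ, (∑ k ∈ Finset.Icc 1 ⌊t⌋₊, (1 : ℕ → ℂ) k) = S t + t := by
        intro t; simp [hS]
      simp_rw [hfl, add_mul]
      have hbd : ∀ᵐ t ∂(MeasureTheory.volume.restrict (Set.Ioi (1 : ℝ))),
          ‖S t * (t : ℂ) ^ (-(z + 1))‖ ≤ t ^ (-(z.re + 1)) := by
        filter_upwards [MeasureTheory.ae_restrict_mem measurableSet_Ioi] with t ht
        rw [norm_mul, Complex.norm_cpow_eq_rpow_re_of_pos (zero_lt_one.trans ht)]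
        simp only [Complex.neg_re, Complex.add_re, Complex.one_re]
        exact mul_le_of_le_one_left (Real.rpow_nonneg (zero_lt_one.trans ht).le _) (hSb t ht)
      have hcpow : ∀ a : ℂ, ContinuousOn (fun t : ℝ => (t : ℂ) ^ a) (Set.Ioi 1) := by
        intro a t ht
        exact (Complex.continuousAt_ofReal_cpow_const t a
          (Or.inr (zero_lt_one.trans ht).ne')).continuousWithinAt
      have hint1 : MeasureTheory.IntegrableOn (fun t : ℝ => S t * (t : ℂ) ^ (-(z + 1)))
          (Set.Ioi 1) := by
        refine MeasureTheory.Integrable.mono'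
          (integrableOn_Ioi_rpow_of_lt (a := -(z.re + 1)) (by linarith) one_pos) ?_ hbd
        exact hSm.aestronglyMeasurable.mul ((hcpow _).aestronglyMeasurable measurableSet_Ioi)
      have hmul : ∀ t ∈ Set.Ioi (1 : ℝ), (t : ℂ) * (t : ℂ) ^ (-(z + 1)) = (t : ℂ) ^ (-z) := by
        intro t ht
        have ht0 : (t : ℂ) ≠ 0 := by exact_mod_cast (zero_lt_one.trans ht).ne'
        rw [show -z = 1 + -(z + 1) by ring, Complex.cpow_add _ _ ht0, Complex.cpow_one]
      have hint2 : MeasureTheory.IntegrableOn (fun t : ℝ => (t : ℂ) * (t : ℂ) ^ (-(z + 1)))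
          (Set.Ioi 1) := by
        refine (integrableOn_Ioi_cpow_of_lt (a := -z) (by simpa using hz) one_pos).congr_fun ?_
          measurableSet_Ioi
        exact fun t ht => (hmul t ht).symm
      rw [MeasureTheory.integral_add hint1 hint2,
        MeasureTheory.setIntegral_congr_fun measurableSet_Ioi hmul,
        integral_Ioi_cpow_of_lt (by simpa using hz) one_pos]
      simp only [Complex.ofReal_one, Complex.one_cpow]
      have : -z + 1 ≠ 0 := by
        intro h; apply hz1'; linear_combination -h
      field_simp
      ring
  have hb := norm_integral_Ioi_one_le hSb hs
  rw [heq]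
  refine (norm_add_le _ _).trans ?_
  rw [norm_mul, norm_mul, div_eq_mul_one_div (‖s‖ * ‖s - 1‖)]
  exact add_le_add le_rfl (mul_le_mul_of_nonneg_left hb (by positivity))

theorem quarter_le_norm_LFunction_two {q : ℕ} [NeZero q] (χ : DirichletCharacter ℂ q) (t : ℝ) :
    1 / 4 ≤ ‖DirichletCharacter.LFunction χ (2 + t * Complex.I)‖ := by
  set s : ℂ := 2 + t * Complex.I with hs
  have hre : s.re = 2 := by simp [hs]
  have h1 : 1 < s.re := by rw [hre]; norm_num
  rw [DirichletCharacter.LFunction_eq_LSeries χ h1]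
  have hsum : Summable (LSeries.term (χ ·) s) := DirichletCharacter.LSeriesSummable_of_one_lt_re χ h1
  have hz : Summable (fun n : ℕ => 1 / (n : ℝ) ^ 2) := hasSum_zeta_two.summable
  have hz2 : ∑' n : ℕ, 1 / ((n + 2 : ℕ) : ℝ) ^ 2 = Real.pi ^ 2 / 6 - 1 := by
    have := hz.sum_add_tsum_nat_add 2
    rw [hasSum_zeta_two.tsum_eq] at this
    simp [Finset.sum_range_succ] at this
    push_cast
    simp only [one_div]
    linarith
  have hdec := hsum.sum_add_tsum_nat_add 2
  have hterm1 : ∑ i ∈ Finset.range 2, LSeries.term (χ ·) s i = 1 := by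
    simp [Finset.sum_range_succ, LSeries.term]
  have hbd : ‖∑' i : ℕ, LSeries.term (χ ·) s (i + 2)‖ ≤ Real.pi ^ 2 / 6 - 1 := by
    rw [← hz2]
    refine tsum_of_norm_bounded ((summable_nat_add_iff 2).2 hz).hasSum fun n => ?_
    rw [LSeries.norm_term_eq, if_neg (by omega), hre]
    have h2 : ((n + 2 : ℕ) : ℝ) ^ (2 : ℝ) = ((n + 2 : ℕ) : ℝ) ^ 2 := by
      exact_mod_cast Real.rpow_natCast ((n + 2 : ℕ) : ℝ) 2
    rw [h2]
    exact div_le_div_of_nonneg_right (χ.norm_le_one _) (by positivity)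
  have hpi : Real.pi ^ 2 / 6 - 1 ≤ 3 / 4 := by
    have := Real.pi_lt_d2
    have := Real.pi_pos
    nlinarith
  rw [LSeries, ← hdec, hterm1]
  have := norm_sub_norm_le (1 : ℂ) (-∑' i : ℕ, LSeries.term (χ ·) s (i + 2))
  rw [sub_neg_eq_add, norm_neg, norm_one] at this
  linarith

theorem log_le_rpow_mul_rpow {ε : ℝ} (hε : 0 < ε) {Q u : ℝ} (hQ : 0 ≤ Q) :
    Real.log (4 * Q * (|u| + 6) ^ 2) ≤
      (4 ^ ε * 36 ^ ε / ε) * Q ^ ε * (1 + |u|) ^ (2 * ε) := by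
  have h1 : 0 ≤ 4 * Q * (|u| + 6) ^ 2 := by positivity
  refine (Real.log_le_rpow_div h1 hε).trans ?_
  have h2 : 4 * Q * (|u| + 6) ^ 2 ≤ 4 * Q * (36 * (1 + |u|) ^ 2) := by
    gcongr
    nlinarith [abs_nonneg u]
  have h3 := Real.rpow_le_rpow h1 h2 hε.le
  refine (div_le_div_of_nonneg_right h3 hε.le).trans (le_of_eq ?_)
  have h4 : ((1 + |u|) ^ 2 : ℝ) ^ ε = (1 + |u|) ^ (2 * ε) := by
    rw [Real.rpow_mul (by positivity), Real.rpow_two]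
  rw [Real.mul_rpow (by positivity) (by positivity), Real.mul_rpow (by positivity) (by positivity),
    Real.mul_rpow (by positivity) (by positivity), h4]
  ring

/-- The bound `f'/f ≪ Q^ε (1+|t|)^(2ε)` in `re s ≥ 1/2 + η` for zero-free functions of polynomial
growth. -/
theorem norm_logDeriv_le_rpow {η : ℝ} (hη : 0 < η) (hη' : η < 3 / 2) {ε : ℝ} (hε : 0 < ε) :
    ∃ C : ℝ, 0 < C ∧ ∀ (f : ℂ → ℂ) (Q : ℝ), 1 ≤ Q →
      DifferentiableOn ℂ f {s | 1 / 2 < s.re} → (∀ s : ℂ, 1 / 2 < s.re → f s ≠ 0) →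
      (∀ s : ℂ, 1 / 2 < s.re → s.re < 7 / 2 → ‖f s‖ ≤ Q * (|s.im| + 4) ^ 2) →
      (∀ t : ℝ, 1 / 4 ≤ ‖f (2 + t * Complex.I)‖) →
      ∀ s : ℂ, 1 / 2 + η ≤ s.re → s.re ≤ 2 →
        ‖deriv f s / f s‖ ≤ C * Q ^ ε * (1 + |s.im|) ^ (2 * ε) := by
  obtain ⟨C, hC, h⟩ := norm_logDeriv_le_of_halfplane hη hη'
  refine ⟨C * (4 ^ ε * 36 ^ ε / ε), by positivity, ?_⟩
  intro f Q hQ h1 h2 h3 h4 s hs hs2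
  refine (h f Q hQ h1 h2 h3 h4 s hs hs2).trans ?_
  rw [mul_assoc C, mul_assoc C]
  refine mul_le_mul_of_nonneg_left ?_ hC.le
  exact log_le_rpow_mul_rpow hε (by linarith)

theorem norm_le_abs_im_add_four {s : ℂ} (h1 : 1 / 2 < s.re) (h2 : s.re < 7 / 2) :
    ‖s‖ ≤ |s.im| + 4 := by
  have := Complex.norm_le_abs_re_add_abs_im s
  rw [abs_of_pos (by linarith : 0 < s.re)] at this
  linarith

theorem LFunction_ne_zero_of_half_lt_re (hGRH : GeneralizedRiemannHypothesis) {q : ℕ} [NeZero q]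
    {χ : DirichletCharacter ℂ q} {s : ℂ} (hχ : χ ≠ 1 ∨ s ≠ 1) (hs : 1 / 2 < s.re) :
    DirichletCharacter.LFunction χ s ≠ 0 := by
  rcases lt_or_ge s.re 1 with h | h
  · intro h0
    have := hGRH q χ s h0 (by linarith) h
    linarith
  · exact DirichletCharacter.LFunction_ne_zero_of_one_le_re χ hχ h

theorem norm_logDeriv_LFunction_le (hGRH : GeneralizedRiemannHypothesis)
    {η : ℝ} (hη : 0 < η) (hη' : η < 3 / 2) {ε : ℝ} (hε : 0 < ε) :
    ∃ C : ℝ, 0 < C ∧ ∀ (q : ℕ) [NeZero q] (χ : DirichletCharacter ℂ q), χ ≠ 1 →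
      ∀ s : ℂ, 1 / 2 + η ≤ s.re → s.re ≤ 2 →
        ‖deriv (DirichletCharacter.LFunction χ) s / DirichletCharacter.LFunction χ s‖ ≤
          C * (q : ℝ) ^ ε * (1 + |s.im|) ^ (2 * ε) := by
  obtain ⟨C, hC, h⟩ := norm_logDeriv_le_rpow hη hη' hε
  refine ⟨C * 2 ^ ε, by positivity, ?_⟩
  intro q _ χ hχ s hs hs2
  have hq : (1 : ℝ) ≤ q := by exact_mod_cast Nat.one_le_iff_ne_zero.2 (NeZero.ne q)
  refine (h (DirichletCharacter.LFunction χ) (2 * q) (by linarith)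
    (DirichletCharacter.differentiable_LFunction hχ).differentiableOn
    (fun s hs => LFunction_ne_zero_of_half_lt_re hGRH (Or.inl hχ) hs) ?_
    (quarter_le_norm_LFunction_two χ) s hs hs2).trans (le_of_eq ?_)
  · intro s h1 h2
    refine (norm_LFunction_le hχ (by linarith)).trans ?_
    have h3 : (q : ℝ) / s.re ≤ 2 * q := by
      rw [div_le_iff₀ (by linarith)]
      nlinarith
    have h4 := norm_le_abs_im_add_four h1 h2
    have h5 : (1 : ℝ) ≤ |s.im| + 4 := by linarith [abs_nonneg s.im]
    calc ‖s‖ * (q / s.re) ≤ (|s.im| + 4) * (2 * q) := by gcongr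
      _ ≤ 2 * q * (|s.im| + 4) ^ 2 := by nlinarith [mul_nonneg (by linarith : (0 : ℝ) ≤ q) (by linarith : (0 : ℝ) ≤ |s.im| + 4)]
  · rw [Real.mul_rpow (by norm_num) (by positivity)]
    ring

theorem subOneMulZeta_ne_zero (hGRH : GeneralizedRiemannHypothesis) {s : ℂ} (hs : 1 / 2 < s.re) :
    subOneMulZeta s ≠ 0 := by
  rcases eq_or_ne s 1 with rfl | h1
  · exact DirichletCharacter.LFunctionTrivChar₁_apply_one_ne_zero 1
  · rw [subOneMulZeta_of_ne_one h1, ← DirichletCharacter.LFunction_modOne_eq (χ := 1)]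
    exact mul_ne_zero (sub_ne_zero.2 h1) (LFunction_ne_zero_of_half_lt_re hGRH (Or.inr h1) hs)

theorem norm_logDeriv_subOneMulZeta_le (hGRH : GeneralizedRiemannHypothesis)
    {η : ℝ} (hη : 0 < η) (hη' : η < 3 / 2) {ε : ℝ} (hε : 0 < ε) :
    ∃ C : ℝ, 0 < C ∧ ∀ s : ℂ, 1 / 2 + η ≤ s.re → s.re ≤ 2 →
        ‖deriv subOneMulZeta s / subOneMulZeta s‖ ≤ C * (1 + |s.im|) ^ (2 * ε) := by
  obtain ⟨C, hC, h⟩ := norm_logDeriv_le_rpow hη hη' hε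
  refine ⟨C * 5 ^ ε, by positivity, ?_⟩
  intro s hs hs2
  refine h subOneMulZeta 5 (by norm_num) differentiable_subOneMulZeta.differentiableOn
    (fun s hs => subOneMulZeta_ne_zero hGRH hs) ?_ ?_ s hs hs2
  · intro s h1 h2
    refine (norm_subOneMulZeta_le (by linarith)).trans ?_
    have h4 := norm_le_abs_im_add_four h1 h2
    have h5 : ‖s - 1‖ ≤ |s.im| + 4 := by
      have := Complex.norm_le_abs_re_add_abs_im (s - 1)
      have h6 : |(s - 1).re| ≤ 5 / 2 := by
        rw [abs_le]; constructor <;> simp <;> linarith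
      simp at this h6
      linarith
    have h7 : (1 : ℝ) ≤ |s.im| + 4 := by linarith [abs_nonneg s.im]
    have h8 : ‖s‖ * ‖s - 1‖ / s.re ≤ 2 * ((|s.im| + 4) * (|s.im| + 4)) := by
      rw [div_le_iff₀ (by linarith)]
      calc ‖s‖ * ‖s - 1‖ ≤ (|s.im| + 4) * (|s.im| + 4) := by gcongr
        _ ≤ 2 * ((|s.im| + 4) * (|s.im| + 4)) * s.re := by nlinarith [mul_self_nonneg (|s.im| + 4)]
    nlinarith
  · intro t
    have h1 : (2 + t * Complex.I : ℂ) ≠ 1 := by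
      intro h; have := congrArg Complex.re h; simp at this
    rw [subOneMulZeta_of_ne_one h1, norm_mul, ← DirichletCharacter.LFunction_modOne_eq (χ := 1)]
    have h2 := quarter_le_norm_LFunction_two (1 : DirichletCharacter ℂ 1) t
    have h3 : 1 ≤ ‖(2 + t * Complex.I - 1 : ℂ)‖ := by
      refine le_trans ?_ (Complex.abs_re_le_norm _)
      simp; norm_num
    nlinarith [norm_nonneg (DirichletCharacter.LFunction (1 : DirichletCharacter ℂ 1) (2 + t * Complex.I))]

theorem one_add_abs_im_le {s : ℂ} (hs : 1 / 2 ≤ s.re) : (1 + |s.im|) / 3 ≤ ‖s‖ := by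
  have h1 := Complex.abs_im_le_norm s
  have h2 := (le_abs_self s.re).trans (Complex.abs_re_le_norm s)
  linarith

theorem integrable_one_add_abs_rpow {r : ℝ} (hr : 1 < r) :
    MeasureTheory.Integrable (fun t : ℝ => (1 + |t|) ^ (-r)) := by
  have := integrable_one_add_norm (E := ℝ) (μ := MeasureTheory.volume) (r := r) (by simpa using hr)
  simpa using this

/-- Shifting a vertical line of integration for functions decaying faster than `1/|t|`. -/
theorem integral_vertical_eq {G : ℂ → ℂ} {a b K r : ℝ} (hab : a ≤ b) (hr : 1 < r)
    (hG : ∀ s : ℂ, a ≤ s.re → s.re ≤ b → DifferentiableAt ℂ G s)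
    (hK : ∀ s : ℂ, a ≤ s.re → s.re ≤ b → ‖G s‖ ≤ K * (1 + |s.im|) ^ (-r)) :
    ∫ t : ℝ, G (a + t * Complex.I) = ∫ t : ℝ, G (b + t * Complex.I) := by
  have hK0 : 0 ≤ K := by
    have := (norm_nonneg _).trans (hK a (by simp) (by simpa using hab))
    simpa using this
  have hcont : ∀ c : ℝ, a ≤ c → c ≤ b → Continuous fun t : ℝ => G (c + t * Complex.I) := by
    intro c h1 h2
    rw [continuous_iff_continuousAt]
    intro t
    have : ContinuousAt G (c + t * Complex.I) := (hG _ (by simpa using h1) (by simpa using h2)).continuousAt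
    exact ContinuousAt.comp (f := fun t : ℝ => (c + t * Complex.I : ℂ)) this (by fun_prop)
  have hint : ∀ c : ℝ, a ≤ c → c ≤ b →
      MeasureTheory.Integrable fun t : ℝ => G (c + t * Complex.I) := by
    intro c h1 h2
    refine ((integrable_one_add_abs_rpow hr).const_mul K).mono'
      (hcont c h1 h2).aestronglyMeasurable (Eventually.of_forall fun t => ?_)
    have := hK (c + t * Complex.I) (by simpa using h1) (by simpa using h2)
    simpa using this
  have hlim : ∀ c : ℝ, a ≤ c → c ≤ b →
      Tendsto (fun T : ℝ => ∫ t in (-T)..T, G (c + t * Complex.I)) atTop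
        (𝓝 (∫ t : ℝ, G (c + t * Complex.I))) := fun c h1 h2 =>
    MeasureTheory.intervalIntegral_tendsto_integral (hint c h1 h2) tendsto_neg_atTop_atBot tendsto_id
  have hdec : Tendsto (fun T : ℝ => 2 * (K * (1 + |T|) ^ (-r) * |b - a|)) atTop (𝓝 0) := by
    have h1 : Tendsto (fun T : ℝ => (1 + |T|) ^ (-r)) atTop (𝓝 0) :=
      (tendsto_rpow_neg_atTop (by linarith)).comp
        (tendsto_atTop_add_const_left _ _ tendsto_abs_atTop_atTop)
    have := ((h1.const_mul K).mul_const |b - a|).const_mul 2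
    simpa using this
  have hdiff : Tendsto (fun T : ℝ => (∫ t in (-T)..T, G (b + t * Complex.I)) -
      ∫ t in (-T)..T, G (a + t * Complex.I)) atTop (𝓝 0) := by
    refine squeeze_zero_norm (fun T => ?_) hdec
    have hrect := Complex.integral_boundary_rect_eq_zero_of_differentiableOn G
      (a + (-T : ℝ) * Complex.I) (b + T * Complex.I) (by
        intro z hz
        have hz1 := hz.1
        simp [Set.uIcc_of_le hab] at hz1
        exact (hG z hz1.1 hz1.2).differentiableWithinAt)
    simp only [Complex.add_re, Complex.ofReal_re, Complex.mul_re, Complex.I_re, mul_zero,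
      Complex.ofReal_im, Complex.I_im, mul_one, sub_self, add_zero, Complex.add_im,
      Complex.mul_im, zero_add] at hrect
    have hh : ∀ τ : ℝ, |τ| = |T| → ‖∫ x in a..b, G (x + τ * Complex.I)‖ ≤
        K * (1 + |T|) ^ (-r) * |b - a| := by
      intro τ hτ
      refine intervalIntegral.norm_integral_le_of_norm_le_const fun x hx => ?_
      rw [Set.uIoc_of_le hab] at hx
      have := hK (x + τ * Complex.I) (by simpa using hx.1.le) (by simpa using hx.2)
      simpa [hτ] using this
    have h1 := hh (-T) (abs_neg T)
    have h2 := hh T rfl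
    set I1 := ∫ x in a..b, G (x + (-T : ℝ) * Complex.I)
    set I2 := ∫ x in a..b, G (x + T * Complex.I)
    set J1 := ∫ t in (-T)..T, G (b + t * Complex.I)
    set J2 := ∫ t in (-T)..T, G (a + t * Complex.I)
    have h3 : J1 - J2 = Complex.I * (I1 - I2) := by
      simp only [smul_eq_mul] at hrect
      have hI := Complex.I_mul_I
      linear_combination (-Complex.I) * hrect + (J1 - J2) * hI
    rw [h3, norm_mul, Complex.norm_I, one_mul]
    refine (norm_sub_le _ _).trans ?_
    linarith
  have := tendsto_nhds_unique hdiff ((hlim b hab le_rfl).sub (hlim a le_rfl hab))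
  exact (sub_eq_zero.1 this.symm).symm

theorem hasMellin_cesaro {s : ℂ} (hs : 0 < s.re) :
    HasMellin (Set.indicator (Set.Ioc 0 1) (fun t : ℝ => (1 : ℂ) - t)) s (1 / (s * (s + 1))) := by
  have h1 := hasMellin_one_Ioc hs
  have h2 := hasMellin_cpow_Ioc 1 (s := s) (by simp; linarith)
  have h3 := hasMellin_sub h1.1 h2.1
  rw [h1.2, h2.2] at h3
  have hs0 : s ≠ 0 := by rintro rfl; simp at hs
  have hs1 : s + 1 ≠ 0 := by
    intro h; have := congrArg Complex.re h; simp at this; linarith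
  have hf : Set.indicator (Set.Ioc 0 1) (fun t : ℝ => (1 : ℂ) - t) = fun t : ℝ =>
      Set.indicator (Set.Ioc 0 1) (fun _ => (1 : ℂ)) t -
        Set.indicator (Set.Ioc 0 1) (fun t : ℝ => (t : ℂ) ^ (1 : ℂ)) t := by
    ext t
    by_cases ht : t ∈ Set.Ioc (0 : ℝ) 1
    · simp [Set.indicator_of_mem ht]
    · simp [Set.indicator_of_notMem ht]
  have hv : 1 / (s * (s + 1)) = 1 / s - 1 / (s + 1) := by
    field_simp
    ring
  rw [hf, hv]
  exact h3

theorem hasMellin_cesaro_two {s : ℂ} (hs : 0 < s.re) :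
    HasMellin (Set.indicator (Set.Ioc 0 1) (fun t : ℝ => ((1 : ℂ) - t) ^ 2)) s
      (2 / (s * (s + 1) * (s + 2))) := by
  have h1 := hasMellin_one_Ioc hs
  have h2 := hasMellin_cpow_Ioc 1 (s := s) (by simp; linarith)
  have h4 := hasMellin_cpow_Ioc 2 (s := s) (by simp; linarith)
  have h5 := hasMellin_const_smul h2.1 (2 : ℂ)
  have h3 := hasMellin_sub h1.1 h5.1
  have h6 := hasMellin_add h3.1 h4.1
  rw [h3.2, h5.2, h1.2, h2.2, h4.2] at h6
  have hs0 : s ≠ 0 := by rintro rfl; simp at hs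
  have hs1 : s + 1 ≠ 0 := by
    intro h; have := congrArg Complex.re h; simp at this; linarith
  have hs2 : s + 2 ≠ 0 := by
    intro h; have := congrArg Complex.re h; simp at this; linarith
  have hf : Set.indicator (Set.Ioc 0 1) (fun t : ℝ => ((1 : ℂ) - t) ^ 2) = fun t : ℝ =>
      (Set.indicator (Set.Ioc 0 1) (fun _ => (1 : ℂ)) t -
        (2 : ℂ) • Set.indicator (Set.Ioc 0 1) (fun t : ℝ => (t : ℂ) ^ (1 : ℂ)) t) +
        Set.indicator (Set.Ioc 0 1) (fun t : ℝ => (t : ℂ) ^ (2 : ℂ)) t := by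
    ext t
    by_cases ht : t ∈ Set.Ioc (0 : ℝ) 1
    · simp [Set.indicator_of_mem ht]
      ring
    · simp [Set.indicator_of_notMem ht]
  have hv : 2 / (s * (s + 1) * (s + 2)) = (1 / s - (2 : ℂ) • (1 / (s + 1))) + 1 / (s + 2) := by
    simp only [smul_eq_mul]
    field_simp
    ring
  rw [hf, hv]
  exact h6

theorem ne_zero_of_re_pos {s : ℂ} (hs : 0 < s.re) : s ≠ 0 := by
  rintro rfl
  simp at hs

theorem norm_inv_mul_add_one_le {s : ℂ} (hs : 1 / 2 ≤ s.re) :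
    ‖1 / (s * (s + 1))‖ ≤ 9 * (1 + |s.im|) ^ (-2 : ℝ) := by
  have h1 := one_add_abs_im_le hs
  have h2 : (1 + |s.im|) / 3 ≤ ‖s + 1‖ := by
    have := one_add_abs_im_le (s := s + 1) (by simp; linarith)
    simpa using this
  have h3 : 0 < 1 + |s.im| := by positivity
  rw [norm_div, norm_mul, norm_one, Real.rpow_neg h3.le, Real.rpow_two]
  calc 1 / (‖s‖ * ‖s + 1‖) ≤ 1 / ((1 + |s.im|) / 3 * ((1 + |s.im|) / 3)) := by gcongr
    _ = 9 * ((1 + |s.im|) ^ 2)⁻¹ := by field_simp; norm_num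

theorem continuous_vertical {G : ℂ → ℂ} {σ : ℝ}
    (hG : ∀ s : ℂ, s.re = σ → DifferentiableAt ℂ G s) :
    Continuous fun t : ℝ => G (σ + t * Complex.I) := by
  rw [continuous_iff_continuousAt]
  intro t
  exact ContinuousAt.comp (f := fun t : ℝ => (σ + t * Complex.I : ℂ))
    (hG _ (by simp)).continuousAt (by fun_prop)

theorem integrable_vertical {G : ℂ → ℂ} {σ K r : ℝ} (hr : 1 < r)
    (hG : ∀ s : ℂ, s.re = σ → DifferentiableAt ℂ G s)
    (hK : ∀ s : ℂ, s.re = σ → ‖G s‖ ≤ K * (1 + |s.im|) ^ (-r)) :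
    MeasureTheory.Integrable fun t : ℝ => G (σ + t * Complex.I) := by
  refine ((integrable_one_add_abs_rpow hr).const_mul K).mono'
    (continuous_vertical hG).aestronglyMeasurable (Eventually.of_forall fun t => ?_)
  simpa using hK (σ + t * Complex.I) (by simp)

theorem integral_cesaro {σ u : ℝ} (hσ : 1 / 2 ≤ σ) (hu : 0 < u) :
    ∫ t : ℝ, (u : ℂ) ^ (-(σ + t * Complex.I)) *
      (1 / ((σ + t * Complex.I) * (σ + t * Complex.I + 1))) =
      2 * Real.pi * ((max (1 - u) 0 : ℝ) : ℂ) := by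
  set f : ℝ → ℂ := fun t => ((max (1 - t) 0 : ℝ) : ℂ)
  have hfc : Continuous f := by
    refine Complex.continuous_ofReal.comp ?_
    fun_prop
  have hm : ∀ s : ℂ, 0 < s.re → HasMellin f s (1 / (s * (s + 1))) := by
    intro s hs
    have h := hasMellin_cesaro hs
    have he : Set.EqOn (Set.indicator (Set.Ioc 0 1) (fun t : ℝ => (1 : ℂ) - t)) f (Set.Ioi 0) := by
      intro t ht
      have ht : 0 < t := ht
      by_cases h1 : t ≤ 1
      · rw [Set.indicator_of_mem (show t ∈ Set.Ioc (0 : ℝ) 1 from ⟨ht, h1⟩)]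
        simp only [f]
        rw [max_eq_left (by linarith)]
        push_cast
        ring
      · rw [Set.indicator_of_notMem (show t ∉ Set.Ioc (0 : ℝ) 1 from fun hh => h1 hh.2)]
        simp only [f]
        rw [max_eq_right (by linarith)]
        simp
    constructor
    · exact (MeasureTheory.integrableOn_congr_fun (fun t ht => by simp only [he ht])
        measurableSet_Ioi).1 h.1
    · rw [← h.2]
      exact MeasureTheory.setIntegral_congr_fun measurableSet_Ioi
        (fun t ht => by simp only [he ht])
  have hσ0 : 0 < σ := by linarith
  have h := mellinInv_mellin_eq σ f hu (hm σ (by simpa using hσ0)).1 (by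
    have : MeasureTheory.Integrable fun t : ℝ =>
        (fun s : ℂ => 1 / (s * (s + 1))) (σ + t * Complex.I) := by
      refine integrable_vertical (G := fun s : ℂ => 1 / (s * (s + 1))) (σ := σ) (K := 9) (r := 2) (by norm_num) ?_ ?_
      · intro s hs
        have h1 : s ≠ 0 := ne_zero_of_re_pos (by rw [hs]; exact hσ0)
        have h2 : s + 1 ≠ 0 := ne_zero_of_re_pos (by simp; rw [hs]; linarith)
        fun_prop (disch := simp [h1, h2])
      · intro s hs
        exact norm_inv_mul_add_one_le (by rw [hs]; exact hσ)
    refine this.congr (Eventually.of_forall fun t => ?_)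
    exact (hm _ (by simpa using hσ0)).2.symm) hfc.continuousAt
  have h2 : mellinInv σ (mellin f) u = (1 / (2 * Real.pi)) •
      ∫ t : ℝ, (u : ℂ) ^ (-(σ + t * Complex.I)) *
      (1 / ((σ + t * Complex.I) * (σ + t * Complex.I + 1))) := by
    unfold mellinInv
    congr 2
    ext t
    rw [(hm (σ + t * Complex.I) (by simpa using hσ0)).2, smul_eq_mul]
  rw [h2, Complex.real_smul] at h
  have hpi : (Real.pi : ℂ) ≠ 0 := by exact_mod_cast Real.pi_ne_zero
  have h3 : f u = ((max (1 - u) 0 : ℝ) : ℂ) := rfl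
  have e : 2 * (Real.pi : ℂ) * ((1 / (2 * Real.pi) : ℝ) : ℂ) = 1 := by
    push_cast
    field_simp
  rw [← h3, ← h, ← mul_assoc, e, one_mul]

theorem integral_cesaro_two {σ u : ℝ} (hσ : 1 / 2 ≤ σ) (hu : 0 < u) (hu1 : u ≤ 1) :
    ∫ t : ℝ, (u : ℂ) ^ (-(σ + t * Complex.I)) *
      (2 / ((σ + t * Complex.I) * (σ + t * Complex.I + 1) * (σ + t * Complex.I + 2))) =
      2 * Real.pi * (1 - u : ℂ) ^ 2 := by
  set f : ℝ → ℂ := fun t => ((max (1 - t) 0 : ℝ) : ℂ) ^ 2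
  have hfc : Continuous f := by
    refine (Complex.continuous_ofReal.comp ?_).pow 2
    fun_prop
  have hm : ∀ s : ℂ, 0 < s.re → HasMellin f s (2 / (s * (s + 1) * (s + 2))) := by
    intro s hs
    have h := hasMellin_cesaro_two hs
    have he : Set.EqOn (Set.indicator (Set.Ioc 0 1) (fun t : ℝ => ((1 : ℂ) - t) ^ 2)) f
        (Set.Ioi 0) := by
      intro t ht
      have ht : 0 < t := ht
      by_cases h1 : t ≤ 1
      · rw [Set.indicator_of_mem (show t ∈ Set.Ioc (0 : ℝ) 1 from ⟨ht, h1⟩)]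
        simp only [f]
        rw [max_eq_left (by linarith)]
        push_cast
        ring
      · rw [Set.indicator_of_notMem (show t ∉ Set.Ioc (0 : ℝ) 1 from fun hh => h1 hh.2)]
        simp only [f]
        rw [max_eq_right (by linarith)]
        simp
    constructor
    · exact (MeasureTheory.integrableOn_congr_fun (fun t ht => by simp only [he ht])
        measurableSet_Ioi).1 h.1
    · rw [← h.2]
      exact MeasureTheory.setIntegral_congr_fun measurableSet_Ioi
        (fun t ht => by simp only [he ht])
  have hσ0 : 0 < σ := by linarith
  have h := mellinInv_mellin_eq σ f hu (hm σ (by simpa using hσ0)).1 (by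
    have : MeasureTheory.Integrable fun t : ℝ =>
        (fun s : ℂ => 2 / (s * (s + 1) * (s + 2))) (σ + t * Complex.I) := by
      refine integrable_vertical (G := fun s : ℂ => 2 / (s * (s + 1) * (s + 2))) (σ := σ) (K := 18) (r := 2) (by norm_num) ?_ ?_
      · intro s hs
        have h1 : s ≠ 0 := ne_zero_of_re_pos (by rw [hs]; exact hσ0)
        have h2 : s + 1 ≠ 0 := ne_zero_of_re_pos (by simp; rw [hs]; linarith)
        have h3 : s + 2 ≠ 0 := ne_zero_of_re_pos (by simp; rw [hs]; linarith)
        fun_prop (disch := simp [h1, h2, h3])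
      · intro s hs
        have h3 : 1 ≤ ‖s + 2‖ := by
          have := (le_abs_self (s + 2).re).trans (Complex.abs_re_le_norm (s + 2))
          simp at this
          linarith
        have h4 := norm_inv_mul_add_one_le (s := s) (by rw [hs]; exact hσ)
        calc ‖2 / (s * (s + 1) * (s + 2))‖ = 2 * ‖1 / (s * (s + 1))‖ / ‖s + 2‖ := by
              simp only [norm_div, norm_mul, norm_one, Complex.norm_ofNat]
              ring
          _ ≤ 2 * ‖1 / (s * (s + 1))‖ := div_le_self (by positivity) h3
          _ ≤ _ := by linarith
    refine this.congr (Eventually.of_forall fun t => ?_)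
    exact (hm _ (by simpa using hσ0)).2.symm) hfc.continuousAt
  have h2 : mellinInv σ (mellin f) u = (1 / (2 * Real.pi)) •
      ∫ t : ℝ, (u : ℂ) ^ (-(σ + t * Complex.I)) *
      (2 / ((σ + t * Complex.I) * (σ + t * Complex.I + 1) * (σ + t * Complex.I + 2))) := by
    unfold mellinInv
    congr 2
    ext t
    rw [(hm (σ + t * Complex.I) (by simpa using hσ0)).2, smul_eq_mul]
  rw [h2, Complex.real_smul] at h
  have hpi : (Real.pi : ℂ) ≠ 0 := by exact_mod_cast Real.pi_ne_zero
  have h3 : f u = (1 - u : ℂ) ^ 2 := by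
    simp only [f]
    rw [max_eq_left (by linarith)]
    push_cast
    ring
  have e : 2 * (Real.pi : ℂ) * ((1 / (2 * Real.pi) : ℝ) : ℂ) = 1 := by
    push_cast
    field_simp
  rw [← h3, ← h, ← mul_assoc, e, one_mul]

/-- The Cesàro-weighted Perron formula, with a possible pole at `1` removed. -/
theorem perron_cesaro {c : ℕ → ℂ} (hc : LSeriesSummable c 2) {F : ℂ → ℂ} {κ : ℂ}
    (hF : ∀ s : ℂ, s.re = 2 → F s = LSeries c s - κ / (s - 1)) {x : ℝ} (hx : 1 ≤ x) :
    ∫ t : ℝ, F (2 + t * Complex.I) * ((x : ℂ) ^ (2 + t * Complex.I + 1) /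
        ((2 + t * Complex.I) * (2 + t * Complex.I + 1))) =
      2 * Real.pi * (∑ n ∈ Ioc 0 ⌊x⌋₊, ((x : ℂ) - n) * c n - κ * (x - 1) ^ 2 / 2) := by
  have hx0 : 0 < x := by linarith
  have hxC : (x : ℂ) ≠ 0 := by exact_mod_cast hx0.ne'
  set k : ℝ → ℂ := fun t => (x : ℂ) ^ (2 + t * Complex.I + 1) /
        ((2 + t * Complex.I) * (2 + t * Complex.I + 1)) with hk
  have hkint : MeasureTheory.Integrable k := by
    have := integrable_vertical (G := fun s => (x : ℂ) ^ (s + 1) / (s * (s + 1))) (σ := 2)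
      (K := x ^ (3 : ℝ) * 9) (r := 2) (by norm_num) (by
        intro s hs
        have h1 : s ≠ 0 := ne_zero_of_re_pos (by rw [hs]; norm_num)
        have h2 : s + 1 ≠ 0 := ne_zero_of_re_pos (by simp; rw [hs]; norm_num)
        fun_prop (disch := simp [h1, h2, hxC])) (by
        intro s hs
        have h4 := norm_inv_mul_add_one_le (s := s) (by rw [hs]; norm_num)
        rw [div_eq_mul_one_div, norm_mul, Complex.norm_cpow_eq_rpow_re_of_pos hx0, mul_assoc]
        have : (s + 1).re = 3 := by simp [hs]; norm_num
        rw [this]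
        gcongr)
    simpa [hk] using this
  have hterm : ∀ n : ℕ, ∫ t : ℝ, LSeries.term c (2 + t * Complex.I) n * k t =
      if n = 0 then 0 else c n * (2 * Real.pi * ((max (x - n) 0 : ℝ) : ℂ)) := by
    intro n
    rcases eq_or_ne n 0 with rfl | hn
    · simp
    · have hn0 : (0 : ℝ) < n := by exact_mod_cast Nat.pos_of_ne_zero hn
      have h := integral_cesaro (σ := 2) (u := n / x) (by norm_num) (by positivity)
      have h2 : (2 * Real.pi * ((max (x - n) 0 : ℝ) : ℂ)) =
          x * (2 * Real.pi * ((max (1 - n / x) 0 : ℝ) : ℂ)) := by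
        have : max (x - n) 0 = x * max (1 - n / x) 0 := by
          rw [mul_max_of_nonneg _ _ hx0.le]
          congr 1
          · field_simp
          · simp
        rw [this]
        push_cast
        ring
      rw [if_neg hn, h2, ← h, ← MeasureTheory.integral_const_mul,
        ← MeasureTheory.integral_const_mul]
      congr 1
      ext t
      rw [LSeries.term_of_ne_zero hn]
      simp only [hk]
      have e1 : ((n / x : ℝ) : ℂ) ^ (-((2 : ℝ) + t * Complex.I)) =
          (x : ℂ) ^ (2 + t * Complex.I) / (n : ℂ) ^ (2 + t * Complex.I) := by
        have : (n / x : ℝ) = n * x⁻¹ := by ring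
        rw [this, Complex.ofReal_mul, Complex.mul_cpow_ofReal_nonneg hn0.le (by positivity)]
        rw [Complex.ofReal_inv, Complex.inv_cpow _ _ (by
          rw [Complex.arg_ofReal_of_nonneg hx0.le]; exact Real.pi_ne_zero.symm),
          Complex.cpow_neg, Complex.cpow_neg, inv_inv]
        push_cast
        ring
      have e2 : (x : ℂ) ^ (2 + t * Complex.I + 1) = (x : ℂ) ^ (2 + t * Complex.I) * x := by
        rw [Complex.cpow_add _ _ hxC, Complex.cpow_one]
      rw [e1, e2]
      push_cast
      ring
  have hnorm : ∀ (n : ℕ) (t : ℝ), ‖LSeries.term c (2 + t * Complex.I) n‖ =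
      ‖LSeries.term c 2 n‖ := by
    intro n t
    rw [LSeries.norm_term_eq, LSeries.norm_term_eq]
    simp
  have hsumm : ∀ t : ℝ, LSeriesSummable c (2 + t * Complex.I) := fun t =>
    hc.of_re_le_re (by simp)
  have hcontterm : ∀ n : ℕ, Continuous fun t : ℝ => LSeries.term c (2 + t * Complex.I) n := by
    intro n
    rcases eq_or_ne n 0 with rfl | hn
    · simpa using continuous_const
    · simp only [LSeries.term_of_ne_zero hn]
      have hnC : (n : ℂ) ≠ 0 := by exact_mod_cast hn
      refine continuous_const.div ?_ ?_
      · exact Continuous.const_cpow (by fun_prop) (Or.inl hnC)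
      · intro t h
        exact hnC ((Complex.cpow_eq_zero_iff _ _).1 h).1
  have hFint : ∀ n : ℕ, MeasureTheory.Integrable fun t : ℝ =>
      LSeries.term c (2 + t * Complex.I) n * k t := by
    intro n
    refine MeasureTheory.Integrable.bdd_mul (c := ‖LSeries.term c 2 n‖) hkint
      (hcontterm n).aestronglyMeasurable ?_
    exact Eventually.of_forall fun t => (hnorm n t).le
  have hmain := MeasureTheory.hasSum_integral_of_summable_integral_norm hFint (by
    simp only [norm_mul, hnorm, MeasureTheory.integral_const_mul]
    exact hc.norm.mul_right _)
  simp only [hterm] at hmain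
  have hfin : HasSum (fun n : ℕ => if n = 0 then (0 : ℂ) else
      c n * (2 * Real.pi * ((max (x - n) 0 : ℝ) : ℂ)))
      (∑ n ∈ Ioc 0 ⌊x⌋₊, c n * (2 * Real.pi * (x - n))) := by
    have h1 : ∑ n ∈ Ioc 0 ⌊x⌋₊, c n * (2 * Real.pi * ((x : ℂ) - n)) =
        ∑ n ∈ Ioc 0 ⌊x⌋₊, if n = 0 then (0 : ℂ) else
          c n * (2 * Real.pi * ((max (x - n) 0 : ℝ) : ℂ)) := by
      refine Finset.sum_congr rfl fun n hn => ?_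
      rw [Finset.mem_Ioc] at hn
      rw [if_neg (by lia), max_eq_left]
      · push_cast
        ring
      · have := (Nat.le_floor_iff hx0.le).1 hn.2
        linarith
    rw [h1]
    refine hasSum_sum_of_ne_finset_zero fun n hn => ?_
    rw [Finset.mem_Ioc] at hn
    rcases eq_or_ne n 0 with rfl | h0
    · simp
    · have : ¬ n ≤ ⌊x⌋₊ := fun h => hn ⟨Nat.pos_of_ne_zero h0, h⟩
      have h2 : x < n := by
        by_contra! h
        exact this ((Nat.le_floor_iff hx0.le).2 h)
      rw [if_neg h0, max_eq_right (by linarith)]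
      simp
  have hL := hfin.unique hmain
  have hL2 : ∫ t : ℝ, (∑' n, LSeries.term c (2 + t * Complex.I) n * k t) =
      ∫ t : ℝ, LSeries c (2 + t * Complex.I) * k t := by
    congr 1
    ext t
    rw [tsum_mul_right]
    rfl
  rw [hL2] at hL
  have hLint : MeasureTheory.Integrable fun t : ℝ => LSeries c (2 + t * Complex.I) * k t := by
    refine MeasureTheory.Integrable.bdd_mul (c := ∑' n, ‖LSeries.term c 2 n‖) hkint ?_ ?_
    · have : Continuous fun t : ℝ => LSeries c (2 + t * Complex.I) := by
        refine continuous_tsum hcontterm hc.norm fun n t => (hnorm n t).le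
      exact this.aestronglyMeasurable
    · refine Eventually.of_forall fun t => ?_
      refine (norm_tsum_le_tsum_norm ?_).trans_eq ?_
      · simp only [hnorm]; exact hc.norm
      · simp only [hnorm]
  -- the polar part
  have hpole := integral_cesaro_two (σ := 1) (u := 1 / x) (by norm_num) (by positivity)
    (by rw [div_le_one hx0]; exact hx)
  have hre : ∀ t : ℝ, (1 + t * Complex.I : ℂ) ≠ 0 := fun t => ne_zero_of_re_pos (by simp)
  have hpole2 : ∀ t : ℝ, κ / (2 + t * Complex.I - 1) * k t = κ * x ^ 2 / 2 *
      (((1 / x : ℝ) : ℂ) ^ (-((1 : ℝ) + t * Complex.I)) * (2 / (((1 : ℝ) + t * Complex.I) *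
        ((1 : ℝ) + t * Complex.I + 1) * ((1 : ℝ) + t * Complex.I + 2)))) := by
    intro t
    have e1 : ((1 / x : ℝ) : ℂ) ^ (-((1 : ℝ) + t * Complex.I)) =
        (x : ℂ) ^ (1 + t * Complex.I) := by
      rw [one_div, Complex.ofReal_inv, Complex.inv_cpow _ _ (by
          rw [Complex.arg_ofReal_of_nonneg hx0.le]; exact Real.pi_ne_zero.symm),
          Complex.cpow_neg, inv_inv]
      simp
    have e2 : (x : ℂ) ^ (2 + t * Complex.I + 1) = (x : ℂ) ^ (1 + t * Complex.I) * x ^ 2 := by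
      rw [← Complex.cpow_ofNat x 2, ← Complex.cpow_add _ _ hxC]
      congr 1
      ring
    rw [e1, hk]
    simp only [e2]
    have h1 := hre t
    have h2 : (2 + t * Complex.I : ℂ) ≠ 0 := ne_zero_of_re_pos (by simp)
    have h3 : (2 + t * Complex.I + 1 : ℂ) ≠ 0 := ne_zero_of_re_pos (by simp; norm_num)
    have e3 : (2 + t * Complex.I - 1 : ℂ) = 1 + t * Complex.I := by ring
    have e4 : ((1 : ℝ) + t * Complex.I + 1 : ℂ) = 2 + t * Complex.I := by push_cast; ring
    have e5 : ((1 : ℝ) + t * Complex.I + 2 : ℂ) = 2 + t * Complex.I + 1 := by push_cast; ring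
    rw [e3, e4, e5, Complex.ofReal_one]
    field_simp
  have hPint : MeasureTheory.Integrable fun t : ℝ => κ / (2 + t * Complex.I - 1) * k t := by
    refine MeasureTheory.Integrable.bdd_mul (c := ‖κ‖) hkint ?_ ?_
    · have : Continuous fun t : ℝ => κ / (2 + t * Complex.I - 1) := by
        refine continuous_const.div (by fun_prop) fun t => ?_
        have e3 : (2 + t * Complex.I - 1 : ℂ) = 1 + t * Complex.I := by ring
        rw [e3]
        exact hre t
      exact this.aestronglyMeasurable
    · refine Eventually.of_forall fun t => ?_
      rw [norm_div]
      refine div_le_self (norm_nonneg _) ?_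
      have := (le_abs_self (2 + t * Complex.I - 1 : ℂ).re).trans (Complex.abs_re_le_norm _)
      refine le_trans ?_ this
      simp
      norm_num
  have hfinal : ∫ t : ℝ, F (2 + t * Complex.I) * k t =
      (∫ t : ℝ, LSeries c (2 + t * Complex.I) * k t) -
        ∫ t : ℝ, κ / (2 + t * Complex.I - 1) * k t := by
    rw [← MeasureTheory.integral_sub hLint hPint]
    congr 1
    ext t
    rw [hF _ (by simp)]
    ring
  rw [hfinal, ← hL]
  simp only [hpole2, MeasureTheory.integral_const_mul]
  rw [hpole]
  have : (κ * x ^ 2 / 2 * (2 * Real.pi * (1 - ((1 / x : ℝ) : ℂ)) ^ 2)) =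
      2 * Real.pi * (κ * (x - 1) ^ 2 / 2) := by
    push_cast
    field_simp
  rw [this, mul_sub, Finset.mul_sum]
  congr 1
  refine Finset.sum_congr rfl fun n _ => ?_
  ring

/-- The right-hand side in the shifted Cesàro-weighted Perron formula. -/
theorem cesaro_sum_eq_shifted {c : ℕ → ℂ} (hc : LSeriesSummable c 2) {F : ℂ → ℂ} {κ : ℂ} {B η : ℝ}
    (hη : 0 < η) (hη1 : η ≤ 1 / 4)
    (hFd : ∀ s : ℂ, 1 / 2 + η ≤ s.re → s.re ≤ 2 → DifferentiableAt ℂ F s)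
    (hFb : ∀ s : ℂ, 1 / 2 + η ≤ s.re → s.re ≤ 2 → ‖F s‖ ≤ B * (1 + |s.im|) ^ η)
    (hF : ∀ s : ℂ, s.re = 2 → F s = LSeries c s - κ / (s - 1)) {x : ℝ} (hx : 1 ≤ x) :
    2 * Real.pi * (∑ n ∈ Ioc 0 ⌊x⌋₊, ((x : ℂ) - n) * c n - κ * (x - 1) ^ 2 / 2) =
      ∫ t : ℝ, F (((1 / 2 + η : ℝ) : ℂ) + t * Complex.I) *
        ((x : ℂ) ^ (((1 / 2 + η : ℝ) : ℂ) + t * Complex.I + 1) /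
        ((((1 / 2 + η : ℝ) : ℂ) + t * Complex.I) *
          (((1 / 2 + η : ℝ) : ℂ) + t * Complex.I + 1))) := by
  have hx0 : 0 < x := by linarith
  have hxC : (x : ℂ) ≠ 0 := by exact_mod_cast hx0.ne'
  have hB0 : 0 ≤ B := by
    have := (norm_nonneg _).trans (hFb 1 (by simp; linarith) (by simp))
    simpa using this
  rw [← perron_cesaro hc hF hx]
  have := integral_vertical_eq (G := fun s => F s * ((x : ℂ) ^ (s + 1) / (s * (s + 1))))
    (a := 1 / 2 + η) (b := 2) (K := B * x ^ (3 : ℝ) * 9) (r := 2 - η) (by linarith) (by linarith)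
    (by
      intro s h1 h2
      have h0 : s ≠ 0 := ne_zero_of_re_pos (by linarith)
      have h0' : s + 1 ≠ 0 := ne_zero_of_re_pos (by simp; linarith)
      have := hFd s h1 h2
      fun_prop (disch := simp [h0, h0', hxC])) (by
      intro s h1 h2
      have h4 := norm_inv_mul_add_one_le (s := s) (by linarith)
      have hp : 0 < 1 + |s.im| := by positivity
      rw [norm_mul, div_eq_mul_one_div, norm_mul, Complex.norm_cpow_eq_rpow_re_of_pos hx0]
      have h5 : x ^ (s + 1).re ≤ x ^ (3 : ℝ) :=
        Real.rpow_le_rpow_of_exponent_le hx (by simp; linarith)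
      have h6 : (1 + |s.im|) ^ (-(2 - η)) = (1 + |s.im|) ^ η * (1 + |s.im|) ^ (-2 : ℝ) := by
        rw [← Real.rpow_add hp]
        congr 1
        ring
      have h7 := hFb s h1 h2
      calc ‖F s‖ * (x ^ (s + 1).re * ‖1 / (s * (s + 1))‖)
          ≤ (B * (1 + |s.im|) ^ η) * (x ^ (3 : ℝ) * (9 * (1 + |s.im|) ^ (-2 : ℝ))) := by
            gcongr
        _ = _ := by rw [h6]; ring)
  simpa using this.symm

theorem norm_cpow_sub_cpow_le {x Δ : ℝ} (hx : 1 ≤ x) (hΔ : 0 < Δ) (hΔx : Δ ≤ x) {w : ℂ}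
    (hw : 1 ≤ w.re) {θ : ℝ} (hθ : 0 ≤ θ) (hθ1 : θ ≤ 1) :
    ‖((x + Δ : ℝ) : ℂ) ^ w - (x : ℂ) ^ w‖ ≤
      ‖w‖ ^ (1 - θ) * (Δ * (2 * x) ^ (w.re - 1) * (4 * x / Δ) ^ θ) := by
  have hx0 : 0 < x := by linarith
  set A := ‖w‖ * (2 * x) ^ (w.re - 1) * Δ
  set B := 2 * (2 * x) ^ w.re
  have h1 : ‖((x + Δ : ℝ) : ℂ) ^ w - (x : ℂ) ^ w‖ ≤ A := by
    have := (convex_Icc x (x + Δ)).norm_image_sub_le_of_norm_hasDerivWithin_le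
      (f := fun y : ℝ => (y : ℂ) ^ w) (f' := fun y : ℝ => w * (y : ℂ) ^ (w - 1))
      (C := ‖w‖ * (2 * x) ^ (w.re - 1)) (x := x) (y := x + Δ) (by
        intro y hy
        have hy0 : 0 < y := by linarith [hy.1]
        have h := (hasDerivAt_id (y : ℂ)).comp_ofReal
        have h2 := (HasDerivAt.cpow_const (c := w) (hasDerivAt_id (y : ℂ))
          (Or.inl (by simpa using hy0))).comp_ofReal
        refine (h2.congr_deriv ?_).hasDerivWithinAt
        simp) (by
        intro y hy
        have hy0 : 0 < y := by linarith [hy.1]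
        rw [norm_mul, Complex.norm_cpow_eq_rpow_re_of_pos hy0]
        have : y ≤ 2 * x := by linarith [hy.2]
        simp only [Complex.sub_re, Complex.one_re]
        have h3 : 0 ≤ w.re - 1 := by linarith
        gcongr) ⟨le_rfl, by linarith⟩ ⟨by linarith, le_rfl⟩
    simpa [abs_of_pos hΔ, A] using this
  have h2 : ‖((x + Δ : ℝ) : ℂ) ^ w - (x : ℂ) ^ w‖ ≤ B := by
    refine (norm_sub_le _ _).trans ?_
    rw [Complex.norm_cpow_eq_rpow_re_of_pos hx0,
      Complex.norm_cpow_eq_rpow_re_of_pos (by linarith : 0 < x + Δ)]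
    have e1 : (x + Δ) ^ w.re ≤ (2 * x) ^ w.re := by
      gcongr
      linarith
    have e2 : x ^ w.re ≤ (2 * x) ^ w.re := by
      gcongr
      linarith
    simp only [B]
    linarith
  have hA : 0 ≤ A := (norm_nonneg _).trans h1
  have hB : 0 < B := by simp only [B]; positivity
  set N := ‖((x + Δ : ℝ) : ℂ) ^ w - (x : ℂ) ^ w‖
  have hw0 : 0 < ‖w‖ := by
    have := (le_abs_self w.re).trans (Complex.abs_re_le_norm w)
    linarith
  calc N = N ^ ((1 - θ) + θ) := by simp
    _ = N ^ (1 - θ) * N ^ θ :=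
        Real.rpow_add_of_nonneg (norm_nonneg _) (by linarith) hθ
    _ ≤ A ^ (1 - θ) * B ^ θ := by
        have : 0 ≤ 1 - θ := by linarith
        gcongr
    _ = _ := by
        have hP : 0 < (2 * x) ^ (w.re - 1) := by positivity
        have hPB : B = (2 * x) ^ (w.re - 1) * Δ * (4 * x / Δ) := by
          simp only [B]
          rw [Real.rpow_sub_one (by positivity)]
          field_simp
          norm_num
        have hPA : A = ‖w‖ * ((2 * x) ^ (w.re - 1) * Δ) := by simp only [A]; ring
        rw [hPA, hPB, Real.mul_rpow hw0.le (by positivity),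
          Real.mul_rpow (x := (2 * x) ^ (w.re - 1) * Δ) (by positivity) (by positivity)]
        have : ((2 * x) ^ (w.re - 1) * Δ) ^ (1 - θ) * ((2 * x) ^ (w.re - 1) * Δ) ^ θ =
            (2 * x) ^ (w.re - 1) * Δ := by
          rw [← Real.rpow_add (by positivity)]
          simp
        linear_combination ‖w‖ ^ (1 - θ) * (4 * x / Δ) ^ θ * this

theorem norm_cesaro_sub_le {η : ℝ} (hη : 0 < η) (hη1 : η ≤ 1 / 4) :
    ∃ C > 0, ∀ (c : ℕ → ℂ) (F : ℂ → ℂ) (κ : ℂ) (B : ℝ), LSeriesSummable c 2 →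
    (∀ s : ℂ, 1 / 2 + η ≤ s.re → s.re ≤ 2 → DifferentiableAt ℂ F s) →
    (∀ s : ℂ, 1 / 2 + η ≤ s.re → s.re ≤ 2 → ‖F s‖ ≤ B * (1 + |s.im|) ^ η) →
    (∀ s : ℂ, s.re = 2 → F s = LSeries c s - κ / (s - 1)) → ∀ x Δ : ℝ, 1 ≤ x → 0 < Δ → Δ ≤ x →
    ‖(∑ n ∈ Ioc 0 ⌊x + Δ⌋₊, (((x + Δ : ℝ) : ℂ) - n) * c n - κ * (((x + Δ : ℝ) : ℂ) - 1) ^ 2 / 2) -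
      (∑ n ∈ Ioc 0 ⌊x⌋₊, ((x : ℂ) - n) * c n - κ * (x - 1) ^ 2 / 2)‖ ≤
      C * B * (Δ * (2 * x) ^ (1 / 2 + η) * (4 * x / Δ) ^ (2 * η)) := by
  set K := ∫ t : ℝ, 9 * (1 + |t|) ^ (-(1 + η))
  have hK0 : 0 ≤ K := MeasureTheory.integral_nonneg fun t => by positivity
  refine ⟨K + 1, by linarith, ?_⟩
  intro c F κ B hc hFd hFb hF x Δ hx hΔ hΔx
  have hx0 : 0 < x := by linarith
  have hxC : (x : ℂ) ≠ 0 := by exact_mod_cast hx0.ne'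
  have hxC' : ((x + Δ : ℝ) : ℂ) ≠ 0 := by exact_mod_cast (by linarith : 0 < x + Δ).ne'
  have hB0 : 0 ≤ B := by
    have := (norm_nonneg _).trans (hFb 1 (by simp; linarith) (by simp))
    simpa using this
  have e1 := cesaro_sum_eq_shifted hc hη hη1 hFd hFb hF hx
  have e2 := cesaro_sum_eq_shifted hc hη hη1 hFd hFb hF (by linarith : 1 ≤ x + Δ)
  set W1 := (∑ n ∈ Ioc 0 ⌊x + Δ⌋₊, (((x + Δ : ℝ) : ℂ) - n) * c n -
    κ * (((x + Δ : ℝ) : ℂ) - 1) ^ 2 / 2)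
  set W0 := (∑ n ∈ Ioc 0 ⌊x⌋₊, ((x : ℂ) - n) * c n - κ * (x - 1) ^ 2 / 2)
  set σ : ℝ := 1 / 2 + η with hσ
  have hint : ∀ z : ℝ, 1 ≤ z → MeasureTheory.Integrable fun t : ℝ =>
      F ((σ : ℂ) + t * Complex.I) * ((z : ℂ) ^ ((σ : ℂ) + t * Complex.I + 1) /
        (((σ : ℂ) + t * Complex.I) * ((σ : ℂ) + t * Complex.I + 1))) := by
    intro z hz
    have hz0 : 0 < z := by linarith
    have hzC : (z : ℂ) ≠ 0 := by exact_mod_cast hz0.ne'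
    refine integrable_vertical (G := fun s => F s * ((z : ℂ) ^ (s + 1) / (s * (s + 1))))
      (σ := σ) (K := B * z ^ (3 : ℝ) * 9) (r := 2 - η) (by linarith) ?_ ?_
    · intro s h1
      have h0 : s ≠ 0 := ne_zero_of_re_pos (by rw [h1]; linarith)
      have h0' : s + 1 ≠ 0 := ne_zero_of_re_pos (by simp; rw [h1]; linarith)
      have := hFd s (by linarith) (by linarith)
      fun_prop (disch := simp [h0, h0', hzC])
    · intro s h1
      have h4 := norm_inv_mul_add_one_le (s := s) (by linarith)
      have hp : 0 < 1 + |s.im| := by positivity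
      rw [norm_mul, div_eq_mul_one_div, norm_mul, Complex.norm_cpow_eq_rpow_re_of_pos hz0]
      have h5 : z ^ (s + 1).re ≤ z ^ (3 : ℝ) :=
        Real.rpow_le_rpow_of_exponent_le hz (by simp; linarith)
      have h6 : (1 + |s.im|) ^ (-(2 - η)) = (1 + |s.im|) ^ η * (1 + |s.im|) ^ (-2 : ℝ) := by
        rw [← Real.rpow_add hp]
        congr 1
        ring
      have h7 := hFb s (by linarith) (by linarith)
      calc ‖F s‖ * (z ^ (s + 1).re * ‖1 / (s * (s + 1))‖)
          ≤ (B * (1 + |s.im|) ^ η) * (z ^ (3 : ℝ) * (9 * (1 + |s.im|) ^ (-2 : ℝ))) := by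
            gcongr
        _ = _ := by rw [h6]; ring
  have e3 : 2 * Real.pi * (W1 - W0) = ∫ t : ℝ, F ((σ : ℂ) + t * Complex.I) *
      ((((x + Δ : ℝ) : ℂ) ^ ((σ : ℂ) + t * Complex.I + 1) -
        (x : ℂ) ^ ((σ : ℂ) + t * Complex.I + 1)) /
        (((σ : ℂ) + t * Complex.I) * ((σ : ℂ) + t * Complex.I + 1))) := by
    rw [mul_sub, e1, e2, ← MeasureTheory.integral_sub (hint _ (by linarith)) (hint _ hx)]
    congr 1
    ext t
    ring
  set P := Δ * (2 * x) ^ σ * (4 * x / Δ) ^ (2 * η)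
  have hP0 : 0 ≤ P := by positivity
  have hb : ‖2 * Real.pi * (W1 - W0)‖ ≤ ∫ t : ℝ, B * P * (9 * (1 + |t|) ^ (-(1 + η))) := by
    rw [e3]
    refine MeasureTheory.norm_integral_le_of_norm_le
      (((integrable_one_add_abs_rpow (by linarith)).const_mul 9).const_mul _)
      (Eventually.of_forall fun t => ?_)
    set s : ℂ := (σ : ℂ) + t * Complex.I with hs
    have hsre : s.re = σ := by simp [hs]
    have hsim : s.im = t := by simp [hs]
    have hb1 := hFb s (by rw [hsre]) (by rw [hsre]; linarith)
    rw [hsim] at hb1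
    have hb2 := norm_cpow_sub_cpow_le hx hΔ hΔx (w := s + 1) (by simp [hsre]; linarith)
      (θ := 2 * η) (by linarith) (by linarith)
    have hwre : (s + 1).re - 1 = σ := by simp [hsre]
    rw [hwre] at hb2
    have hn1 : (1 + |t|) / 3 ≤ ‖s‖ := by
      have := one_add_abs_im_le (s := s) (by rw [hsre]; linarith)
      rwa [hsim] at this
    have hn2 : (1 + |t|) / 3 ≤ ‖s + 1‖ := by
      have := one_add_abs_im_le (s := s + 1) (by simp [hsre]; linarith)
      simpa [hsim] using this
    have hT : 0 < 1 + |t| := by positivity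
    have hn20 : 0 < ‖s + 1‖ := by linarith
    have hn10 : 0 < ‖s‖ := by linarith
    rw [norm_mul, norm_div, norm_mul]
    calc ‖F s‖ * (‖((x + Δ : ℝ) : ℂ) ^ (s + 1) - (x : ℂ) ^ (s + 1)‖ / (‖s‖ * ‖s + 1‖))
        ≤ (B * (1 + |t|) ^ η) * (‖s + 1‖ ^ (1 - 2 * η) * P / (‖s‖ * ‖s + 1‖)) := by gcongr
      _ = B * P * ((1 + |t|) ^ η * (‖s‖⁻¹ * ‖s + 1‖ ^ (-(2 * η)))) := by
          rw [sub_eq_add_neg, Real.rpow_add hn20, Real.rpow_one]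
          field_simp
      _ ≤ B * P * ((1 + |t|) ^ η * (((1 + |t|) / 3)⁻¹ * ((1 + |t|) / 3) ^ (-(2 * η)))) := by
          have : ‖s + 1‖ ^ (-(2 * η)) ≤ ((1 + |t|) / 3) ^ (-(2 * η)) :=
            Real.rpow_le_rpow_of_nonpos (by positivity) hn2 (by linarith)
          gcongr
      _ ≤ B * P * (9 * (1 + |t|) ^ (-(1 + η))) := by
          have h3 : ((1 + |t|) / 3) ^ (-(2 * η)) ≤ 3 * (1 + |t|) ^ (-(2 * η)) := by
            rw [Real.div_rpow hT.le (by norm_num), div_eq_mul_inv, mul_comm,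
              ← Real.rpow_neg (by norm_num), neg_neg]
            gcongr
            calc (3 : ℝ) ^ (2 * η) ≤ 3 ^ (1 : ℝ) :=
                  Real.rpow_le_rpow_of_exponent_le (by norm_num) (by linarith)
              _ = 3 := by simp
          have h4 : (1 + |t|) ^ (-(1 + η)) =
              (1 + |t|) ^ η * ((1 + |t|)⁻¹ * (1 + |t|) ^ (-(2 * η))) := by
            rw [← Real.rpow_neg_one, ← Real.rpow_add hT, ← Real.rpow_add hT]
            congr 1
            ring
          rw [h4]
          calc _ ≤ B * P * ((1 + |t|) ^ η * (((1 + |t|) / 3)⁻¹ *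
                (3 * (1 + |t|) ^ (-(2 * η))))) := by gcongr
            _ = _ := by
              field_simp
              norm_num
  rw [MeasureTheory.integral_const_mul] at hb
  have hpi : ‖(2 * Real.pi : ℂ)‖ = 2 * Real.pi := by
    rw [norm_mul, Complex.norm_real, Real.norm_of_nonneg Real.pi_pos.le]
    simp
  rw [norm_mul, hpi] at hb
  have h1 : ‖W1 - W0‖ ≤ 2 * Real.pi * ‖W1 - W0‖ :=
    le_mul_of_one_le_left (norm_nonneg _) (by linarith [Real.pi_gt_three])
  calc ‖W1 - W0‖ ≤ B * P * K := h1.trans hb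
    _ ≤ (K + 1) * B * P := by nlinarith [mul_nonneg hB0 hP0]

theorem norm_sum_sub_le {η : ℝ} (hη : 0 < η) (hη1 : η ≤ 1 / 4) :
    ∃ C > 0, ∀ (c : ℕ → ℂ) (F : ℂ → ℂ) (κ : ℂ) (B : ℝ), LSeriesSummable c 2 → ‖κ‖ ≤ 1 →
    (∀ n : ℕ, ‖c n‖ ≤ Real.log n) →
    (∀ s : ℂ, 1 / 2 + η ≤ s.re → s.re ≤ 2 → DifferentiableAt ℂ F s) →
    (∀ s : ℂ, 1 / 2 + η ≤ s.re → s.re ≤ 2 → ‖F s‖ ≤ B * (1 + |s.im|) ^ η) →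
    (∀ s : ℂ, s.re = 2 → F s = LSeries c s - κ / (s - 1)) → ∀ x : ℝ, 1 ≤ x →
    ‖∑ n ∈ Ioc 0 ⌊x⌋₊, c n - κ * x‖ ≤ C * (B + 1) * x ^ (1 / 2 + 2 * η) := by
  obtain ⟨C, hC, h⟩ := norm_cesaro_sub_le hη hη1
  refine ⟨8 * C + (8 / η + 4), by positivity, ?_⟩
  intro c F κ B hc hκ hlog hFd hFb hF x hx
  have hx0 : 0 < x := by linarith
  have hB0 : 0 ≤ B := by
    have := (norm_nonneg _).trans (hFb 1 (by simp; linarith) (by simp))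
    simpa using this
  set Δ := √x with hΔdef
  have hΔ1 : 1 ≤ Δ := Real.one_le_sqrt.2 hx
  have hΔsq : Δ * Δ = x := Real.mul_self_sqrt hx0.le
  have hΔx : Δ ≤ x := by nlinarith
  have hmain := h c F κ B hc hFd hFb hF x Δ hx (by linarith) hΔx
  have hfloor : ⌊x⌋₊ ≤ ⌊x + Δ⌋₊ := Nat.floor_mono (by linarith)
  have hsplit : ∀ f : ℕ → ℂ, ∑ n ∈ Ioc 0 ⌊x + Δ⌋₊, f n =
      ∑ n ∈ Ioc 0 ⌊x⌋₊, f n + ∑ n ∈ Ioc ⌊x⌋₊ ⌊x + Δ⌋₊, f n := fun f => by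
    rw [← Finset.sum_Ioc_consecutive f (Nat.zero_le _) hfloor]
  set T := ∑ n ∈ Ioc ⌊x⌋₊ ⌊x + Δ⌋₊, (((x + Δ : ℝ) : ℂ) - n) * c n with hT
  set S := ∑ n ∈ Ioc 0 ⌊x⌋₊, c n with hS
  have e1 : (∑ n ∈ Ioc 0 ⌊x + Δ⌋₊, (((x + Δ : ℝ) : ℂ) - n) * c n -
      κ * (((x + Δ : ℝ) : ℂ) - 1) ^ 2 / 2) -
      (∑ n ∈ Ioc 0 ⌊x⌋₊, ((x : ℂ) - n) * c n - κ * (x - 1) ^ 2 / 2) =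
      Δ * (S - κ * x) + (T - κ * (Δ * (Δ / 2 - 1))) := by
    rw [hsplit, ← hT]
    have : ∑ n ∈ Ioc 0 ⌊x⌋₊, (((x + Δ : ℝ) : ℂ) - n) * c n =
        ∑ n ∈ Ioc 0 ⌊x⌋₊, ((x : ℂ) - n) * c n + Δ * S := by
      rw [hS, Finset.mul_sum, ← Finset.sum_add_distrib]
      refine Finset.sum_congr rfl fun n _ => ?_
      push_cast
      ring
    rw [this]
    push_cast
    ring
  rw [e1] at hmain
  have hTb : ‖T‖ ≤ Δ * ((Δ + 1) * Real.log (2 * x)) := by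
    have h1 : ‖T‖ ≤ ∑ n ∈ Ioc ⌊x⌋₊ ⌊x + Δ⌋₊, Δ * Real.log (2 * x) := by
      refine norm_sum_le_of_le _ fun n hn => ?_
      rw [Finset.mem_Ioc] at hn
      have hn1 : x < n := Nat.lt_of_floor_lt hn.1
      have hn2 : (n : ℝ) ≤ x + Δ := (Nat.le_floor_iff (by linarith)).1 hn.2
      rw [norm_mul]
      have : ‖((x + Δ : ℝ) : ℂ) - n‖ ≤ Δ := by
        have : (((x + Δ : ℝ) : ℂ) - n) = ((x + Δ - n : ℝ) : ℂ) := by push_cast; ring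
        rw [this, Complex.norm_real, Real.norm_of_nonneg (by linarith)]
        linarith
      have h2 : Real.log n ≤ Real.log (2 * x) := Real.log_le_log (by linarith) (by linarith)
      have h3 := (hlog n).trans h2
      gcongr
    rw [Finset.sum_const, Nat.card_Ioc, nsmul_eq_mul] at h1
    have h2 : ((⌊x + Δ⌋₊ - ⌊x⌋₊ : ℕ) : ℝ) ≤ Δ + 1 := by
      rw [Nat.cast_sub hfloor]
      have := Nat.floor_le (by linarith : 0 ≤ x + Δ)
      have := Nat.lt_floor_add_one x
      linarith
    have h4 : 0 ≤ Real.log (2 * x) := Real.log_nonneg (by linarith)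
    calc ‖T‖ ≤ _ := h1
      _ ≤ (Δ + 1) * (Δ * Real.log (2 * x)) := by gcongr
      _ = _ := by ring
  have hκb : ‖κ * (Δ * (Δ / 2 - 1) : ℂ)‖ ≤ Δ * (Δ + 1) := by
    rw [norm_mul]
    have : (Δ * (Δ / 2 - 1) : ℂ) = ((Δ * (Δ / 2 - 1) : ℝ) : ℂ) := by push_cast; ring
    rw [this, Complex.norm_real, Real.norm_eq_abs, abs_mul, abs_of_pos (by linarith : 0 < Δ)]
    have h5 : |Δ / 2 - 1| ≤ Δ + 1 := by rw [abs_le]; constructor <;> linarith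
    calc ‖κ‖ * (Δ * |Δ / 2 - 1|) ≤ 1 * (Δ * (Δ + 1)) := by gcongr
      _ = _ := one_mul _
  have hfin : Δ * ‖S - κ * x‖ ≤ Δ * (C * B * ((2 * x) ^ (1 / 2 + η) * (4 * x / Δ) ^ (2 * η)) +
      ((Δ + 1) * Real.log (2 * x) + (Δ + 1))) := by
    have e2 : Δ * ‖S - κ * x‖ = ‖(Δ : ℂ) * (S - κ * x)‖ := by
      rw [norm_mul, Complex.norm_real, Real.norm_of_nonneg (by linarith)]
    have e3 : (Δ : ℂ) * (S - κ * x) = (Δ * (S - κ * x) + (T - κ * (Δ * (Δ / 2 - 1)))) -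
        T + κ * (Δ * (Δ / 2 - 1)) := by ring
    rw [e2, e3]
    refine (norm_add_le _ _).trans ?_
    have := norm_sub_le (Δ * (S - κ * x) + (T - κ * (Δ * (Δ / 2 - 1)))) T
    calc _ ≤ C * B * (Δ * (2 * x) ^ (1 / 2 + η) * (4 * x / Δ) ^ (2 * η)) +
        Δ * ((Δ + 1) * Real.log (2 * x)) + Δ * (Δ + 1) := by linarith
      _ = _ := by ring
  have hfin2 := le_of_mul_le_mul_left hfin (by linarith : 0 < Δ)
  have hxp : 0 < x ^ (1 / 2 + 2 * η) := by positivity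
  have e5 : Δ = x ^ (1 / 2 : ℝ) := by rw [hΔdef, Real.sqrt_eq_rpow]
  have h6 : (2 * x) ^ (1 / 2 + η) ≤ 2 * x ^ (1 / 2 + η) := by
    rw [Real.mul_rpow (by norm_num) hx0.le]
    gcongr
    calc (2 : ℝ) ^ (1 / 2 + η) ≤ 2 ^ (1 : ℝ) :=
          Real.rpow_le_rpow_of_exponent_le (by norm_num) (by linarith)
      _ = 2 := by simp
  have h7 : (4 * x / Δ) ^ (2 * η) ≤ 4 * x ^ η := by
    have : 4 * x / Δ = 4 * Δ := by rw [← hΔsq]; field_simp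
    rw [this, Real.mul_rpow (by norm_num) (by linarith), e5, ← Real.rpow_mul hx0.le]
    have : 1 / 2 * (2 * η) = η := by ring
    rw [this]
    gcongr
    calc (4 : ℝ) ^ (2 * η) ≤ 4 ^ (1 : ℝ) :=
          Real.rpow_le_rpow_of_exponent_le (by norm_num) (by linarith)
      _ = 4 := by simp
  have h8 : (2 * x) ^ (1 / 2 + η) * (4 * x / Δ) ^ (2 * η) ≤ 8 * x ^ (1 / 2 + 2 * η) := by
    calc _ ≤ (2 * x ^ (1 / 2 + η)) * (4 * x ^ η) := by gcongr
      _ = 8 * (x ^ (1 / 2 + η) * x ^ η) := by ring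
      _ = _ := by rw [← Real.rpow_add hx0]; congr 2; ring
  have h9 : Δ + 1 ≤ 2 * x ^ (1 / 2 : ℝ) := by rw [← e5]; linarith
  have h10 : Real.log (2 * x) ≤ 2 / η * x ^ η := by
    calc Real.log (2 * x) ≤ (2 * x) ^ η / η := Real.log_le_rpow_div (by linarith) hη
      _ ≤ (2 * x ^ η) / η := by
          rw [Real.mul_rpow (by norm_num) hx0.le]
          gcongr
          calc (2 : ℝ) ^ η ≤ 2 ^ (1 : ℝ) :=
                Real.rpow_le_rpow_of_exponent_le (by norm_num) (by linarith)
            _ = 2 := by simp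
      _ = _ := by ring
  have h11 : x ^ (1 / 2 : ℝ) * x ^ η ≤ x ^ (1 / 2 + 2 * η) := by
    rw [← Real.rpow_add hx0]
    exact Real.rpow_le_rpow_of_exponent_le hx (by linarith)
  have h12 : x ^ (1 / 2 : ℝ) ≤ x ^ (1 / 2 + 2 * η) :=
    Real.rpow_le_rpow_of_exponent_le hx (by linarith)
  have h13 : 0 ≤ Real.log (2 * x) := Real.log_nonneg (by linarith)
  calc ‖S - κ * x‖ ≤ _ := hfin2
    _ ≤ C * B * (8 * x ^ (1 / 2 + 2 * η)) + ((2 * x ^ (1 / 2 : ℝ)) * (2 / η * x ^ η) +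
        2 * x ^ (1 / 2 : ℝ)) := by gcongr
    _ = 8 * C * B * x ^ (1 / 2 + 2 * η) + (4 / η * (x ^ (1 / 2 : ℝ) * x ^ η) +
        2 * x ^ (1 / 2 : ℝ)) := by ring
    _ ≤ 8 * C * B * x ^ (1 / 2 + 2 * η) + (4 / η * x ^ (1 / 2 + 2 * η) +
        2 * x ^ (1 / 2 + 2 * η)) := by gcongr
    _ = (8 * C * B + (4 / η + 2)) * x ^ (1 / 2 + 2 * η) := by ring
    _ ≤ (8 * C + (8 / η + 4)) * (B + 1) * x ^ (1 / 2 + 2 * η) := by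
        gcongr
        have h14 : 4 / η ≤ 8 / η := by gcongr; norm_num
        have h15 : 0 < 8 / η := by positivity
        nlinarith [mul_nonneg hB0 h15.le]

/-- The square-root bound for character sums over prime powers. -/
theorem norm_sum_char_vonMangoldt_le (hGRH : GeneralizedRiemannHypothesis) {ε : ℝ} (hε : 0 < ε)
    (hε1 : ε ≤ 1 / 2) :
    ∃ C > 0, ∀ (q : ℕ) [NeZero q] (χ : DirichletCharacter ℂ q), χ ≠ 1 → ∀ x : ℝ, 1 ≤ x →
      ‖∑ n ∈ Ioc 0 ⌊x⌋₊, χ n * (ArithmeticFunction.vonMangoldt n : ℂ)‖ ≤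
        C * (q : ℝ) ^ ε * x ^ (1 / 2 + ε) := by
  obtain ⟨C₁, hC₁, h₁⟩ := norm_logDeriv_LFunction_le hGRH (η := ε / 2) (by linarith) (by linarith)
    (ε := ε / 4) (by linarith)
  obtain ⟨C₂, hC₂, h₂⟩ := norm_sum_sub_le (η := ε / 2) (by linarith) (by linarith)
  refine ⟨C₂ * (C₁ + 1), by positivity, ?_⟩
  intro q _ χ hχ x hx
  have hq1 : (1 : ℝ) ≤ q := by exact_mod_cast NeZero.one_le
  have h := h₂ (fun n => χ n * (ArithmeticFunction.vonMangoldt n : ℂ))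
    (fun s => -(deriv (DirichletCharacter.LFunction χ) s / DirichletCharacter.LFunction χ s)) 0
    (C₁ * (q : ℝ) ^ (ε / 4))
    (DirichletCharacter.LSeriesSummable_twist_vonMangoldt χ (s := 2) (by simp)) (by simp)
    (by
      intro n
      rw [norm_mul, Complex.norm_real, Real.norm_of_nonneg ArithmeticFunction.vonMangoldt_nonneg]
      calc _ ≤ 1 * ArithmeticFunction.vonMangoldt n := by
            gcongr
            exact DirichletCharacter.norm_le_one χ _
        _ ≤ _ := by rw [one_mul]; exact ArithmeticFunction.vonMangoldt_le_log)
    (by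
      intro s hs _
      have hd := DirichletCharacter.differentiable_LFunction hχ
      exact ((hd.contDiff (n := 2)).differentiable_deriv_two s |>.div (hd s)
        (LFunction_ne_zero_of_half_lt_re hGRH (Or.inl hχ) (by linarith))).neg)
    (by
      intro s hs hs2
      rw [norm_neg]
      refine (h₁ q χ hχ s hs hs2).trans_eq ?_
      congr 2
      ring)
    (by
      intro s hs
      have hs1 : 1 < s.re := by rw [hs]; norm_num
      rw [DirichletCharacter.deriv_LFunction_eq_deriv_LSeries χ hs1,
        DirichletCharacter.LFunction_eq_LSeries χ hs1, zero_div, sub_zero, ← neg_div]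
      exact (DirichletCharacter.LSeries_twist_vonMangoldt_eq χ hs1).symm) x hx
  rw [zero_mul, sub_zero] at h
  refine h.trans ?_
  have h5 : (q : ℝ) ^ (ε / 4) ≤ (q : ℝ) ^ ε :=
    Real.rpow_le_rpow_of_exponent_le hq1 (by linarith)
  have h6 : 1 ≤ (q : ℝ) ^ ε := Real.one_le_rpow hq1 hε.le
  have e : 2 * (ε / 2) = ε := by ring
  rw [e]
  calc C₂ * (C₁ * (q : ℝ) ^ (ε / 4) + 1) * x ^ (1 / 2 + ε)
      ≤ C₂ * (C₁ * (q : ℝ) ^ ε + (q : ℝ) ^ ε) * x ^ (1 / 2 + ε) := by gcongr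
    _ = _ := by ring

theorem abs_psi_sub_le (hGRH : GeneralizedRiemannHypothesis) {ε : ℝ} (hε : 0 < ε)
    (hε1 : ε ≤ 1 / 2) :
    ∃ C > 0, ∀ x : ℝ, 1 ≤ x → |Chebyshev.psi x - x| ≤ C * x ^ (1 / 2 + ε) := by
  obtain ⟨C₁, hC₁, h₁⟩ := norm_logDeriv_subOneMulZeta_le hGRH (η := ε / 2) (by linarith)
    (by linarith) (ε := ε / 4) (by linarith)
  obtain ⟨C₂, hC₂, h₂⟩ := norm_sum_sub_le (η := ε / 2) (by linarith) (by linarith)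
  refine ⟨C₂ * (C₁ + 1), by positivity, ?_⟩
  intro x hx
  have h := h₂ (fun n => (ArithmeticFunction.vonMangoldt n : ℂ))
    (fun s => -(deriv subOneMulZeta s / subOneMulZeta s)) 1 C₁
    (ArithmeticFunction.LSeriesSummable_vonMangoldt (s := 2) (by simp)) (by simp)
    (by
      intro n
      rw [Complex.norm_real, Real.norm_of_nonneg ArithmeticFunction.vonMangoldt_nonneg]
      exact ArithmeticFunction.vonMangoldt_le_log)
    (by
      intro s hs _
      have hd := differentiable_subOneMulZeta
      exact ((hd.contDiff (n := 2)).differentiable_deriv_two s |>.div (hd s)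
        (subOneMulZeta_ne_zero hGRH (by linarith))).neg)
    (by
      intro s hs hs2
      rw [norm_neg]
      refine (h₁ s hs hs2).trans_eq ?_
      congr 2
      ring)
    (by
      intro s hs
      have hs1 : 1 < s.re := by rw [hs]; norm_num
      have hne : s ≠ 1 := by rintro rfl; simp at hs1
      have hL := ArithmeticFunction.LSeries_vonMangoldt_eq_deriv_riemannZeta_div hs1
      have hev : subOneMulZeta =ᶠ[𝓝 s] fun z => (z - 1) * riemannZeta z := by
        filter_upwards [isOpen_ne.mem_nhds hne] with z hz
        exact subOneMulZeta_of_ne_one hz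
      have hder : deriv subOneMulZeta s = riemannZeta s + (s - 1) * deriv riemannZeta s := by
        rw [hev.deriv_eq]
        have h1 : HasDerivAt (fun z : ℂ => z - 1) 1 s := (hasDerivAt_id s).sub_const 1
        have h2 := (differentiableAt_riemannZeta hne).hasDerivAt
        rw [show (fun z : ℂ => (z - 1) * riemannZeta z) = (fun z : ℂ => z - 1) * riemannZeta from rfl,
          (h1.mul h2).deriv]
        ring
      have hz : riemannZeta s ≠ 0 := riemannZeta_ne_zero_of_one_lt_re hs1
      have hs0 : s - 1 ≠ 0 := sub_ne_zero.2 hne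
      rw [hder, subOneMulZeta_of_ne_one hne]
      have hL' : LSeries (fun n => (ArithmeticFunction.vonMangoldt n : ℂ)) s =
        -deriv riemannZeta s / riemannZeta s := hL
      rw [hL']
      field_simp
      ring) x hx
  have e : 2 * (ε / 2) = ε := by ring
  rw [e] at h
  have : ((Chebyshev.psi x - x : ℝ) : ℂ) =
      ∑ n ∈ Ioc 0 ⌊x⌋₊, (ArithmeticFunction.vonMangoldt n : ℂ) - 1 * x := by
    rw [Chebyshev.psi]
    push_cast
    ring
  rw [← this, Complex.norm_real, Real.norm_eq_abs] at h
  exact h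

theorem sqrt_mul_log_le {ε x : ℝ} (hε : 0 < ε) (hx : 1 ≤ x) :
    2 * √x * Real.log x ≤ 2 / ε * x ^ (1 / 2 + ε) := by
  have hx0 : 0 < x := by linarith
  rw [Real.sqrt_eq_rpow, Real.rpow_add hx0]
  have := Real.log_le_rpow_div hx0.le hε
  calc _ ≤ 2 * x ^ (1 / 2 : ℝ) * (x ^ ε / ε) := by gcongr
    _ = _ := by ring

/-- The square-root bound for character sums over primes. -/
theorem norm_sum_char_log_prime_le (hGRH : GeneralizedRiemannHypothesis) {ε : ℝ} (hε : 0 < ε)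
    (hε1 : ε ≤ 1 / 2) :
    ∃ C > 0, ∀ (q : ℕ) [NeZero q] (χ : DirichletCharacter ℂ q), χ ≠ 1 → ∀ x : ℝ, 1 ≤ x →
      ‖∑ p ∈ Ioc 0 ⌊x⌋₊ with p.Prime, χ p * (Real.log p : ℂ)‖ ≤
        C * (q : ℝ) ^ ε * x ^ (1 / 2 + ε) := by
  obtain ⟨C, hC, h⟩ := norm_sum_char_vonMangoldt_le hGRH hε hε1
  refine ⟨C + 2 / ε, by positivity, ?_⟩
  intro q _ χ hχ x hx
  have hq1 : (1 : ℝ) ≤ q := by exact_mod_cast NeZero.one_le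
  have h1 := h q χ hχ x hx
  have hsplit := Finset.sum_filter_add_sum_filter_not (Ioc 0 ⌊x⌋₊) Nat.Prime
    (fun n : ℕ => χ n * (ArithmeticFunction.vonMangoldt n : ℂ))
  have e1 : ∑ n ∈ Ioc 0 ⌊x⌋₊ with n.Prime, χ n * (ArithmeticFunction.vonMangoldt n : ℂ) =
      ∑ p ∈ Ioc 0 ⌊x⌋₊ with p.Prime, χ p * (Real.log p : ℂ) := by
    refine Finset.sum_congr rfl fun p hp => ?_
    rw [ArithmeticFunction.vonMangoldt_apply_prime (Finset.mem_filter.1 hp).2]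
  rw [e1] at hsplit
  have h2 : ‖∑ n ∈ Ioc 0 ⌊x⌋₊ with ¬ n.Prime, χ n * (ArithmeticFunction.vonMangoldt n : ℂ)‖ ≤
      2 * √x * Real.log x := by
    refine le_trans (norm_sum_le_of_le (f := fun n : ℕ => χ n * (ArithmeticFunction.vonMangoldt n : ℂ)) _
      (n := fun n : ℕ => ArithmeticFunction.vonMangoldt n) fun n _ => ?_) ?_
    · rw [norm_mul, Complex.norm_real, Real.norm_of_nonneg ArithmeticFunction.vonMangoldt_nonneg]
      exact mul_le_of_le_one_left ArithmeticFunction.vonMangoldt_nonneg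
        (DirichletCharacter.norm_le_one χ _)
    · rw [← Chebyshev.psi_sub_theta_eq_sum_not_prime]
      exact (le_abs_self _).trans (Chebyshev.abs_psi_sub_theta_le_sqrt_mul_log hx)
  have h3 := sqrt_mul_log_le hε hx
  have hq : 1 ≤ (q : ℝ) ^ ε := Real.one_le_rpow hq1 hε.le
  have h4 : ∑ p ∈ Ioc 0 ⌊x⌋₊ with p.Prime, χ p * (Real.log p : ℂ) =
    ∑ n ∈ Ioc 0 ⌊x⌋₊, χ n * (ArithmeticFunction.vonMangoldt n : ℂ) -
    ∑ n ∈ Ioc 0 ⌊x⌋₊ with ¬ n.Prime, χ n * (ArithmeticFunction.vonMangoldt n : ℂ) :=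
    eq_sub_of_add_eq hsplit
  rw [h4]
  refine (norm_sub_le _ _).trans ?_
  have h5 : 2 / ε * x ^ (1 / 2 + ε) ≤ 2 / ε * (q : ℝ) ^ ε * x ^ (1 / 2 + ε) := by
    gcongr
    exact le_mul_of_one_le_right (by positivity) hq
  linarith

theorem abs_theta_sub_le (hGRH : GeneralizedRiemannHypothesis) {ε : ℝ} (hε : 0 < ε)
    (hε1 : ε ≤ 1 / 2) :
    ∃ C > 0, ∀ x : ℝ, 1 ≤ x → |Chebyshev.theta x - x| ≤ C * x ^ (1 / 2 + ε) := by
  obtain ⟨C, hC, h⟩ := abs_psi_sub_le hGRH hε hε1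
  refine ⟨C + 2 / ε, by positivity, ?_⟩
  intro x hx
  have h1 := h x hx
  have h2 := Chebyshev.abs_psi_sub_theta_le_sqrt_mul_log hx
  have h3 := sqrt_mul_log_le hε hx
  rw [abs_le] at *
  constructor <;> linarith

theorem jacobiSym_eq_of_mod_eq (k : ℤ) {m n : ℕ} (hm : Odd m) (hn : Odd n)
    (h : m % (4 * k.natAbs) = n % (4 * k.natAbs)) : jacobiSym k m = jacobiSym k n := by
  rw [jacobiSym.mod_right k hm, jacobiSym.mod_right k hn, h]

/-- The Dirichlet character attached to the Jacobi symbol `(k / ·)`. -/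
noncomputable def jacobiChar (k : ℤ) (hk : k ≠ 0) : DirichletCharacter ℂ (4 * k.natAbs) where
  toFun x := if Odd x.val then (jacobiSym k x.val : ℂ) else 0
  map_one' := by
    have hN : 1 < 4 * k.natAbs := by have := Int.natAbs_pos.2 hk; lia
    have : Fact (1 < 4 * k.natAbs) := ⟨hN⟩
    simp [ZMod.val_one]
  map_mul' x y := by
    have : NeZero (4 * k.natAbs) := ⟨by have := Int.natAbs_pos.2 hk; lia⟩
    have hpar : Odd (x * y).val ↔ Odd (x.val * y.val) := by
      rw [ZMod.val_mul, Nat.odd_iff, Nat.odd_iff, Nat.mod_mod_of_dvd _ (by lia : 2 ∣ 4 * k.natAbs)]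
    by_cases h : Odd (x.val * y.val)
    · have hx := (Nat.odd_mul.1 h).1
      have hy := (Nat.odd_mul.1 h).2
      rw [if_pos (hpar.2 h), if_pos hx, if_pos hy, ← Int.cast_mul]
      congr 1
      rw [← jacobiSym.mul_right' k hx.pos.ne' hy.pos.ne']
      refine jacobiSym_eq_of_mod_eq k (hpar.2 h) h ?_
      rw [ZMod.val_mul, Nat.mod_mod]
    · rw [if_neg (fun h' => h (hpar.1 h'))]
      rw [Nat.odd_mul, not_and_or] at h
      rcases h with h | h <;> simp [h]
  map_nonunit' x hx := by
    have : NeZero (4 * k.natAbs) := ⟨by have := Int.natAbs_pos.2 hk; lia⟩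
    by_cases h : Odd x.val
    · rw [if_pos h]
      have hc : ¬ x.val.Coprime (4 * k.natAbs) := by
        intro hc
        apply hx
        have := (ZMod.isUnit_iff_coprime x.val (4 * k.natAbs)).2 hc
        rwa [ZMod.natCast_zmod_val] at this
      have h2 : ¬ x.val.Coprime k.natAbs := by
        intro h2
        refine hc (Nat.Coprime.mul_right ?_ h2)
        exact (Nat.coprime_two_right.2 h).pow_right 2
      have : jacobiSym k x.val = 0 := by
        rw [jacobiSym.eq_zero_iff]
        refine ⟨h.pos.ne', fun h3 => h2 ?_⟩
        rw [Nat.coprime_comm]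
        rw [Int.gcd, Int.natAbs_natCast] at h3
        exact h3
      simp [this]
    · rw [if_neg h]

theorem jacobiChar_natCast (k : ℤ) (hk : k ≠ 0) {n : ℕ} (hn : Odd n) :
    jacobiChar k hk n = jacobiSym k n := by
  have hdef : jacobiChar k hk n = if Odd (n : ZMod (4 * k.natAbs)).val then
    (jacobiSym k (n : ZMod (4 * k.natAbs)).val : ℂ) else 0 := rfl
  have hodd : Odd (n : ZMod (4 * k.natAbs)).val := by
    rw [ZMod.val_natCast, Nat.odd_iff, Nat.mod_mod_of_dvd _ (by lia : 2 ∣ 4 * k.natAbs)]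
    exact Nat.odd_iff.1 hn
  rw [hdef, if_pos hodd, ZMod.val_natCast, ← jacobiSym.mod_right k hn]

theorem jacobiSym_sign_eq_one {n : ℕ} (hn : n % 4 = 1) {k : ℤ} (hk : k ≠ 0) :
    jacobiSym k n = jacobiSym k.natAbs n := by
  have h1 : jacobiSym (-1) n = 1 := by
    rw [jacobiSym.at_neg_one (Nat.odd_iff.2 (by lia)), ZMod.χ₄_nat_one_mod_four hn]
  rcases lt_or_gt_of_ne hk with h | h
  · have : k = -1 * (k.natAbs : ℤ) := by lia
    conv_lhs => rw [this]
    rw [jacobiSym.mul_left, h1, one_mul]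
  · have : k = (k.natAbs : ℤ) := by lia
    conv_lhs => rw [this]

theorem exists_jacobiSym_eq_neg_one_of_odd_prime {k : ℤ} (hk : k ≠ 0) {p e m : ℕ} (hp : p.Prime)
    (hp2 : p ≠ 2) (hkm : k.natAbs = p ^ e * m) (he : Odd e) (hm : ¬ p ∣ m) :
    ∃ n : ℕ, Odd n ∧ jacobiSym k n = -1 := by
  have := Fact.mk hp
  obtain ⟨r, hr⟩ := FiniteField.exists_nonsquare (F := ZMod p) (by rwa [ZMod.ringChar_zmod_n])
  have hcop : Nat.Coprime p (4 * m) := by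
    refine Nat.Coprime.mul_right ?_ ((Nat.Prime.coprime_iff_not_dvd hp).2 hm)
    exact (Nat.coprime_two_right.2 (hp.odd_of_ne_two hp2)).pow_right 2
  obtain ⟨n, hn1, hn2⟩ := Nat.chineseRemainder hcop r.val 1
  have hm0 : m ≠ 0 := by rintro rfl; simp at hm
  have hn4 : n % 4 = 1 := by
    have := hn2.of_mul_right m
    simpa [Nat.ModEq] using this
  have hodd : Odd n := Nat.odd_iff.2 (by lia)
  refine ⟨n, hodd, ?_⟩
  rw [jacobiSym_sign_eq_one hn4 hk, hkm, Nat.cast_mul, jacobiSym.mul_left, Nat.cast_pow,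
    jacobiSym.pow_left]
  have h1 : jacobiSym (m : ℤ) n = 1 := by
    rw [jacobiSym.mod_right _ hodd, Int.natAbs_natCast, hn2]
    rw [Nat.mod_eq_of_lt (by lia), jacobiSym.one_right]
  have h2 : jacobiSym (p : ℤ) n = -1 := by
    rw [← jacobiSym.quadratic_reciprocity_one_mod_four hn4 (hp.odd_of_ne_two hp2),
      ZMod.nonsquare_iff_jacobiSym_eq_neg_one]
    have : ((n : ℤ) : ZMod p) = r := by
      have := (ZMod.natCast_eq_natCast_iff _ _ _).2 hn1
      rw [ZMod.natCast_zmod_val] at this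
      simpa using this
    rwa [this]
  rw [h1, h2, mul_one, he.neg_one_pow]

theorem exists_jacobiSym_eq_neg_one {k : ℤ} (hk : ¬ IsSquare k) :
    ∃ n : ℕ, Odd n ∧ jacobiSym k n = -1 := by
  have hk0 : k ≠ 0 := by rintro rfl; exact hk (IsSquare.zero)
  obtain ⟨s, b, hsb, hs⟩ := Nat.sq_mul_squarefree k.natAbs
  have hka : k.natAbs ≠ 0 := Int.natAbs_ne_zero.2 hk0
  have hb0 : b ≠ 0 := by rintro rfl; simp at hsb; lia
  by_cases hodd : ∃ p, p.Prime ∧ p ≠ 2 ∧ p ∣ s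
  · obtain ⟨p, hp, hp2, hps⟩ := hodd
    obtain ⟨t, rfl⟩ := hps
    have hpt : ¬ p ∣ t := by
      intro h
      obtain ⟨u, rfl⟩ := h
      have := hs p ⟨u, by ring⟩
      exact hp.one_lt.ne' (Nat.isUnit_iff.1 this)
    obtain ⟨e, c, hc, hbe⟩ := Nat.exists_eq_pow_mul_and_not_dvd hb0 p hp.ne_one
    refine exists_jacobiSym_eq_neg_one_of_odd_prime hk0 hp hp2 (e := 2 * e + 1) (m := c ^ 2 * t)
      ?_ ⟨e, rfl⟩ ?_
    · rw [← hsb, hbe]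
      ring
    · intro h
      rcases hp.dvd_mul.1 h with h | h
      · exact hc (hp.dvd_of_dvd_pow h)
      · exact hpt h
  · have hs2 : s = 1 ∨ s = 2 := by
      have h1 : ∀ p, p.Prime → p ∣ s → p = 2 := fun p hp h => by
        by_contra h2
        exact hodd ⟨p, hp, h2, h⟩
      have h3 := Nat.eq_prime_pow_of_unique_prime_dvd hs.ne_zero (fun {d} hd h => h1 d hd h)
      have : s.primeFactorsList.length ≤ 1 := by
        by_contra! h4
        have : 2 * 2 ∣ s := by
          rw [h3]
          exact (by norm_num : 2 * 2 = 2 ^ 2) ▸ pow_dvd_pow 2 h4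
        have := Nat.isUnit_iff.1 (hs 2 this)
        lia
      interval_cases h : s.primeFactorsList.length
      · left; simpa using h3
      · right; simpa using h3
    rcases hs2 with rfl | rfl
    · have hneg : k = -1 * (b : ℤ) ^ 2 := by
        rcases Int.natAbs_eq k with h | h
        · exfalso
          apply hk
          rw [h, ← hsb]
          exact ⟨b, by push_cast; ring⟩
        · rw [h, ← hsb]
          push_cast
          ring
      have hb1 : 1 ≤ b := Nat.pos_of_ne_zero hb0
      have hodd' : Odd (4 * b - 1) := Nat.odd_iff.2 (by lia)
      refine ⟨4 * b - 1, hodd', ?_⟩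
      have hcop : Nat.Coprime b (4 * b - 1) := by
        have h1 : Nat.gcd b (4 * b - 1) ∣ 1 := by
          have h2 : 4 * b - (4 * b - 1) = 1 := by lia
          have h3 := Nat.dvd_sub ((Nat.gcd_dvd_left b (4 * b - 1)).mul_left 4)
            (Nat.gcd_dvd_right b (4 * b - 1))
          rwa [h2] at h3
        exact Nat.dvd_one.1 h1
      rw [hneg, jacobiSym.mul_left, jacobiSym.sq_one' (by simpa [Int.gcd] using hcop), mul_one,
        jacobiSym.at_neg_one hodd', ZMod.χ₄_nat_three_mod_four (by lia)]
    · obtain ⟨j, c, hc, hbc⟩ := Nat.exists_eq_pow_mul_and_not_dvd hb0 2 (by norm_num)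
      have hcodd : Odd c := Nat.odd_iff.2 (by lia)
      have hcop : Nat.Coprime 8 c := by
        have := (Nat.coprime_two_left.2 hcodd).pow_left 3
        simpa using this
      obtain ⟨n, hn1, hn2⟩ := Nat.chineseRemainder hcop 5 1
      have hn8 : n % 8 = 5 := by simpa [Nat.ModEq] using hn1
      have hn : Odd n := Nat.odd_iff.2 (by lia)
      refine ⟨n, hn, ?_⟩
      have hcn : Nat.Coprime c n := by
        rw [Nat.coprime_comm, Nat.Coprime, hn2.gcd_eq]
        simp
      have hbn : Nat.Coprime b n := by
        rw [hbc]
        exact Nat.Coprime.mul_left ((Nat.coprime_two_left.2 hn).pow_left j) hcn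
      rw [jacobiSym_sign_eq_one (by lia) hk0, ← hsb, Nat.cast_mul, jacobiSym.mul_left, Nat.cast_pow,
        jacobiSym.sq_one' (by simpa [Int.gcd] using hbn), one_mul]
      have : ((2 : ℕ) : ℤ) = 2 := rfl
      rw [this, jacobiSym.at_two hn, ZMod.χ₈_nat_eq_if_mod_eight]
      simp [hn8]
      lia

theorem jacobiChar_ne_one {k : ℤ} (hk0 : k ≠ 0) (hk : ¬ IsSquare k) : jacobiChar k hk0 ≠ 1 := by
  intro h
  obtain ⟨n, hn, hJ⟩ := exists_jacobiSym_eq_neg_one hk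
  have h1 := jacobiChar_natCast k hk0 hn
  rw [h, hJ] at h1
  by_cases hu : IsUnit (n : ZMod (4 * k.natAbs))
  · rw [MulChar.one_apply hu] at h1
    norm_num at h1
  · rw [MulChar.map_nonunit _ hu] at h1
    norm_num at h1

/-- The square-root bound for sums of Jacobi symbols over odd primes. -/
theorem abs_sum_jacobiSym_log_le (hGRH : GeneralizedRiemannHypothesis) {ε : ℝ} (hε : 0 < ε)
    (hε1 : ε ≤ 1 / 2) :
    ∃ C > 0, ∀ k : ℤ, ¬ IsSquare k → ∀ x : ℝ, 1 ≤ x →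
      |∑ p ∈ Ioc 0 ⌊x⌋₊ with p.Prime, (jacobiSym k p : ℝ) * Real.log p| ≤
        C * |(k : ℝ)| ^ ε * x ^ (1 / 2 + ε) := by
  obtain ⟨C, hC, h⟩ := norm_sum_char_log_prime_le hGRH hε hε1
  refine ⟨C * 4 ^ ε + 2, by positivity, ?_⟩
  intro k hk x hx
  have hk0 : k ≠ 0 := by rintro rfl; exact hk (IsSquare.zero)
  have : NeZero (4 * k.natAbs) := ⟨by have := Int.natAbs_pos.2 hk0; lia⟩
  have h1 := h (4 * k.natAbs) (jacobiChar k hk0) (jacobiChar_ne_one hk0 hk) x hx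
  have hkabs : ((k.natAbs : ℕ) : ℝ) = |(k : ℝ)| := by rw [Nat.cast_natAbs, Int.cast_abs]
  have hk1 : (1 : ℝ) ≤ |(k : ℝ)| := by
    rw [← hkabs]; exact_mod_cast Int.natAbs_pos.2 hk0
  rw [Nat.cast_mul, hkabs, Nat.cast_ofNat, Real.mul_rpow (by norm_num) (by positivity)] at h1
  set f : ℕ → ℂ := fun p => jacobiChar k hk0 p * (Real.log p : ℂ)
  set g : ℕ → ℂ := fun p => (((jacobiSym k p : ℝ) * Real.log p : ℝ) : ℂ)
  have hfg : ∑ p ∈ Ioc 0 ⌊x⌋₊ with p.Prime, ‖g p - f p‖ ≤ 2 := by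
    have h0 : ∀ p ∈ (Ioc 0 ⌊x⌋₊).filter Nat.Prime, p ≠ 2 → ‖g p - f p‖ = 0 := by
      intro p hp hp2
      have hpo := (Finset.mem_filter.1 hp).2.odd_of_ne_two hp2
      simp only [f, g]
      rw [jacobiChar_natCast k hk0 hpo]
      push_cast
      simp
    have h2 : ‖g 2 - f 2‖ ≤ 2 := by
      have hl : Real.log 2 ≤ 1 := by linarith [Real.log_two_lt_d9]
      have hl0 : 0 ≤ Real.log 2 := Real.log_nonneg (by norm_num)
      refine (norm_sub_le _ _).trans ?_
      have e1 : ‖g 2‖ ≤ 1 := by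
        simp only [g]
        rw [Complex.norm_real, Real.norm_eq_abs, abs_mul, Nat.cast_ofNat, abs_of_nonneg hl0]
        have : |(jacobiSym k 2 : ℝ)| ≤ 1 := by
          rcases jacobiSym.trichotomy k 2 with h | h | h <;> simp [h]
        calc _ ≤ 1 * Real.log 2 := by gcongr
          _ ≤ 1 := by linarith
      have e2 : ‖f 2‖ ≤ 1 := by
        simp only [f]
        rw [norm_mul, Complex.norm_real, Real.norm_eq_abs, Nat.cast_ofNat (R := ℝ),
          abs_of_nonneg hl0]
        have := DirichletCharacter.norm_le_one (jacobiChar k hk0) ((2 : ℕ) : ZMod (4 * k.natAbs))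
        calc _ ≤ 1 * Real.log 2 := by gcongr
          _ ≤ 1 := by linarith
      linarith
    by_cases hm : 2 ∈ (Ioc 0 ⌊x⌋₊).filter Nat.Prime
    · rw [Finset.sum_eq_single_of_mem 2 hm h0]
      exact h2
    · rw [Finset.sum_eq_zero]
      · norm_num
      · intro p hp
        exact h0 p hp (by rintro rfl; exact hm hp)
  have h3 : ‖∑ p ∈ Ioc 0 ⌊x⌋₊ with p.Prime, g p‖ ≤
      2 + ‖∑ p ∈ Ioc 0 ⌊x⌋₊ with p.Prime, f p‖ := by
    have : ∑ p ∈ Ioc 0 ⌊x⌋₊ with p.Prime, g p = ∑ p ∈ Ioc 0 ⌊x⌋₊ with p.Prime, (g p - f p) +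
        ∑ p ∈ Ioc 0 ⌊x⌋₊ with p.Prime, f p := by
      rw [Finset.sum_sub_distrib]; ring
    rw [this]
    refine (norm_add_le _ _).trans ?_
    gcongr
    exact (norm_sum_le _ _).trans hfg
  have h4 : ‖∑ p ∈ Ioc 0 ⌊x⌋₊ with p.Prime, g p‖ =
      |∑ p ∈ Ioc 0 ⌊x⌋₊ with p.Prime, (jacobiSym k p : ℝ) * Real.log p| := by
    simp only [g]
    rw [← Complex.ofReal_sum, Complex.norm_real, Real.norm_eq_abs]
  rw [← h4]
  have h5 : 1 ≤ |(k : ℝ)| ^ ε * x ^ (1 / 2 + ε) := by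
    have e1 : 1 ≤ |(k : ℝ)| ^ ε := Real.one_le_rpow hk1 hε.le
    have e2 : 1 ≤ x ^ (1 / 2 + ε) := Real.one_le_rpow hx (by linarith)
    nlinarith
  calc _ ≤ 2 + C * (4 ^ ε * |(k : ℝ)| ^ ε) * x ^ (1 / 2 + ε) := h3.trans (by gcongr)
    _ ≤ _ := by linarith

theorem tsum_int_eq_sum_residues (N : ℕ) [NeZero N] {f : ℤ → ℂ} (hf : Summable f) :
    ∑' n, f n = ∑ r : ZMod N, ∑' m : ℤ, f (m * N + r.val) := by
  obtain ⟨M, rfl⟩ := Nat.exists_eq_succ_of_ne_zero (NeZero.ne N)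
  have h1 := (Int.divModEquiv (M + 1)).symm.tsum_eq f
  have h2 : Summable fun q : ℤ × Fin (M + 1) => f ((Int.divModEquiv (M + 1)).symm q) :=
    (Int.divModEquiv (M + 1)).symm.summable_iff.2 hf
  have h3 : Summable fun q : Fin (M + 1) × ℤ => f ((Int.divModEquiv (M + 1)).symm (q.2, q.1)) :=
    (Equiv.prodComm _ _).summable_iff.2 h2
  rw [← h1, ← (Equiv.prodComm (Fin (M + 1)) ℤ).tsum_eq]
  refine h3.tsum_prod.trans ?_
  rw [tsum_fintype]
  rfl

theorem summable_cexp_neg_mul_int_sq {a : ℂ} (ha : 0 < a.re) :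
    Summable fun n : ℤ => Complex.exp (-Real.pi * a * (n : ℂ) ^ 2) := by
  have h := (summable_jacobiTheta₂_term_iff 0 (Complex.I * a)).2 (by simpa using ha)
  refine h.congr fun n => ?_
  rw [jacobiTheta₂_term]
  congr 1
  linear_combination (Real.pi * a * (n : ℂ) ^ 2) * Complex.I_sq

theorem real_mul_cpow {r : ℝ} (hr : 0 < r) {x : ℂ} (hx : x ≠ 0) (s : ℂ) :
    ((r : ℂ) * x) ^ s = (r : ℂ) ^ s * x ^ s := by
  have hr' : (r : ℂ) ≠ 0 := by exact_mod_cast hr.ne'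
  rw [Complex.cpow_def_of_ne_zero (mul_ne_zero hr' hx), Complex.cpow_def_of_ne_zero hr',
    Complex.cpow_def_of_ne_zero hx, Complex.log_ofReal_mul hr hx, ← Complex.exp_add,
    Complex.ofReal_log hr.le]
  congr 1
  ring

theorem tsum_theta_residue {z : ℂ} (hz : 0 < z.re) {N : ℕ} (hN : N ≠ 0) (r : ℂ) :
    z ^ (1 / 2 : ℂ) * ∑' m : ℤ, Complex.exp (-Real.pi * z * (m * N + r) ^ 2) =
      1 / N * ∑' m : ℤ, Complex.exp (2 * Real.pi * Complex.I * (m * r / N)) *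
        Complex.exp (-Real.pi * z⁻¹ / N ^ 2 * m ^ 2) := by
  have hz0 : z ≠ 0 := by rintro rfl; simp at hz
  have hNC : (N : ℂ) ≠ 0 := by exact_mod_cast hN
  have ha : 0 < (z * N ^ 2).re := by
    have : z * N ^ 2 = ((N ^ 2 : ℝ) : ℂ) * z := by push_cast; ring
    rw [this, Complex.re_ofReal_mul]
    positivity
  have h := Complex.tsum_exp_neg_quadratic ha (-z * N * r)
  have hl : ∀ m : ℤ, Complex.exp (-Real.pi * z * (m * N + r) ^ 2) =
      Complex.exp (-Real.pi * z * r ^ 2) * Complex.exp (-Real.pi * (z * N ^ 2) * m ^ 2 +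
        2 * Real.pi * (-z * N * r) * m) := by
    intro m
    rw [← Complex.exp_add]
    congr 1
    ring
  have hr : ∀ m : ℤ, Complex.exp (2 * Real.pi * Complex.I * (m * r / N)) *
        Complex.exp (-Real.pi * z⁻¹ / N ^ 2 * m ^ 2) = Complex.exp (-Real.pi * z * r ^ 2) *
        Complex.exp (-Real.pi / (z * N ^ 2) * (m + Complex.I * (-z * N * r)) ^ 2) := by
    intro m
    rw [← Complex.exp_add, ← Complex.exp_add]
    congr 1
    field_simp
    ring_nf
    rw [Complex.I_sq]
    ring
  simp_rw [hl, hr]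
  rw [tsum_mul_left, tsum_mul_left, h]
  have hp : (z * N ^ 2) ^ (1 / 2 : ℂ) = N * z ^ (1 / 2 : ℂ) := by
    have : z * N ^ 2 = ((N ^ 2 : ℝ) : ℂ) * z := by push_cast; ring
    rw [this, real_mul_cpow (by positivity) hz0]
    congr 1
    rw [show ((N ^ 2 : ℝ) : ℂ) = ((N : ℂ)) ^ (2 : ℕ) by push_cast; rfl, one_div,
      Complex.sq_cpow_two_inv]
    rw [Complex.natCast_re]
    positivity
  have hz1 : z ^ (1 / 2 : ℂ) ≠ 0 := by simp [Complex.cpow_eq_zero_iff, hz0]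
  rw [hp]
  field_simp

theorem tendsto_theta_residue {l : Filter ℝ} {z : ℝ → ℂ} (hz : ∀ᶠ t in l, 0 < (z t).re)
    (hzi : Tendsto (fun t => ((z t)⁻¹).re) l atTop) {N : ℕ} (hN : N ≠ 0) (r : ℝ) :
    Tendsto (fun t => (z t) ^ (1 / 2 : ℂ) *
      ∑' m : ℤ, Complex.exp (-Real.pi * z t * (m * N + (r : ℂ)) ^ 2)) l (𝓝 (1 / N)) := by
  have hN2 : (0 : ℝ) < (N : ℝ) ^ 2 := by positivity
  have hR : Tendsto (fun t => ((z t)⁻¹).re / N ^ 2) l atTop := hzi.atTop_div_const hN2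
  have hnorm : ∀ t (m : ℤ), ‖Complex.exp (2 * Real.pi * Complex.I * (m * r / N)) *
      Complex.exp (-Real.pi * (z t)⁻¹ / N ^ 2 * m ^ 2)‖ =
      Real.exp (-Real.pi * m ^ 2 * (((z t)⁻¹).re / N ^ 2)) := by
    intro t m
    have e1 : (2 * Real.pi * Complex.I * (m * r / N) : ℂ) =
        ((2 * Real.pi * (m * r / N) : ℝ) : ℂ) * Complex.I := by push_cast; ring
    have e2 : (-Real.pi * (z t)⁻¹ / N ^ 2 * m ^ 2 : ℂ) =
        ((-Real.pi * m ^ 2 / N ^ 2 : ℝ) : ℂ) * (z t)⁻¹ := by push_cast; ring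
    rw [norm_mul, e1, Complex.norm_exp_ofReal_mul_I, one_mul, Complex.norm_exp, e2,
      Complex.re_ofReal_mul]
    congr 1
    ring
  have hlim : Tendsto (fun t => ∑' m : ℤ, Complex.exp (2 * Real.pi * Complex.I * (m * r / N)) *
      Complex.exp (-Real.pi * (z t)⁻¹ / N ^ 2 * m ^ 2)) l
      (𝓝 (∑' m : ℤ, if m = 0 then 1 else 0)) := by
    refine tendsto_tsum_of_dominated_convergence
      (bound := fun m : ℤ => Real.exp (-Real.pi * m ^ 2)) ?_ ?_ ?_
    · have := (summable_cexp_neg_mul_int_sq (a := 1) (by simp)).norm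
      refine this.congr fun m => ?_
      rw [Complex.norm_exp]
      congr 1
      have : (-Real.pi * 1 * m ^ 2 : ℂ) = ((-Real.pi * m ^ 2 : ℝ) : ℂ) := by push_cast; ring
      rw [this, Complex.ofReal_re]
    · intro m
      by_cases hm : m = 0
      · subst hm
        simpa using tendsto_const_nhds
      · rw [if_neg hm, tendsto_zero_iff_norm_tendsto_zero]
        simp_rw [hnorm]
        refine Real.tendsto_exp_atBot.comp ?_
        refine hR.const_mul_atTop_of_neg ?_
        have : (0 : ℝ) < (m : ℝ) ^ 2 := by positivity
        nlinarith [Real.pi_pos]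
    · filter_upwards [hR.eventually_ge_atTop 1] with t ht m
      rw [hnorm]
      refine Real.exp_le_exp.2 ?_
      have : 0 ≤ Real.pi * (m : ℝ) ^ 2 := by positivity
      nlinarith
  rw [tsum_ite_eq] at hlim
  have := hlim.const_mul (1 / N : ℂ)
  rw [mul_one] at this
  refine this.congr' ?_
  filter_upwards [hz] with t ht
  rw [tsum_theta_residue ht hN]

/-- Mean value of a periodic sequence, extracted from a complex theta series. -/
theorem tendsto_theta_periodic {l : Filter ℝ} {z : ℝ → ℂ} (hz : ∀ᶠ t in l, 0 < (z t).re)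
    (hzi : Tendsto (fun t => ((z t)⁻¹).re) l atTop) {N : ℕ} [NeZero N] (c : ZMod N → ℂ) :
    Tendsto (fun t => (z t) ^ (1 / 2 : ℂ) *
      ∑' n : ℤ, c n * Complex.exp (-Real.pi * z t * (n : ℂ) ^ 2)) l
      (𝓝 (1 / N * ∑ r, c r)) := by
  have h : Tendsto (fun t => ∑ r : ZMod N, c r * ((z t) ^ (1 / 2 : ℂ) *
      ∑' m : ℤ, Complex.exp (-Real.pi * z t * (m * N + ((r.val : ℝ) : ℂ)) ^ 2))) l
      (𝓝 (∑ r : ZMod N, c r * (1 / N))) :=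
    tendsto_finsetSum _ fun r _ =>
      (tendsto_theta_residue hz hzi (NeZero.ne N) (r.val : ℝ)).const_mul (c r)
  rw [← Finset.sum_mul, mul_comm] at h
  refine h.congr' ?_
  filter_upwards [hz] with t ht
  have hs : Summable fun n : ℤ => c n * Complex.exp (-Real.pi * z t * (n : ℂ) ^ 2) := by
    obtain ⟨B, hB⟩ := (Set.finite_range fun r => ‖c r‖).bddAbove
    refine Summable.of_norm_bounded ((summable_cexp_neg_mul_int_sq ht).norm.mul_left B)
      fun n => ?_
    rw [norm_mul]
    gcongr
    exact hB ⟨_, rfl⟩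
  rw [tsum_int_eq_sum_residues N hs, Finset.mul_sum]
  refine Finset.sum_congr rfl fun r _ => ?_
  have : ∀ m : ℤ, c ((m * N + r.val : ℤ) : ZMod N) * Complex.exp (-Real.pi * z t *
      ((m * N + r.val : ℤ) : ℂ) ^ 2) =
      c r * Complex.exp (-Real.pi * z t * (m * N + ((r.val : ℝ) : ℂ)) ^ 2) := by
    intro m
    have : ((m * N + r.val : ℤ) : ZMod N) = r := by simp
    rw [this]
    push_cast
    rfl
  simp_rw [this]
  rw [tsum_mul_left]
  ring

theorem cexp_neg_pi_I_half_mul_sq (p : ℕ) (n : ℤ) :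
    Complex.exp (-Real.pi * (Complex.I * p / 2) * (n : ℂ) ^ 2) =
      if (n : ZMod 2) = 0 then 1 else (-Complex.I) ^ p := by
  have hI : Complex.exp (-Real.pi / 2 * Complex.I) = -Complex.I := by
    rw [show (-Real.pi / 2 * Complex.I : ℂ) = -(Real.pi / 2 * Complex.I) by ring,
      Complex.exp_neg, Complex.exp_pi_div_two_mul_I, Complex.inv_I]
  rcases Int.even_or_odd' n with ⟨j, rfl | rfl⟩
  · rw [if_pos (by push_cast; rw [show (2 : ZMod 2) = 0 from rfl, zero_mul]),
      Complex.exp_eq_one_iff]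
    exact ⟨-(p * j ^ 2), by push_cast; ring⟩
  · rw [if_neg (by push_cast; rw [show (2 : ZMod 2) = 0 from rfl, zero_mul, zero_add]; decide),
      ← hI, ← Complex.exp_nat_mul, Complex.exp_eq_exp_iff_exists_int]
    exact ⟨-(p * (j ^ 2 + j)), by push_cast; ring⟩

theorem quadratic_exp_sum_aux {p : ℕ} [NeZero p] :
    ∑ r : ZMod p, ZMod.stdAddChar (r ^ 2) =
      1 / (-2 * Complex.I / p) ^ (1 / 2 : ℂ) * (1 + (-Complex.I) ^ p) := by
  have hp0 : (0 : ℝ) < p := by exact_mod_cast NeZero.pos p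
  have hpC : (p : ℂ) ≠ 0 := by exact_mod_cast NeZero.ne p
  set l : Filter ℝ := 𝓝[>] 0
  have hlpos : ∀ᶠ t : ℝ in l, 0 < t := eventually_mem_nhdsWithin
  have hl0 : Tendsto (fun t : ℝ => t) l (𝓝 0) := tendsto_id.mono_left nhdsWithin_le_nhds
  have hl0' : Tendsto (fun t : ℝ => (t : ℂ)) l (𝓝 0) :=
    (Complex.continuous_ofReal.tendsto 0).comp hl0
  set a : ℝ → ℂ := fun t => t - 2 * Complex.I / p
  have hare : ∀ t, (a t).re = t := by
    intro t
    have : a t = (t : ℂ) + ((-2 / p : ℝ) : ℂ) * Complex.I := by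
      simp only [a]; push_cast; ring
    rw [this]; simp
  have ha0 : ∀ t, 0 < t → a t ≠ 0 := by
    intro t ht h
    have := congrArg Complex.re h
    rw [hare] at this
    exact ht.ne' this
  set u : ℝ → ℂ := fun t => -Complex.I * p / (2 * a t)
  set w : ℝ → ℂ := fun t => t * u t
  have halim : Tendsto a l (𝓝 (-2 * Complex.I / p)) := by
    have := hl0'.sub_const (2 * Complex.I / p)
    rwa [show (0 - 2 * Complex.I / p : ℂ) = -2 * Complex.I / p by ring] at this
  have halim0 : (-2 * Complex.I / p : ℂ) ≠ 0 := by
    simp [hpC]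
  have hulim : Tendsto u l (𝓝 ((p / 2 : ℂ) ^ 2)) := by
    have := (tendsto_const_nhds (x := -Complex.I * (p : ℂ))).div (halim.const_mul 2)
      (mul_ne_zero two_ne_zero halim0)
    rwa [show (-Complex.I * p / (2 * (-2 * Complex.I / p)) : ℂ) = (p / 2 : ℂ) ^ 2 by
      field_simp] at this
  have hu0 : ∀ t, 0 < t → u t ≠ 0 := fun t ht =>
    div_ne_zero (by simp [hpC]) (mul_ne_zero two_ne_zero (ha0 t ht))
  have hw0 : ∀ t, 0 < t → w t ≠ 0 := fun t ht =>
    mul_ne_zero (by exact_mod_cast ht.ne') (hu0 t ht)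
  have hwinv : ∀ t, 0 < t →
      (w t)⁻¹ = ((4 / p ^ 2 * t⁻¹ : ℝ) : ℂ) + ((2 / p : ℝ) : ℂ) * Complex.I := by
    intro t ht
    have ht' : (t : ℂ) ≠ 0 := by exact_mod_cast ht.ne'
    simp only [w, u]
    rw [mul_inv, inv_div, neg_mul, div_neg, mul_comm Complex.I, ← div_div, Complex.div_I]
    simp only [a]
    push_cast
    field_simp
    ring_nf
    simp only [Complex.I_sq]
    ring
  have hwinvre : ∀ t, 0 < t → ((w t)⁻¹).re = 4 / p ^ 2 * t⁻¹ := by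
    intro t ht
    rw [hwinv t ht, Complex.add_re, Complex.ofReal_re, Complex.re_ofReal_mul, Complex.I_re,
      mul_zero, add_zero]
  have hwre : ∀ t, 0 < t → 0 < (w t).re := by
    intro t ht
    have h1 := hwinvre t ht
    rw [Complex.inv_re] at h1
    have h2 : 0 < Complex.normSq (w t) := Complex.normSq_pos.2 (hw0 t ht)
    have h3 : (0 : ℝ) < 4 / p ^ 2 * t⁻¹ := by positivity
    rw [← h1] at h3
    exact (div_pos_iff_of_pos_right h2).1 h3
  have hwinf : Tendsto (fun t => ((w t)⁻¹).re) l atTop := by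
    have : Tendsto (fun t : ℝ => 4 / (p : ℝ) ^ 2 * t⁻¹) l atTop :=
      tendsto_inv_nhdsGT_zero.const_mul_atTop (by positivity)
    refine this.congr' ?_
    filter_upwards [hlpos] with t ht
    rw [hwinvre t ht]
  have hL := tendsto_theta_periodic (l := l) (z := fun t => (t : ℂ)) (N := p)
    (by filter_upwards [hlpos] with t ht; simpa using ht)
    (by
      refine tendsto_inv_nhdsGT_zero.congr fun t => ?_
      rw [← Complex.ofReal_inv, Complex.ofReal_re])
    (fun r => ZMod.stdAddChar (r ^ 2))
  have hR := tendsto_theta_periodic (l := l) (z := w) (N := 2)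
    (by filter_upwards [hlpos] with t ht using hwre t ht) hwinf
    (fun r => if r = 0 then 1 else (-Complex.I) ^ p)
  have hsum2 : ∑ r : ZMod 2, (if r = 0 then 1 else (-Complex.I) ^ p) = 1 + (-Complex.I) ^ p := by
    rw [show (Finset.univ : Finset (ZMod 2)) = {0, 1} from rfl, Finset.sum_pair (by decide)]
    simp
  rw [hsum2] at hR
  have hacpow : Tendsto (fun t => 1 / (a t) ^ (1 / 2 : ℂ)) l
      (𝓝 (1 / (-2 * Complex.I / p) ^ (1 / 2 : ℂ))) := by
    refine tendsto_const_nhds.div ((continuousAt_cpow_const ?_).tendsto.comp halim) (by simp [Complex.cpow_eq_zero_iff, hpC])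
    right
    have : (-2 * Complex.I / p : ℂ) = ((-2 / p : ℝ) : ℂ) * Complex.I := by push_cast; ring
    rw [this]
    simpa using hp0.ne'
  have hucpow : Tendsto (fun t => 1 / (u t) ^ (1 / 2 : ℂ)) l (𝓝 (1 / (p / 2 : ℂ))) := by
    have h2 : (((p / 2 : ℂ) ^ 2) ^ (1 / 2 : ℂ)) = (p / 2 : ℂ) := by
      rw [one_div, Complex.sq_cpow_two_inv]
      have : (p / 2 : ℂ) = ((p / 2 : ℝ) : ℂ) := by push_cast; rfl
      rw [this, Complex.ofReal_re]
      positivity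
    have h3 := (continuousAt_cpow_const (a := (p / 2 : ℂ) ^ 2) (b := (1 / 2 : ℂ)) (by
      left
      have : ((p / 2 : ℂ) ^ 2) = (((p / 2) ^ 2 : ℝ) : ℂ) := by push_cast; rfl
      rw [this, Complex.ofReal_re]
      positivity)).tendsto.comp hulim
    rw [h2] at h3
    exact tendsto_const_nhds.div h3 (by simp [hpC])
  have hlim := (hacpow.mul hucpow).mul hR
  have heq := tendsto_nhds_unique hL (hlim.congr' ?_)
  · rw [one_div, inv_mul_eq_iff_eq_mul₀ hpC] at heq
    rw [heq]
    push_cast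
    field_simp
  filter_upwards [hlpos] with t ht
  have hth := Complex.tsum_exp_neg_mul_int_sq (a := a t) (by rw [hare]; exact ht)
  have hl : ∀ n : ℤ, ZMod.stdAddChar ((n : ZMod p) ^ 2) * Complex.exp (-Real.pi * t * (n : ℂ) ^ 2) =
      Complex.exp (-Real.pi * a t * (n : ℂ) ^ 2) := by
    intro n
    rw [← Int.cast_pow, ZMod.stdAddChar_coe, ← Complex.exp_add]
    congr 1
    simp only [a]
    push_cast
    ring
  have hr : ∀ n : ℤ, (if (n : ZMod 2) = 0 then 1 else (-Complex.I) ^ p) *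
      Complex.exp (-Real.pi * w t * (n : ℂ) ^ 2) =
      Complex.exp (-Real.pi / a t * (n : ℂ) ^ 2) := by
    intro n
    rw [← cexp_neg_pi_I_half_mul_sq, ← Complex.exp_add]
    congr 1
    have : (Complex.I * p / 2 : ℂ) + w t = 1 / a t := by
      have h1 := ha0 t ht
      simp only [w, u]
      field_simp
      simp only [a]
      field_simp
      ring_nf
      simp only [Complex.I_sq]
      ring
    rw [← add_mul, ← mul_add, this]
    ring
  simp_rw [hl, hr, hth]
  have ht' : (t : ℂ) ^ (1 / 2 : ℂ) ≠ 0 := by simp [Complex.cpow_eq_zero_iff, ht.ne']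
  have hu' : (u t) ^ (1 / 2 : ℂ) ≠ 0 := by simp [Complex.cpow_eq_zero_iff, hu0 t ht]
  have : (w t) ^ (1 / 2 : ℂ) = (t : ℂ) ^ (1 / 2 : ℂ) * (u t) ^ (1 / 2 : ℂ) :=
    real_mul_cpow ht (hu0 t ht) _
  rw [this]
  field_simp

theorem quadratic_exp_sum_eq {p : ℕ} (hp : Odd p) [NeZero p] :
    ∑ r : ZMod p, ZMod.stdAddChar (r ^ 2) =
      Real.sqrt p * (if p % 4 = 1 then 1 else Complex.I) := by
  have hp0 : (0 : ℝ) < p := by exact_mod_cast NeZero.pos p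
  have hpC : (p : ℂ) ≠ 0 := by exact_mod_cast NeZero.ne p
  have hs : ((Real.sqrt p : ℝ) : ℂ) ^ 2 = p := by
    rw [← Complex.ofReal_pow, Real.sq_sqrt hp0.le]; simp
  have hs0 : ((Real.sqrt p : ℝ) : ℂ) ≠ 0 := by
    exact_mod_cast (Real.sqrt_pos.2 hp0).ne'
  have h1 : (-2 * Complex.I / p : ℂ) = ((1 - Complex.I) / (Real.sqrt p : ℝ)) ^ 2 := by
    rw [div_pow, hs]
    congr 1
    ring_nf
    rw [Complex.I_sq]
    ring
  have h2 : (-2 * Complex.I / p : ℂ) ^ (1 / 2 : ℂ) = (1 - Complex.I) / (Real.sqrt p : ℝ) := by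
    rw [h1, one_div, Complex.sq_cpow_two_inv]
    rw [Complex.div_ofReal_re]
    simpa using hp0
  have h4 : (-Complex.I) ^ 4 = 1 := by rw [neg_pow, Complex.I_pow_four]; norm_num
  have h3 : (-Complex.I) ^ p = (-Complex.I) ^ (p % 4) := by
    conv_lhs => rw [← Nat.div_add_mod p 4, pow_add, pow_mul, h4, one_pow, one_mul]
  have h5 : (1 - Complex.I) ≠ 0 := by
    intro h
    have := congrArg Complex.re h
    simp at this
  rw [quadratic_exp_sum_aux, h2, h3]
  have h6 : p % 4 = 1 ∨ p % 4 = 3 := by have := Nat.odd_iff.1 hp; lia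
  rcases h6 with h | h
  · rw [h, if_pos rfl, pow_one, one_div_div]
    field_simp
    ring
  · rw [h, if_neg (by norm_num), one_div_div]
    field_simp
    linear_combination (1 - Complex.I) * Complex.I_sq

section

open scoped SchwartzMap FourierTransform

theorem exists_schwartz_comp_mul {E : Type*} [NormedAddCommGroup E] [NormedSpace ℝ E]
    (f : 𝓢(ℝ, E)) {c : ℝ} (hc : c ≠ 0) :
    ∃ F : 𝓢(ℝ, E), ∀ x, F x = f (c * x) :=
  ⟨SchwartzMap.compCLMOfContinuousLinearEquiv ℝ
    (ContinuousLinearEquiv.unitsEquivAut ℝ (Units.mk0 c hc)) f, fun x => by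
      simp [mul_comm]⟩

theorem summable_schwartz_int {E : Type*} [NormedAddCommGroup E] [NormedSpace ℝ E]
    (f : 𝓢(ℝ, E)) {c : ℝ} (hc : c ≠ 0) : Summable fun n : ℤ => ‖f (c * n)‖ := by
  obtain ⟨F, hF⟩ := exists_schwartz_comp_mul f hc
  have h := ((F.isBigO_cocompact_rpow (-2)).comp_tendsto Int.tendsto_coe_cofinite).norm_left
  refine (summable_of_isBigO (Real.summable_abs_int_rpow one_lt_two) h).congr fun n => ?_
  simp [hF]

theorem fourier_comp_mul (f : ℝ → ℂ) {c : ℝ} (hc : 0 < c) (ξ : ℝ) :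
    𝓕 (fun x => f (c * x)) ξ = (1 / c : ℂ) * 𝓕 f (ξ / c) := by
  rw [Real.fourier_real_eq_integral_exp_smul, Real.fourier_real_eq_integral_exp_smul]
  have h := MeasureTheory.Measure.integral_comp_mul_left
    (fun v : ℝ => Complex.exp (↑(-2 * Real.pi * v * (ξ / c)) * Complex.I) • f v) c
  rw [abs_of_pos (inv_pos.2 hc)] at h
  rw [one_div, ← Complex.ofReal_inv, ← Complex.real_smul, ← h]
  congr 1
  ext v
  congr 4
  field_simp

theorem tsum_schwartz_comp_mul (f : 𝓢(ℝ, ℂ)) {c : ℝ} (hc : 0 < c) (x : ℝ) :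
    ∑' n : ℤ, f (c * (x + n)) =
      ∑' k : ℤ, (1 / c : ℂ) * 𝓕 f (k / c) * fourier k (x : UnitAddCircle) := by
  obtain ⟨F, hF⟩ := exists_schwartz_comp_mul f hc.ne'
  have h := SchwartzMap.tsum_eq_tsum_fourier F x
  simp_rw [hF] at h
  rw [h]
  congr 1
  ext k
  congr 1
  have : (𝓕 F : 𝓢(ℝ, ℂ)) (k : ℝ) = 𝓕 (F : ℝ → ℂ) k := rfl
  rw [this, show (F : ℝ → ℂ) = fun x => f (c * x) from funext hF, fourier_comp_mul _ hc]
  rfl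

/-- The Legendre symbol modulo `p` as a complex multiplicative character. -/
noncomputable def legendreChar (p : ℕ) [Fact p.Prime] : MulChar (ZMod p) ℂ :=
  (quadraticChar (ZMod p)).ringHomComp (Int.castRingHom ℂ)

theorem legendreChar_intCast (p : ℕ) [Fact p.Prime] (n : ℤ) :
    legendreChar p n = (jacobiSym n p : ℂ) := by
  rw [← jacobiSym.legendreSym.to_jacobiSym]
  rfl

theorem gaussSum_legendreChar {p : ℕ} [Fact p.Prime] (hp : p ≠ 2) :
    gaussSum (legendreChar p) ZMod.stdAddChar =
      Real.sqrt p * (if p % 4 = 1 then 1 else Complex.I) := by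
  have hpp : p.Prime := Fact.out
  rw [← quadratic_exp_sum_eq (hpp.odd_of_ne_two hp), gaussSum]
  have h1 : ∑ a : ZMod p, ZMod.stdAddChar a = (0 : ℂ) :=
    AddChar.sum_eq_zero_of_ne_one (by
      have := ZMod.isPrimitive_stdAddChar p (a := 1) one_ne_zero
      intro h
      apply this
      rw [h]
      ext
      simp)
  have h2 : ∑ r : ZMod p, ZMod.stdAddChar (r ^ 2) =
      ∑ a : ZMod p, ∑ r with r ^ 2 = a, (ZMod.stdAddChar a : ℂ) := by
    rw [← Finset.sum_fiberwise Finset.univ (fun r : ZMod p => r ^ 2)]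
    refine Finset.sum_congr rfl fun a _ => Finset.sum_congr rfl fun r hr => ?_
    rw [(Finset.mem_filter.1 hr).2]
  rw [h2, ← add_zero (∑ a : ZMod p, legendreChar p a * _), ← h1, ← Finset.sum_add_distrib]
  refine Finset.sum_congr rfl fun a _ => ?_
  have h3 := quadraticChar_card_sqrts (F := ZMod p) (by rwa [ZMod.ringChar_zmod_n]) a
  have h4 : ({x : ZMod p | x ^ 2 = a} : Set (ZMod p)).toFinset = Finset.univ.filter (· ^ 2 = a) := by
    ext; simp
  rw [h4] at h3
  rw [Finset.sum_const, nsmul_eq_mul]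
  have h5 : (((Finset.univ.filter (· ^ 2 = a)).card : ℤ) : ℂ) = legendreChar p a + 1 := by
    rw [h3]
    push_cast
    rfl
  rw [Int.cast_natCast] at h5
  rw [h5]
  ring

theorem sum_jacobiSym_mul_stdAddChar {p : ℕ} [Fact p.Prime] (hp : p ≠ 2) (k : ℤ) :
    ∑ r : ZMod p, legendreChar p r * ZMod.stdAddChar ((k : ZMod p) * r) =
      jacobiSym k p * (Real.sqrt p * (if p % 4 = 1 then 1 else Complex.I)) := by
  by_cases hk : (k : ZMod p) = 0
  · have h0 : jacobiSym k p = 0 := by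
      rw [← jacobiSym.legendreSym.to_jacobiSym]
      exact (legendreSym.eq_zero_iff p k).2 hk
    rw [hk, h0]
    simp only [zero_mul, AddChar.map_zero_eq_one, mul_one, Int.cast_zero]
    refine MulChar.sum_eq_zero_of_ne_one ?_
    intro h
    obtain ⟨a, ha⟩ := quadraticChar_exists_neg_one' (F := ZMod p) (by rwa [ZMod.ringChar_zmod_n])
    have h1 : legendreChar p a = ((quadraticChar (ZMod p) a : ℤ) : ℂ) := rfl
    rw [h, ha, MulChar.one_apply a.isUnit] at h1
    norm_num at h1
  · have h := gaussSum_mulShift_eq (legendreChar p) ZMod.stdAddChar (Units.mk0 (k : ZMod p) hk)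
    rw [gaussSum_legendreChar hp] at h
    have hinv : (legendreChar p)⁻¹ = legendreChar p :=
      ((quadraticChar_isQuadratic (ZMod p)).comp _).inv
    rw [hinv, Units.val_mk0, legendreChar_intCast] at h
    rw [← h]
    simp only [gaussSum, AddChar.mulShift_apply]

/-- Poisson summation twisted by the Legendre symbol. -/
theorem tsum_jacobiSym_schwartz {p : ℕ} (hpp : p.Prime) (hp : p ≠ 2) (f : 𝓢(ℝ, ℂ)) {c : ℝ}
    (hc : 0 < c) :
    ∑' n : ℤ, (jacobiSym n p : ℂ) * f (c * n) =
      (Real.sqrt p * (if p % 4 = 1 then 1 else Complex.I)) / (c * p) *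
        ∑' k : ℤ, (jacobiSym k p : ℂ) * 𝓕 f (k / (c * p)) := by
  have : Fact p.Prime := ⟨hpp⟩
  have hp0 : (0 : ℝ) < p := by exact_mod_cast hpp.pos
  have hcp : 0 < c * p := by positivity
  have hJ : ∀ n : ℤ, ‖(jacobiSym n p : ℂ)‖ ≤ 1 := by
    intro n
    rcases jacobiSym.trichotomy n p with h | h | h <;> simp [h]
  have hs : Summable fun n : ℤ => (jacobiSym n p : ℂ) * f (c * n) := by
    refine Summable.of_norm_bounded (summable_schwartz_int f hc.ne') fun n => ?_
    rw [norm_mul]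
    exact mul_le_of_le_one_left (norm_nonneg _) (hJ n)
  rw [tsum_int_eq_sum_residues p hs]
  have h1 : ∀ r : ZMod p, ∑' m : ℤ, (jacobiSym (m * p + r.val) p : ℂ) *
      f (c * ((m * p + r.val : ℤ) : ℝ)) = ∑' k : ℤ, (1 / (c * p : ℝ) : ℂ) * 𝓕 f (k / (c * p)) *
        (legendreChar p r * ZMod.stdAddChar ((k : ZMod p) * r)) := by
    intro r
    have e1 : ∀ m : ℤ, (jacobiSym (m * p + r.val) p : ℂ) *
      f (c * ((m * p + r.val : ℤ) : ℝ)) = legendreChar p r * f (c * p * ((r.val / p : ℝ) + m)) := by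
      intro m
      rw [← legendreChar_intCast]
      congr 2
      · simp
      · push_cast
        field_simp
        ring
    simp_rw [e1]
    rw [tsum_mul_left, tsum_schwartz_comp_mul f hcp, ← tsum_mul_left]
    refine tsum_congr fun k => ?_
    have e2 : (fourier k ((r.val / p : ℝ) : UnitAddCircle) : ℂ) = ZMod.stdAddChar ((k : ZMod p) * r) := by
      have : (k : ZMod p) * r = ((k * r.val : ℤ) : ZMod p) := by simp
      rw [this, ZMod.stdAddChar_coe, fourier_coe_apply]
      congr 1
      push_cast
      field_simp
    rw [e2]
    ring
  simp_rw [h1]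
  have hcp' : (1 / (c * p)) ≠ 0 := by positivity
  have hF := summable_schwartz_int (𝓕 f : 𝓢(ℝ, ℂ)) hcp'
  have hF' : Summable fun k : ℤ => ‖(𝓕 f : 𝓢(ℝ, ℂ)) (k / (c * p))‖ := by
    refine hF.congr fun k => ?_
    congr 2
    ring
  rw [← Summable.tsum_finsetSum]
  · rw [← tsum_mul_left]
    refine tsum_congr fun k => ?_
    rw [← Finset.mul_sum, sum_jacobiSym_mul_stdAddChar hp]
    push_cast
    ring
  · intro r _
    refine Summable.of_norm_bounded (hF'.mul_left ‖(1 / (c * p : ℝ) : ℂ)‖) fun k => ?_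
    rw [norm_mul, norm_mul, norm_mul]
    have h2 : ‖legendreChar p r‖ ≤ 1 := by
      have := legendreChar_intCast p r.val
      rw [Int.cast_natCast, ZMod.natCast_zmod_val] at this
      rw [this]
      exact hJ _
    have h3 : ‖(ZMod.stdAddChar ((k : ZMod p) * r) : ℂ)‖ = 1 := by
      rw [ZMod.stdAddChar_apply, Circle.norm_coe]
    rw [h3, mul_one]
    exact mul_le_of_le_one_right (by positivity) h2

end

section

open scoped SchwartzMap FourierTransform

theorem exists_schwartz_cosSinTransform {Φ : ℝ → ℝ} (hΦsmooth : ContDiff ℝ (⊤ : ℕ∞) Φ)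
    (hΦsupp : HasCompactSupport Φ) :
    ∃ (f : 𝓢(ℝ, ℂ)) (ψ : 𝓢(ℝ, ℝ)), (∀ x, f x = Φ x) ∧
      (∀ ξ, ψ ξ = ((𝓕 f : 𝓢(ℝ, ℂ)) ξ).re - ((𝓕 f : 𝓢(ℝ, ℂ)) ξ).im) ∧
      ∀ ξ, ψ ξ = cosSinTransform Φ ξ := by
  have h1 : HasCompactSupport fun x => (Φ x : ℂ) := hΦsupp.comp_left Complex.ofReal_zero
  have h2 : ContDiff ℝ (⊤ : ℕ∞) fun x => (Φ x : ℂ) := Complex.ofRealCLM.contDiff.comp hΦsmooth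
  let f : 𝓢(ℝ, ℂ) := h1.toSchwartzMap h2
  have hf : ∀ x, f x = Φ x := fun x => rfl
  let ψ : 𝓢(ℝ, ℝ) :=
    SchwartzMap.postcompCLM (𝕜 := ℝ) (Complex.reCLM - Complex.imCLM) (𝓕 f : 𝓢(ℝ, ℂ))
  have hψ : ∀ ξ, ψ ξ = ((𝓕 f : 𝓢(ℝ, ℂ)) ξ).re - ((𝓕 f : 𝓢(ℝ, ℂ)) ξ).im := fun ξ => rfl
  refine ⟨f, ψ, hf, hψ, fun ξ => ?_⟩
  have e : (𝓕 f : 𝓢(ℝ, ℂ)) ξ = 𝓕 (f : ℝ → ℂ) ξ := rfl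
  have hint : MeasureTheory.Integrable fun v : ℝ =>
      Complex.exp (↑(-2 * Real.pi * v * ξ) * Complex.I) • f v := by
    refine (f.integrable (μ := MeasureTheory.volume)).norm.mono ?_ ?_
    · exact (Continuous.smul (f := fun v : ℝ => Complex.exp (↑(-2 * Real.pi * v * ξ) * Complex.I))
        (by fun_prop) f.continuous).aestronglyMeasurable
    · refine Eventually.of_forall fun v => ?_
      rw [norm_smul, Complex.norm_exp_ofReal_mul_I, one_mul, norm_norm]
  change (Complex.reCLM - Complex.imCLM) ((𝓕 f : 𝓢(ℝ, ℂ)) ξ) = _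
  rw [e, Real.fourier_real_eq_integral_exp_smul, cosSinTransform,
    ← ContinuousLinearMap.integral_comp_comm _ hint]
  refine MeasureTheory.integral_congr_ae (Eventually.of_forall fun v => ?_)
  simp only [hf, smul_eq_mul, sub_apply, Complex.reCLM_apply,
    Complex.imCLM_apply, Complex.re_mul_ofReal, Complex.im_mul_ofReal,
    Complex.exp_ofReal_mul_I_re, Complex.exp_ofReal_mul_I_im]
  rw [show -2 * Real.pi * v * ξ = -(2 * Real.pi * ξ * v) by ring, Real.cos_neg, Real.sin_neg]
  ring

theorem abs_jacobiSym_le_one (n : ℤ) (p : ℕ) : |(jacobiSym n p : ℝ)| ≤ 1 := by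
  rcases jacobiSym.trichotomy n p with h | h | h <;> simp [h]

theorem summable_abs_cosSinTransform_int {Φ : ℝ → ℝ}
    (hΦsmooth : ContDiff ℝ (⊤ : ℕ∞) Φ) (hΦsupp : HasCompactSupport Φ)
    {c : ℝ} (hc : c ≠ 0) :
    Summable fun n : ℤ => |cosSinTransform Φ (c * n)| := by
  obtain ⟨f, ψ, -, -, hψ⟩ := exists_schwartz_cosSinTransform hΦsmooth hΦsupp
  simpa [hψ] using summable_schwartz_int ψ hc

theorem summable_abs_int {Φ : ℝ → ℝ}
    (hΦsmooth : ContDiff ℝ (⊤ : ℕ∞) Φ) (hΦsupp : HasCompactSupport Φ)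
    {c : ℝ} (hc : c ≠ 0) :
    Summable fun n : ℤ => |Φ (c * n)| := by
  obtain ⟨f, ψ, hf, -, hψ⟩ := exists_schwartz_cosSinTransform hΦsmooth hΦsupp
  simpa [hf] using summable_schwartz_int f hc

theorem tsum_jacobiSym_cosSinTransform {Φ : ℝ → ℝ}
    (hΦsmooth : ContDiff ℝ (⊤ : ℕ∞) Φ) (hΦsupp : HasCompactSupport Φ)
    {p : ℕ} (hpp : p.Prime) (hp : p ≠ 2) {c : ℝ} (hc : 0 < c) :
    ∑' n : ℤ, (jacobiSym n p : ℝ) * Φ (c * n) =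
      1 / (c * Real.sqrt p) * ∑' k : ℤ, (jacobiSym k p : ℝ) * cosSinTransform Φ (k / (c * p)) := by
  obtain ⟨f, ψ, hf, hψ1, hψ⟩ := exists_schwartz_cosSinTransform hΦsmooth hΦsupp
  have hp0 : (0 : ℝ) < p := by exact_mod_cast hpp.pos
  have hsp : 0 < Real.sqrt p := Real.sqrt_pos.2 hp0
  have hsq : Real.sqrt p * Real.sqrt p = p := Real.mul_self_sqrt hp0.le
  have hcp : 1 / (c * p) ≠ 0 := by positivity
  have h := tsum_jacobiSym_schwartz hpp hp f hc
  set S : ℂ := ∑' k : ℤ, (jacobiSym k p : ℂ) * (𝓕 f : 𝓢(ℝ, ℂ)) (k / (c * p)) with hS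
  have hL : ∑' n : ℤ, (jacobiSym n p : ℂ) * f (c * n) =
      ((∑' n : ℤ, (jacobiSym n p : ℝ) * Φ (c * n) : ℝ) : ℂ) := by
    rw [Complex.ofReal_tsum]
    simp [hf]
  set L : ℝ := ∑' n : ℤ, (jacobiSym n p : ℝ) * Φ (c * n) with hLdef
  have hsum : Summable fun k : ℤ => (jacobiSym k p : ℂ) * (𝓕 f : 𝓢(ℝ, ℂ)) (k / (c * p)) := by
    refine Summable.of_norm_bounded (summable_schwartz_int (𝓕 f : 𝓢(ℝ, ℂ)) hcp) fun k => ?_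
    rw [norm_mul, show (1 / (c * p) * k : ℝ) = k / (c * p) by ring]
    refine mul_le_of_le_one_left (norm_nonneg _) ?_
    have := abs_jacobiSym_le_one k p
    rwa [← Real.norm_eq_abs, ← Complex.norm_real, Complex.ofReal_intCast] at this
  have hR : ∑' k : ℤ, (jacobiSym k p : ℝ) * cosSinTransform Φ (k / (c * p)) = S.re - S.im := by
    rw [hS]
    change _ = (Complex.reCLM - Complex.imCLM) _
    rw [ContinuousLinearMap.map_tsum _ hsum]
    refine tsum_congr fun k => ?_
    rw [← hψ, hψ1]
    simp
    ring
  rw [hR]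
  rw [hL] at h
  have h' : (L : ℂ) = ((1 / (c * Real.sqrt p) : ℝ) : ℂ) *
      ((if p % 4 = 1 then 1 else Complex.I) * S) := by
    rw [h]
    push_cast
    have e : (Real.sqrt p : ℂ) * Real.sqrt p = p := by exact_mod_cast hsq
    have e0 : (Real.sqrt p : ℂ) ≠ 0 := by exact_mod_cast hsp.ne'
    have e1 : (c : ℂ) ≠ 0 := by exact_mod_cast hc.ne'
    rw [← e]
    field_simp
  have hre := congrArg Complex.re h'
  have him := congrArg Complex.im h'
  rw [Complex.re_ofReal_mul] at hre
  rw [Complex.im_ofReal_mul] at him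
  have hne : 1 / (c * Real.sqrt p) ≠ 0 := by positivity
  split_ifs at hre him with h4
  · simp only [Complex.ofReal_re, Complex.ofReal_im, one_mul] at hre him
    have : S.im = 0 := (mul_eq_zero.1 him.symm).resolve_left hne
    rw [hre, this, sub_zero]
  · simp only [Complex.ofReal_re, Complex.ofReal_im, Complex.I_mul_re, Complex.I_mul_im] at hre him
    have : S.re = 0 := by
      rcases mul_eq_zero.1 him.symm with h0 | h0
      · exact absurd h0 hne
      · exact h0
    rw [hre, this, zero_sub]

theorem tsum_ite_even {f : ℤ → ℝ} :
    ∑' n : ℤ, (if Even n then f n else 0) = ∑' m : ℤ, f (2 * m) := by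
  have hinj : Function.Injective fun m : ℤ => 2 * m := fun a b h => by simpa using h
  rw [← hinj.tsum_eq (f := fun n : ℤ => if Even n then f n else 0)]
  · refine tsum_congr fun m => ?_
    simp
  · intro n hn
    by_contra hc
    apply hn
    refine if_neg fun he => hc ?_
    obtain ⟨m, rfl⟩ := he
    exact ⟨m, by simp; ring⟩

theorem sqrt_mul_tsum_odd_jacobiSym {Φ : ℝ → ℝ}
    (hΦsmooth : ContDiff ℝ (⊤ : ℕ∞) Φ) (hΦsupp : HasCompactSupport Φ)
    {p : ℕ} (hpp : p.Prime) (hp : p ≠ 2) {c : ℝ} (hc : 0 < c) :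
    Real.sqrt p * ∑' n : ℤ, (if Odd n then (jacobiSym (8 * n) p : ℝ) * Φ (c * n) else 0) =
      1 / (2 * c) * ∑' k : ℤ, (if Even k then 1 else -1) *
        ((jacobiSym k p : ℝ) * cosSinTransform Φ (k / (2 * c * p))) := by
  have hp0 : (0 : ℝ) < p := by exact_mod_cast hpp.pos
  have hsp : 0 < Real.sqrt p := Real.sqrt_pos.2 hp0
  have hJ2 : (jacobiSym 2 p : ℝ) * jacobiSym 2 p = 1 := by
    have hodd : (2 : ℤ).gcd p = 1 := by
      rw [Int.gcd_eq_natAbs]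
      exact (Nat.coprime_primes Nat.prime_two hpp).2 hp.symm
    have := jacobiSym.sq_one hodd
    rw [sq] at this
    exact_mod_cast this
  have hJ8 : ∀ n : ℤ, (jacobiSym (8 * n) p : ℝ) = jacobiSym 2 p * jacobiSym n p := by
    intro n
    rw [show (8 * n : ℤ) = 2 * (2 * (2 * n)) by ring]
    simp only [jacobiSym.mul_left, Int.cast_mul]
    rw [← mul_assoc, hJ2, one_mul]
  set J2 : ℝ := (jacobiSym 2 p : ℝ) with hJ2def
  have hs1 : Summable fun n : ℤ => (jacobiSym n p : ℝ) * Φ (c * n) := by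
    refine Summable.of_norm_bounded (summable_abs_int hΦsmooth hΦsupp hc.ne') fun n => ?_
    rw [norm_mul]
    exact mul_le_of_le_one_left (abs_nonneg _) (abs_jacobiSym_le_one n p)
  have hq : 1 / (2 * c * p) ≠ 0 := by positivity
  have hs2 : Summable fun k : ℤ => (jacobiSym k p : ℝ) * cosSinTransform Φ (k / (2 * c * p)) := by
    refine Summable.of_norm_bounded (summable_abs_cosSinTransform_int hΦsmooth hΦsupp hq)
      fun n => ?_
    rw [norm_mul, show (1 / (2 * c * p) * n : ℝ) = n / (2 * c * p) by ring]
    exact mul_le_of_le_one_left (abs_nonneg _) (abs_jacobiSym_le_one n p)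
  have hE1 : Summable fun n : ℤ => if Even n then (jacobiSym n p : ℝ) * Φ (c * n) else 0 :=
    (hs1.indicator {n | Even n}).congr fun n => by simp [Set.indicator_apply]
  have hE2 : Summable fun k : ℤ => if Even k then
      (jacobiSym k p : ℝ) * cosSinTransform Φ (k / (2 * c * p)) else 0 :=
    (hs2.indicator {n | Even n}).congr fun n => by simp [Set.indicator_apply]
  have hA := tsum_jacobiSym_cosSinTransform hΦsmooth hΦsupp hpp hp hc
  have hB := tsum_jacobiSym_cosSinTransform hΦsmooth hΦsupp hpp hp (c := 2 * c) (by positivity)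
  set S1 := ∑' n : ℤ, (jacobiSym n p : ℝ) * Φ (c * n) with hS1
  set S2 := ∑' n : ℤ, (jacobiSym n p : ℝ) * Φ (2 * c * n) with hS2
  set T := ∑' k : ℤ, (jacobiSym k p : ℝ) * cosSinTransform Φ (k / (2 * c * p)) with hT
  set TE := ∑' k : ℤ, (if Even k then
      (jacobiSym k p : ℝ) * cosSinTransform Φ (k / (2 * c * p)) else 0) with hTE
  have hTE' : TE = J2 * ∑' k : ℤ, (jacobiSym k p : ℝ) * cosSinTransform Φ (k / (c * p)) := by
    rw [hTE, tsum_ite_even, ← tsum_mul_left]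
    refine tsum_congr fun k => ?_
    rw [jacobiSym.mul_left, Int.cast_mul, mul_assoc]
    congr 3
    push_cast
    field_simp
  have hleft : ∑' n : ℤ, (if Odd n then (jacobiSym (8 * n) p : ℝ) * Φ (c * n) else 0) =
      J2 * S1 - S2 := by
    have e : ∀ n : ℤ, (if Odd n then (jacobiSym (8 * n) p : ℝ) * Φ (c * n) else 0) =
        J2 * ((jacobiSym n p : ℝ) * Φ (c * n)) -
          J2 * (if Even n then (jacobiSym n p : ℝ) * Φ (c * n) else 0) := by
      intro n
      rw [hJ8]
      rcases Int.even_or_odd n with h | h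
      · rw [if_neg (Int.not_odd_iff_even.2 h), if_pos h]; ring
      · rw [if_pos h, if_neg (Int.not_even_iff_odd.2 h)]; ring
    simp_rw [e]
    rw [(hs1.mul_left J2).tsum_sub (hE1.mul_left J2), tsum_mul_left, tsum_mul_left, ← hS1,
      tsum_ite_even]
    congr 1
    rw [hS2, ← tsum_mul_left]
    refine tsum_congr fun m => ?_
    rw [jacobiSym.mul_left, Int.cast_mul, ← mul_assoc, ← mul_assoc, hJ2, one_mul]
    congr 2
    push_cast
    ring
  have hright : ∑' k : ℤ, (if Even k then 1 else -1) *
        ((jacobiSym k p : ℝ) * cosSinTransform Φ (k / (2 * c * p))) = 2 * TE - T := by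
    rw [hTE, hT, ← tsum_mul_left, ← (hE2.mul_left 2).tsum_sub hs2]
    refine tsum_congr fun k => ?_
    split_ifs <;> ring
  rw [hleft, hright, hA, hB, hTE']
  field_simp

end

section

open scoped SchwartzMap FourierTransform

theorem exists_schwartz_bound {E : Type*} [NormedAddCommGroup E] [NormedSpace ℝ E]
    (f : 𝓢(ℝ, E)) (k : ℕ) : ∃ C > 0, ∀ x, ‖f x‖ ≤ C / (1 + |x|) ^ k := by
  obtain ⟨C0, h0, hC0⟩ := f.decay 0 0
  obtain ⟨C1, h1, hC1⟩ := f.decay k 0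
  refine ⟨2 ^ (k - 1) * (C0 + C1), by positivity, fun x => ?_⟩
  have a0 := hC0 x
  have a1 := hC1 x
  simp only [pow_zero, one_mul, norm_iteratedFDeriv_zero, Real.norm_eq_abs] at a0 a1
  rw [le_div_iff₀ (by positivity)]
  have := add_pow_le zero_le_one (abs_nonneg x) k
  rw [one_pow] at this
  calc ‖f x‖ * (1 + |x|) ^ k ≤ ‖f x‖ * (2 ^ (k - 1) * (1 + |x| ^ k)) := by gcongr
    _ = 2 ^ (k - 1) * (‖f x‖ + |x| ^ k * ‖f x‖) := by ring
    _ ≤ _ := by gcongr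

theorem exists_cosSinTransform_bound {Φ : ℝ → ℝ} (hΦsmooth : ContDiff ℝ (⊤ : ℕ∞) Φ)
    (hΦsupp : HasCompactSupport Φ) :
    Differentiable ℝ (cosSinTransform Φ) ∧ ∃ C > 0,
      (∀ ξ, |cosSinTransform Φ ξ| ≤ C / (1 + |ξ|) ^ 2) ∧
      (∀ ξ, |deriv (cosSinTransform Φ) ξ| ≤ C / (1 + |ξ|) ^ 3) ∧
      ∀ x, |Φ x| ≤ C / (1 + |x|) ^ 2 := by
  obtain ⟨f, ψ, hf, -, hψ⟩ := exists_schwartz_cosSinTransform hΦsmooth hΦsupp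
  have e : (ψ : ℝ → ℝ) = cosSinTransform Φ := funext hψ
  obtain ⟨C1, h1, hC1⟩ := exists_schwartz_bound ψ 2
  obtain ⟨C2, h2, hC2⟩ := exists_schwartz_bound (SchwartzMap.derivCLM ℝ ℝ ψ) 3
  obtain ⟨C3, h3, hC3⟩ := exists_schwartz_bound f 2
  refine ⟨e ▸ ψ.differentiable, max C1 (max C2 C3), by positivity, fun ξ => ?_, fun ξ => ?_,
    fun x => ?_⟩
  · rw [← hψ]
    exact (hC1 ξ).trans (by gcongr; simp)
  · rw [← e]
    have := hC2 ξ
    rw [SchwartzMap.derivCLM_apply] at this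
    exact this.trans (by gcongr; simp)
  · have := hC3 x
    rw [hf, Complex.norm_real] at this
    exact this.trans (by gcongr; simp)

theorem inv_one_add_sq_le_rpow {x s : ℝ} (hx : 0 < x) (hs0 : 0 ≤ s) (hs2 : s ≤ 2) :
    ((1 + x) ^ 2)⁻¹ ≤ x ^ (-s) := by
  rw [Real.rpow_neg hx.le]
  gcongr
  calc x ^ s ≤ (1 + x) ^ s := by gcongr; linarith
    _ ≤ (1 + x) ^ (2 : ℝ) := by gcongr; linarith
    _ = _ := by norm_cast

/-- The variation of `ψ` on the positive half line is controlled by a telescoping function. -/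
theorem abs_sub_le_of_abs_deriv_le {ψ : ℝ → ℝ} {C : ℝ} (hd : Differentiable ℝ ψ)
    (h1 : ∀ ξ, |deriv ψ ξ| ≤ C / (1 + |ξ|) ^ 3) {u v : ℝ} (hu : 0 ≤ u) (huv : u ≤ v) :
    |ψ v - ψ u| ≤ C * (1 / (1 + u) - 1 / (1 + v)) := by
  have hC : 0 ≤ C := by simpa using (abs_nonneg _).trans (h1 0)
  have hw : ∀ x : ℝ, 0 ≤ x → HasDerivAt (fun x : ℝ => -C / (1 + x)) (C / (1 + x) ^ 2) x := by
    intro x hx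
    have h := ((hasDerivAt_id x).const_add 1).fun_inv (by simp; positivity)
    refine ((h.const_mul (-C)).congr_deriv ?_).congr_of_eventuallyEq (Eventually.of_forall fun z => ?_)
    · simp only [id]; ring
    · simp only [id]; ring
  have hb : ∀ x : ℝ, 0 ≤ x → |deriv ψ x| ≤ C / (1 + x) ^ 2 := by
    intro x hx
    refine (h1 x).trans ?_
    rw [abs_of_nonneg hx]
    gcongr
    · linarith
    · norm_num
  have key : ∀ σ : ℝ, |σ| = 1 → MonotoneOn (fun x => -C / (1 + x) + σ * ψ x) (Set.Ici 0) := by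
    intro σ hσ
    have hd' : ∀ x : ℝ, 0 ≤ x → HasDerivAt (fun x => -C / (1 + x) + σ * ψ x)
        (C / (1 + x) ^ 2 + σ * deriv ψ x) x := fun x hx =>
      (hw x hx).add ((hd x).hasDerivAt.const_mul σ)
    refine monotoneOn_of_deriv_nonneg (convex_Ici 0)
      (fun x hx => (hd' x hx).continuousAt.continuousWithinAt)
      (fun x hx => (hd' x (interior_subset hx)).differentiableAt.differentiableWithinAt)
      fun x hx => ?_
    have hx0 : 0 ≤ x := interior_subset hx
    rw [(hd' x hx0).deriv]
    have : |σ * deriv ψ x| ≤ C / (1 + x) ^ 2 := by rw [abs_mul, hσ, one_mul]; exact hb x hx0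
    linarith [neg_le_of_abs_le this]
  have k1 := key 1 (by simp) (Set.mem_Ici.2 hu) (Set.mem_Ici.2 (hu.trans huv)) huv
  have k2 := key (-1) (by simp) (Set.mem_Ici.2 hu) (Set.mem_Ici.2 (hu.trans huv)) huv
  simp only [neg_div] at k1 k2
  rw [abs_le, mul_sub, mul_one_div, mul_one_div]
  constructor <;> linarith

theorem summable_sq_bound {ψ : ℝ → ℝ} {C : ℝ} (h0 : ∀ ξ, |ψ ξ| ≤ C / (1 + |ξ|) ^ 2)
    {t : ℝ} (ht : 0 < t) (m : ℕ) :
    |ψ (((m : ℝ) + 1) ^ 2 * t)| ≤ C / t * (1 / ((m : ℝ) + 1) ^ 2) := by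
  have hC : 0 ≤ C := by simpa using (abs_nonneg _).trans (h0 0)
  refine (h0 _).trans ?_
  rw [abs_of_nonneg (by positivity), div_mul_div_comm, mul_one]
  gcongr
  have : 0 ≤ ((m : ℝ) + 1) ^ 2 * t := by positivity
  nlinarith

theorem summable_one_div_succ_sq : Summable fun m : ℕ => 1 / ((m : ℝ) + 1) ^ 2 := by
  have := (summable_nat_add_iff 1).2 (Real.summable_one_div_nat_pow.2 one_lt_two)
  exact this.congr fun m => by push_cast; rfl

theorem summable_sq {ψ : ℝ → ℝ} {C : ℝ} (h0 : ∀ ξ, |ψ ξ| ≤ C / (1 + |ξ|) ^ 2)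
    {t : ℝ} (ht : 0 < t) (σ : ℕ → ℝ) (hσ : ∀ m, |σ m| ≤ 1) :
    Summable fun m : ℕ => σ m * ψ (((m : ℝ) + 1) ^ 2 * t) := by
  refine Summable.of_norm_bounded (summable_one_div_succ_sq.mul_left (C / t)) fun m => ?_
  rw [norm_mul]
  exact (mul_le_of_le_one_left (norm_nonneg _) (hσ m)).trans (summable_sq_bound h0 ht m)

theorem abs_alternating_tsum_le {ψ : ℝ → ℝ} {C : ℝ} (hd : Differentiable ℝ ψ)
    (h0 : ∀ ξ, |ψ ξ| ≤ C / (1 + |ξ|) ^ 2)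
    (h1 : ∀ ξ, |deriv ψ ξ| ≤ C / (1 + |ξ|) ^ 3) {t : ℝ} (ht : 0 < t) :
    |∑' m : ℕ, (-1 : ℝ) ^ (m + 1) * ψ (((m : ℝ) + 1) ^ 2 * t)| ≤ C := by
  have hC : 0 ≤ C := by simpa using (abs_nonneg _).trans (h1 0)
  have hs := summable_sq h0 ht (fun m => (-1 : ℝ) ^ (m + 1)) (fun m => by simp)
  have hlim := hs.hasSum.tendsto_sum_nat.comp (tendsto_id.const_mul_atTop' (r := 2) two_pos)
  refine le_of_tendsto hlim.abs (Eventually.of_forall fun N => ?_)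
  simp only [Function.comp, id]
  have : |∑ m ∈ range (2 * N), (-1 : ℝ) ^ (m + 1) * ψ (((m : ℝ) + 1) ^ 2 * t)| ≤
      C * (1 - 1 / (1 + (2 * N : ℝ) ^ 2 * t)) := by
    induction N with
    | zero => simp
    | succ N ih =>
      rw [show 2 * (N + 1) = 2 * N + 1 + 1 by ring, sum_range_succ, sum_range_succ, add_assoc]
      have e : (-1 : ℝ) ^ (2 * N + 1) * ψ ((((2 * N : ℕ) : ℝ) + 1) ^ 2 * t) +
          (-1 : ℝ) ^ (2 * N + 1 + 1) * ψ ((((2 * N + 1 : ℕ) : ℝ) + 1) ^ 2 * t) =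
          ψ ((2 * N + 2) ^ 2 * t) - ψ ((2 * N + 1) ^ 2 * t) := by
        have e1 : (-1 : ℝ) ^ (2 * N) = 1 := by simp [pow_mul]
        rw [pow_succ _ (2 * N + 1), pow_succ _ (2 * N), e1]
        push_cast
        ring_nf
      rw [e]
      have k1 := abs_sub_le_of_abs_deriv_le hd h1 (u := (2 * N + 1) ^ 2 * t)
        (v := (2 * N + 2) ^ 2 * t) (by positivity) (by gcongr; norm_num)
      have k2 : 1 / (1 + (2 * N + 1 : ℝ) ^ 2 * t) ≤ 1 / (1 + (2 * N : ℝ) ^ 2 * t) := by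
        gcongr; linarith
      have k3 := abs_add_le (∑ m ∈ range (2 * N), (-1 : ℝ) ^ (m + 1) * ψ (((m : ℝ) + 1) ^ 2 * t))
        (ψ ((2 * N + 2) ^ 2 * t) - ψ ((2 * N + 1) ^ 2 * t))
      have k4 := mul_le_mul_of_nonneg_left k2 hC
      have e2 : (2 * ((N + 1 : ℕ) : ℝ)) = 2 * N + 2 := by push_cast; ring
      rw [e2]
      linarith
  refine this.trans ?_
  have : 0 ≤ C * (1 / (1 + (2 * N : ℝ) ^ 2 * t)) := by positivity
  linarith

theorem abs_tsum_jacobiSym_sq_le {ψ : ℝ → ℝ} {C : ℝ} (hd : Differentiable ℝ ψ)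
    (h0 : ∀ ξ, |ψ ξ| ≤ C / (1 + |ξ|) ^ 2)
    (h1 : ∀ ξ, |deriv ψ ξ| ≤ C / (1 + |ξ|) ^ 3) {t : ℝ} (ht : 0 < t) {p : ℕ} (hp : p.Prime) :
    |∑' m : ℕ, (-1 : ℝ) ^ (m + 1) * (jacobiSym (((m : ℤ) + 1) ^ 2) p : ℝ) *
        ψ (((m : ℝ) + 1) ^ 2 * t)| ≤
      C + C / (p ^ 2 * t) * ∑' m : ℕ, 1 / ((m : ℝ) + 1) ^ 2 := by
  have hC : 0 ≤ C := by simpa using (abs_nonneg _).trans (h1 0)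
  have hp0 : (0 : ℝ) < p := by exact_mod_cast hp.pos
  have hJ : ∀ m : ℕ, (jacobiSym (((m : ℤ) + 1) ^ 2) p : ℝ) = if p ∣ m + 1 then 0 else 1 := by
    intro m
    have : Fact p.Prime := ⟨hp⟩
    rw [← jacobiSym.legendreSym.to_jacobiSym]
    split_ifs with h
    · rw [Int.cast_eq_zero, legendreSym.eq_zero_iff]
      push_cast
      have := (ZMod.natCast_eq_zero_iff (m + 1) p).2 h
      push_cast at this
      rw [this]; simp
    · rw [legendreSym.sq_one']
      · simp
      · push_cast
        intro h2
        apply h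
        rw [← ZMod.natCast_eq_zero_iff]
        push_cast
        exact h2
  have e : ∀ m : ℕ, (-1 : ℝ) ^ (m + 1) * (jacobiSym (((m : ℤ) + 1) ^ 2) p : ℝ) *
        ψ (((m : ℝ) + 1) ^ 2 * t) = (-1 : ℝ) ^ (m + 1) * ψ (((m : ℝ) + 1) ^ 2 * t) -
        (if p ∣ m + 1 then (-1 : ℝ) ^ (m + 1) else 0) * ψ (((m : ℝ) + 1) ^ 2 * t) := by
    intro m
    rw [hJ]
    split_ifs <;> ring
  have hs1 := summable_sq h0 ht (fun m => (-1 : ℝ) ^ (m + 1)) (fun m => by simp)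
  have hs2 := summable_sq h0 ht (fun m => if p ∣ m + 1 then (-1 : ℝ) ^ (m + 1) else 0)
    (fun m => by split_ifs <;> simp)
  simp_rw [e]
  rw [hs1.tsum_sub hs2]
  refine (abs_sub _ _).trans (add_le_add (abs_alternating_tsum_le hd h0 h1 ht) ?_)
  have hinj : Function.Injective fun j : ℕ => p * (j + 1) - 1 := by
    intro a b h
    have h1 : 1 ≤ p * (a + 1) := Nat.succ_le_of_lt (by have := hp.pos; positivity)
    have h2 : 1 ≤ p * (b + 1) := Nat.succ_le_of_lt (by have := hp.pos; positivity)
    have h3 : p * (a + 1) = p * (b + 1) := by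
      simp only at h
      omega
    have := Nat.eq_of_mul_eq_mul_left hp.pos h3
    omega
  rw [← hinj.tsum_eq (f := fun m : ℕ =>
    (if p ∣ m + 1 then (-1 : ℝ) ^ (m + 1) else 0) * ψ (((m : ℝ) + 1) ^ 2 * t))]
  · rw [← tsum_mul_left]
    have hb : ∀ j : ℕ, ‖(if p ∣ p * (j + 1) - 1 + 1 then (-1 : ℝ) ^ (p * (j + 1) - 1 + 1) else 0) *
        ψ ((((p * (j + 1) - 1 : ℕ) : ℝ) + 1) ^ 2 * t)‖ ≤
        C / (p ^ 2 * t) * (1 / ((j : ℝ) + 1) ^ 2) := by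
      intro j
      have h1 : 1 ≤ p * (j + 1) := Nat.succ_le_of_lt (by have := hp.pos; positivity)
      have := summable_sq_bound h0 ht (p * (j + 1) - 1)
      rw [norm_mul]
      refine (mul_le_of_le_one_left (norm_nonneg _) (by split_ifs <;> simp)).trans
        (this.trans (le_of_eq ?_))
      rw [Nat.cast_sub h1]
      push_cast
      rw [sub_add_cancel]
      field_simp
    exact tsum_of_norm_bounded (summable_one_div_succ_sq.mul_left _).hasSum hb
  · intro m hm
    by_contra hc
    apply hm
    have : ¬ p ∣ m + 1 := by
      rintro ⟨j, hj⟩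
      apply hc
      rcases j with _ | j
      · simp at hj
      · exact ⟨j, by simp only [← hj]; omega⟩
    simp [this]

end

theorem sum_Ioc_mul_eq_sub (c g : ℕ → ℝ) {a b : ℕ} (hab : a ≤ b) :
    ∑ n ∈ Ioc a b, c n * g n = (∑ i ∈ Ioc a b, c i) * g b -
      ∑ n ∈ Ico a b, (∑ i ∈ Ioc a n, c i) * (g (n + 1) - g n) := by
  induction b, hab using Nat.le_induction with
  | base => simp
  | succ b hb ih =>
    rw [← insert_Ioc_right_eq_Ioc_add_one hb, sum_insert (by simp), sum_insert (by simp),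
      sum_Ico_succ_top hb, ih]
    ring

/-- Partial summation with a uniform bound for the partial sums. -/
theorem abs_sum_Ioc_mul_le {c g : ℕ → ℝ} {a b : ℕ} (hab : a ≤ b) {K M M' : ℝ} (hM : 0 ≤ M)
    (hM' : 0 ≤ M')
    (hD : ∀ n, a ≤ n → n ≤ b → |∑ i ∈ Ioc a n, c i| ≤ K)
    (hg : ∀ n, a < n → n ≤ b → |g n| ≤ M)
    (hg' : ∀ n, a < n → n < b → |g (n + 1) - g n| ≤ M') :
    |∑ n ∈ Ioc a b, c n * g n| ≤ K * (M + b * M') := by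
  have hK : 0 ≤ K := (abs_nonneg _).trans (hD a le_rfl hab)
  rw [sum_Ioc_mul_eq_sub c g hab]
  refine (abs_sub _ _).trans ?_
  rw [mul_add]
  refine add_le_add ?_ ?_
  · rcases hab.eq_or_lt with rfl | h
    · simp; positivity
    · rw [abs_mul]
      exact mul_le_mul (hD b hab le_rfl) (hg b h le_rfl) (abs_nonneg _) hK
  · refine (abs_sum_le_sum_abs _ _).trans ?_
    have : ∀ n ∈ Ico a b, |(∑ i ∈ Ioc a n, c i) * (g (n + 1) - g n)| ≤ K * M' := by
      intro n hn
      rw [mem_Ico] at hn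
      rcases hn.1.eq_or_lt with rfl | h
      · simp; positivity
      · rw [abs_mul]
        exact mul_le_mul (hD n hn.1 hn.2.le) (hg' n h hn.2) (abs_nonneg _) hK
    refine (sum_le_sum this).trans ?_
    rw [sum_const, Nat.card_Ico, nsmul_eq_mul]
    have : ((b - a : ℕ) : ℝ) ≤ b := by exact_mod_cast Nat.sub_le b a
    calc ((b - a : ℕ) : ℝ) * (K * M') ≤ b * (K * M') := by gcongr
      _ = _ := by ring

/-- The primes in `[yX, yX + X^δ]`. -/
noncomputable def windowPrimes (y δ X : ℝ) : Finset ℕ :=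
  (Finset.range (Nat.floor (y * X + X ^ δ) + 1)).filter
    (fun p : ℕ => p.Prime ∧ y * X ≤ (p : ℝ) ∧ (p : ℝ) ≤ y * X + X ^ δ)

theorem mem_windowPrimes {y δ X : ℝ} {p : ℕ} :
    p ∈ windowPrimes y δ X ↔ p.Prime ∧ y * X ≤ (p : ℝ) ∧ (p : ℝ) ≤ y * X + X ^ δ := by
  rw [windowPrimes, mem_filter, mem_range, Nat.lt_succ_iff, and_iff_right_iff_imp]
  rintro ⟨-, -, h⟩
  exact Nat.le_floor h

theorem le_of_mem_windowPrimes {y δ X : ℝ} (hX : 1 ≤ X) (hδ : δ ≤ 1) {p : ℕ}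
    (hp : p ∈ windowPrimes y δ X) : (p : ℝ) ≤ (y + 1) * X := by
  have h1 : X ^ δ ≤ X := by simpa using Real.rpow_le_rpow_of_exponent_le hX hδ
  linarith [(mem_windowPrimes.1 hp).2.2]

theorem sum_windowPrimes {y δ X : ℝ} (hyX : 0 < y * X) (hX : 0 ≤ X) (h : ℕ → ℝ) :
    ∑ p ∈ windowPrimes y δ X, h p =
      ∑ n ∈ Ioc (⌈y * X⌉₊ - 1) ⌊y * X + X ^ δ⌋₊, if n.Prime then h n else 0 := by
  rw [← sum_filter]
  refine sum_congr ?_ fun _ _ => rfl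
  ext p
  rw [mem_windowPrimes, mem_filter, mem_Ioc]
  have hc : 0 < ⌈y * X⌉₊ := Nat.ceil_pos.2 hyX
  have e1 : ⌈y * X⌉₊ - 1 < p ↔ y * X ≤ p := by
    rw [← Nat.ceil_le]; omega
  have e2 : p ≤ ⌊y * X + X ^ δ⌋₊ ↔ (p : ℝ) ≤ y * X + X ^ δ :=
    Nat.le_floor_iff (by positivity)
  rw [e1, e2]
  tauto

theorem sum_Ioc_sub_sum_Ioc (c : ℕ → ℝ) {a n : ℕ} (h : a ≤ n) :
    ∑ i ∈ Ioc a n, c i = ∑ i ∈ Ioc 0 n, c i - ∑ i ∈ Ioc 0 a, c i := by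
  rw [eq_sub_iff_add_eq, add_comm, sum_Ioc_consecutive c (Nat.zero_le a) h]

theorem abs_sum_windowPrimes_le (hGRH : GeneralizedRiemannHypothesis) {ε : ℝ} (hε : 0 < ε)
    (hε1 : ε ≤ 1 / 2) {y δ : ℝ} (hy : 0 < y) (hδ : δ ≤ 1) :
    ∃ C > 0, ∀ᶠ X : ℝ in atTop, ∀ k : ℤ, ¬ IsSquare k → ∀ (h : ℝ → ℝ) (M : ℝ),
      (∀ t ∈ Set.Icc (y * X) ((y + 1) * X),
        DifferentiableAt ℝ h t ∧ |h t| ≤ M ∧ |deriv h t| ≤ M / X) →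
      |∑ p ∈ windowPrimes y δ X, (jacobiSym k p : ℝ) * h p| ≤
        C * |(k : ℝ)| ^ ε * X ^ (1 / 2 + ε) * M := by
  obtain ⟨C, hC, hB⟩ := abs_sum_jacobiSym_log_le hGRH hε hε1
  refine ⟨2 * C * (y + 1) ^ (1 / 2 + ε) * (1 + (y + 1) * (1 + 1 / y)), by positivity, ?_⟩
  filter_upwards [eventually_ge_atTop 1, eventually_ge_atTop (3 / y)] with X hX1 hXy k hk h M hh
  have hX0 : 0 < X := by linarith
  have hyX : 3 ≤ y * X := by rwa [div_le_iff₀' hy] at hXy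
  have hXδ : X ^ δ ≤ X := by simpa using Real.rpow_le_rpow_of_exponent_le hX1 hδ
  have hXδ0 : 0 < X ^ δ := by positivity
  have hM : 0 ≤ M := (abs_nonneg _).trans (hh (y * X) ⟨le_rfl, by nlinarith⟩).2.1
  rw [sum_windowPrimes (by linarith) hX0.le]
  set a := ⌈y * X⌉₊ - 1 with ha
  set b := ⌊y * X + X ^ δ⌋₊ with hb
  have hceil : 3 ≤ ⌈y * X⌉₊ := by
    have : (3 : ℝ) ≤ ⌈y * X⌉₊ := hyX.trans (Nat.le_ceil _)
    exact_mod_cast this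
  have hbX : (b : ℝ) ≤ (y + 1) * X := by
    have : (b : ℝ) ≤ y * X + X ^ δ := Nat.floor_le (by positivity)
    linarith
  have hab : a ≤ b := by
    have h1 : ⌈y * X⌉₊ ≤ b + 1 := by
      rw [Nat.ceil_le]
      have := Nat.lt_floor_add_one (y * X + X ^ δ)
      push_cast
      linarith
    omega
  have hlow : ∀ n : ℕ, a < n → y * X ≤ n := by
    intro n hn
    rw [← Nat.ceil_le]; omega
  set c : ℕ → ℝ := fun n => if n.Prime then (jacobiSym k n : ℝ) * Real.log n else 0 with hc
  set g : ℝ → ℝ := fun t => h t * (Real.log t)⁻¹ with hg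
  have hlog : ∀ t : ℝ, y * X ≤ t → 1 ≤ Real.log t := by
    intro t ht
    rw [Real.le_log_iff_exp_le (by linarith)]
    linarith [Real.exp_one_lt_d9]
  have e : ∀ n ∈ Ioc a b, (if n.Prime then (jacobiSym k n : ℝ) * h n else 0) = c n * g n := by
    intro n hn
    have := hlog n (hlow n (mem_Ioc.1 hn).1)
    simp only [hc, hg]
    split_ifs
    · field_simp
    · simp
  rw [sum_congr rfl e]
  have hθ : ∀ n : ℕ, 1 ≤ n → n ≤ b → |∑ i ∈ Ioc 0 n, c i| ≤
      C * |(k : ℝ)| ^ ε * ((y + 1) * X) ^ (1 / 2 + ε) := by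
    intro n hn hnb
    have h1 := hB k hk n (by exact_mod_cast hn)
    rw [Nat.floor_natCast, sum_filter] at h1
    refine h1.trans ?_
    have : (n : ℝ) ≤ (y + 1) * X := le_trans (by exact_mod_cast hnb) hbX
    gcongr
  have hinv : ∀ t : ℝ, y * X ≤ t → |(Real.log t)⁻¹| ≤ 1 := by
    intro t ht
    have := hlog t ht
    rw [abs_of_nonneg (by positivity)]
    exact inv_le_one_of_one_le₀ this
  have hgd : ∀ t ∈ Set.Icc (y * X) ((y + 1) * X), HasDerivAt g
      (deriv h t * (Real.log t)⁻¹ + h t * (-(t⁻¹) / (Real.log t) ^ 2)) t := by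
    intro t ht
    have hl := hlog t ht.1
    have ht0 : t ≠ 0 := by linarith [ht.1]
    exact (hh t ht).1.hasDerivAt.mul ((Real.hasDerivAt_log ht0).inv (by linarith))
  have hgd' : ∀ t ∈ Set.Icc (y * X) ((y + 1) * X),
      ‖deriv h t * (Real.log t)⁻¹ + h t * (-(t⁻¹) / (Real.log t) ^ 2)‖ ≤ (1 + 1 / y) * (M / X) := by
    intro t ht
    obtain ⟨-, h1, h2⟩ := hh t ht
    have hl := hlog t ht.1
    have ht0 : 0 < t := by linarith [ht.1]
    refine (norm_add_le _ _).trans ?_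
    rw [norm_mul, norm_mul, add_mul, one_mul]
    refine add_le_add ?_ ?_
    · exact (mul_le_of_le_one_right (norm_nonneg _) (hinv t ht.1)).trans h2
    · have : ‖-(t⁻¹) / (Real.log t) ^ 2‖ ≤ 1 / (y * X) := by
        rw [norm_div, norm_neg, Real.norm_of_nonneg (by positivity),
          Real.norm_of_nonneg (by positivity)]
        have h3 : t⁻¹ ≤ 1 / (y * X) := by rw [one_div]; gcongr; exact ht.1
        refine (div_le_self (by positivity) ?_).trans h3
        nlinarith
      calc ‖h t‖ * ‖-(t⁻¹) / (Real.log t) ^ 2‖ ≤ M * (1 / (y * X)) := by gcongr; exact h1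
        _ = _ := by field_simp
  have hup : ∀ n : ℕ, n ≤ b → (n : ℝ) ≤ (y + 1) * X := fun n hn =>
    le_trans (by exact_mod_cast hn) hbX
  have habel := abs_sum_Ioc_mul_le (c := c) (g := fun n => g n) hab
    (K := 2 * (C * |(k : ℝ)| ^ ε * ((y + 1) * X) ^ (1 / 2 + ε))) (M := M)
    (M' := (1 + 1 / y) * (M / X)) hM (by positivity)
    (by
      intro n han hnb
      rw [sum_Ioc_sub_sum_Ioc c han, two_mul]
      exact (abs_sub _ _).trans (add_le_add (hθ n (by omega) hnb) (hθ a (by omega) hab)))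
    (by
      intro n han hnb
      rw [hg, abs_mul]
      exact (mul_le_of_le_one_right (abs_nonneg _) (hinv n (hlow n han))).trans
        (hh n ⟨hlow n han, hup n hnb⟩).2.1)
    (by
      intro n han hnb
      have h1 := (convex_Icc (y * X) ((y + 1) * X)).norm_image_sub_le_of_norm_hasDerivWithin_le
        (fun t ht => (hgd t ht).hasDerivWithinAt) hgd'
        (⟨hlow n han, hup n hnb.le⟩ : (n : ℝ) ∈ Set.Icc (y * X) ((y + 1) * X))
        (⟨hlow (n + 1) (by omega), hup (n + 1) hnb⟩ :
          ((n + 1 : ℕ) : ℝ) ∈ Set.Icc (y * X) ((y + 1) * X))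
      have h2 : ‖((n + 1 : ℕ) : ℝ) - n‖ = 1 := by push_cast; simp
      rwa [h2, mul_one] at h1)
  refine habel.trans ?_
  rw [Real.mul_rpow (by positivity) hX0.le]
  calc _ ≤ 2 * (C * |(k : ℝ)| ^ ε * ((y + 1) ^ (1 / 2 + ε) * X ^ (1 / 2 + ε))) *
        (M + ((y + 1) * X) * ((1 + 1 / y) * (M / X))) := by gcongr
    _ = _ := by field_simp

theorem tendsto_log_div_log_mul {c : ℝ} (hc : 0 < c) :
    Tendsto (fun X : ℝ => Real.log X / Real.log (c * X)) atTop (𝓝 1) := by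
  have h1 : Tendsto (fun X : ℝ => (Real.log c * (Real.log X)⁻¹ + 1)⁻¹) atTop (𝓝 1) := by
    have := (((tendsto_inv_atTop_zero.comp Real.tendsto_log_atTop).const_mul
      (Real.log c)).add_const 1).inv₀ (by simp)
    simpa using this
  refine h1.congr' ?_
  filter_upwards [eventually_gt_atTop 1] with X hX
  have := Real.log_pos hX
  rw [Real.log_mul hc.ne' (by linarith), ← inv_div]
  congr 1
  field_simp

theorem tendsto_card_windowPrimes (hGRH : GeneralizedRiemannHypothesis)
    {y δ : ℝ} (hy : 0 < y) (hδ : δ ∈ Set.Ioo (3 / 4 : ℝ) 1) :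
    Tendsto (fun X : ℝ => Real.log X / X ^ δ * #(windowPrimes y δ X)) atTop (𝓝 1) := by
  obtain ⟨C, hC, hB⟩ := abs_theta_sub_le hGRH (ε := 1 / 8) (by norm_num) (by norm_num)
  set S : ℝ → ℝ := fun X => ∑ p ∈ windowPrimes y δ X, Real.log p with hS
  have hSb : ∀ᶠ X : ℝ in atTop, |S X / X ^ δ - 1| ≤
      2 * X ^ (-δ) + 2 * C * (y + 1) ^ (5 / 8 : ℝ) * X ^ (-(δ - 5 / 8)) := by
    filter_upwards [eventually_ge_atTop 1, eventually_ge_atTop (3 / y)] with X hX1 hXy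
    have hX0 : 0 < X := by linarith
    have hyX : 3 ≤ y * X := by rwa [div_le_iff₀' hy] at hXy
    have hXδ : X ^ δ ≤ X := by simpa using Real.rpow_le_rpow_of_exponent_le hX1 hδ.2.le
    have hXδ0 : 0 < X ^ δ := by positivity
    have e : S X = _ := sum_windowPrimes (by linarith) hX0.le fun n => Real.log n
    set a := ⌈y * X⌉₊ - 1 with ha
    set b := ⌊y * X + X ^ δ⌋₊ with hb
    have hceil : 3 ≤ ⌈y * X⌉₊ := by
      have : (3 : ℝ) ≤ ⌈y * X⌉₊ := hyX.trans (Nat.le_ceil _)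
      exact_mod_cast this
    have hb1 : (b : ℝ) ≤ y * X + X ^ δ := Nat.floor_le (by positivity)
    have hb2 : y * X + X ^ δ < b + 1 := Nat.lt_floor_add_one (y * X + X ^ δ)
    have ha1 : (a : ℝ) + 1 = ⌈y * X⌉₊ := by
      rw [ha, Nat.cast_sub (by omega)]; simp
    have ha2 : y * X ≤ ⌈y * X⌉₊ := Nat.le_ceil _
    have ha3 : (⌈y * X⌉₊ : ℝ) < y * X + 1 := Nat.ceil_lt_add_one (by positivity)
    have hab : a ≤ b := by
      have : (a : ℝ) < b + 1 := by linarith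
      exact Nat.lt_succ_iff.1 (by exact_mod_cast this)
    have hθ : ∀ n : ℕ, 1 ≤ n → (n : ℝ) ≤ (y + 1) * X →
        |∑ i ∈ Ioc 0 n, (if i.Prime then Real.log i else 0) - n| ≤
          C * ((y + 1) * X) ^ (5 / 8 : ℝ) := by
      intro n hn hnb
      have h1 := hB n (by exact_mod_cast hn)
      rw [Chebyshev.theta, Nat.floor_natCast, sum_filter] at h1
      refine h1.trans ?_
      rw [show (1 / 2 + 1 / 8 : ℝ) = 5 / 8 by norm_num]
      gcongr
    rw [sum_Ioc_sub_sum_Ioc _ hab] at e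
    have k1 := abs_le.1 (hθ a (by omega) (by linarith))
    have k2 := abs_le.1 (hθ b (by omega) (by linarith))
    have k3 : |S X - X ^ δ| ≤ 2 + 2 * C * ((y + 1) * X) ^ (5 / 8 : ℝ) := by
      rw [e, abs_le]
      constructor <;> linarith [k1.1, k1.2, k2.1, k2.2]
    rw [show S X / X ^ δ - 1 = (S X - X ^ δ) / X ^ δ by field_simp, abs_div,
      abs_of_pos hXδ0, div_le_iff₀ hXδ0]
    refine k3.trans (le_of_eq ?_)
    have e1 : X ^ (-δ) * X ^ δ = 1 := by rw [← Real.rpow_add hX0]; simp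
    have e2 : X ^ (-(δ - 5 / 8)) * X ^ δ = X ^ (5 / 8 : ℝ) := by
      rw [← Real.rpow_add hX0]; congr 1; ring
    rw [Real.mul_rpow (by positivity) hX0.le, add_mul, mul_assoc 2 (X ^ (-δ)), e1,
      mul_assoc _ (X ^ (-(δ - 5 / 8))), e2]
    ring
  have hS1 : Tendsto (fun X => S X / X ^ δ) atTop (𝓝 1) := by
    rw [tendsto_iff_norm_sub_tendsto_zero]
    have h0 : Tendsto (fun X : ℝ => 2 * X ^ (-δ) +
        2 * C * (y + 1) ^ (5 / 8 : ℝ) * X ^ (-(δ - 5 / 8))) atTop (𝓝 0) := by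
      have := ((tendsto_rpow_neg_atTop (by linarith [hδ.1] : 0 < δ)).const_mul 2).add
        ((tendsto_rpow_neg_atTop (by linarith [hδ.1] : 0 < δ - 5 / 8)).const_mul
          (2 * C * (y + 1) ^ (5 / 8 : ℝ)))
      simpa using this
    exact squeeze_zero' (Eventually.of_forall fun _ => norm_nonneg _) hSb h0
  have hlo := hS1.mul (tendsto_log_div_log_mul (by positivity : 0 < y + 1))
  have hhi := hS1.mul (tendsto_log_div_log_mul hy)
  rw [mul_one] at hlo hhi
  have hev : ∀ᶠ X : ℝ in atTop, 1 < X ∧ 3 ≤ y * X := by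
    filter_upwards [eventually_gt_atTop 1, eventually_ge_atTop (3 / y)] with X hX1 hXy
    exact ⟨hX1, by rwa [div_le_iff₀' hy] at hXy⟩
  refine tendsto_of_tendsto_of_tendsto_of_le_of_le' hlo hhi ?_ ?_
  · filter_upwards [hev] with X ⟨hX, hyX⟩
    have hl := Real.log_pos hX
    have hX0 : 0 < X := by linarith
    have hl2 : 0 < Real.log ((y + 1) * X) := Real.log_pos (by linarith)
    have : S X ≤ #(windowPrimes y δ X) * Real.log ((y + 1) * X) := by
      rw [← nsmul_eq_mul]
      refine sum_le_card_nsmul _ _ _ fun p hp => ?_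
      have hp0 : (0 : ℝ) < p := by exact_mod_cast (mem_windowPrimes.1 hp).1.pos
      exact Real.log_le_log hp0 (le_of_mem_windowPrimes hX.le hδ.2.le hp)
    calc S X / X ^ δ * (Real.log X / Real.log ((y + 1) * X))
        ≤ #(windowPrimes y δ X) * Real.log ((y + 1) * X) / X ^ δ *
          (Real.log X / Real.log ((y + 1) * X)) := by gcongr
      _ = _ := by field_simp
  · filter_upwards [hev] with X ⟨hX, hyX⟩
    have hl := Real.log_pos hX
    have hX0 : 0 < X := by linarith
    have hl2 : 0 < Real.log (y * X) := Real.log_pos (by linarith)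
    have : #(windowPrimes y δ X) * Real.log (y * X) ≤ S X := by
      rw [← nsmul_eq_mul]
      refine card_nsmul_le_sum _ _ _ fun p hp => ?_
      exact Real.log_le_log (by linarith) (mem_windowPrimes.1 hp).2.1
    calc Real.log X / X ^ δ * #(windowPrimes y δ X) =
          #(windowPrimes y δ X) * Real.log (y * X) / X ^ δ *
          (Real.log X / Real.log (y * X)) := by field_simp
      _ ≤ _ := by gcongr

theorem dvd_of_sq_dvd_sq_mul_squarefree {a b s : ℕ} (hs : Squarefree s)
    (h : a ^ 2 ∣ b ^ 2 * s) (hb : b ≠ 0) : a ∣ b := by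
  have hg : 0 < Nat.gcd a b := Nat.gcd_pos_of_pos_right a (Nat.pos_of_ne_zero hb)
  obtain ⟨g, a', b', hg', hcop, rfl, rfl⟩ := Nat.exists_coprime' hg
  have h1 : a' ^ 2 ∣ b' ^ 2 * s := by
    refine Nat.dvd_of_mul_dvd_mul_right (k := g ^ 2) (by positivity) ?_
    convert h using 1 <;> ring
  have h2 : a' ^ 2 ∣ s := (Nat.Coprime.pow 2 2 hcop).dvd_of_dvd_mul_left h1
  have h3 : a' = 1 := Nat.isUnit_iff.1 (hs a' (by rwa [← sq]))
  rw [h3, one_mul]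
  exact dvd_mul_left _ _

open scoped Classical in
theorem sum_moebius_sq_dvd {d : ℤ} (hd : d ≠ 0) {N : ℕ} (hN : |d| < (N : ℤ) ^ 2) :
    ∑ a ∈ range N, (if ((a : ℤ) ^ 2 ∣ d) then (ArithmeticFunction.moebius a : ℝ) else 0) =
      if Squarefree d then 1 else 0 := by
  obtain ⟨s, b, hsb, hs⟩ := Nat.sq_mul_squarefree d.natAbs
  have hd0 : d.natAbs ≠ 0 := Int.natAbs_ne_zero.2 hd
  have hb0 : b ≠ 0 := by
    rintro rfl
    simp at hsb
    exact hd (Int.natAbs_eq_zero.1 hsb.symm)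
  have h1 : ∀ a : ℕ, ((a : ℤ) ^ 2 ∣ d) ↔ a ∣ b := by
    intro a
    rw [← Int.natAbs_dvd_natAbs, Int.natAbs_pow, Int.natAbs_natCast, ← hsb]
    exact ⟨fun h => dvd_of_sq_dvd_sq_mul_squarefree hs h hb0,
      fun h => Dvd.dvd.mul_right (pow_dvd_pow_of_dvd h 2) s⟩
  have hNd : d.natAbs < N ^ 2 := by zify; exact hN
  have hdiv : (range N).filter (fun a => a ∣ b) = b.divisors := by
    ext a
    rw [mem_filter, mem_range, Nat.mem_divisors]
    refine ⟨fun h => ⟨h.2, hb0⟩, fun h => ⟨?_, h.1⟩⟩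
    have h2 : a ≤ b := Nat.le_of_dvd (Nat.pos_of_ne_zero hb0) h.1
    have h3 : b ^ 2 ≤ d.natAbs := Nat.le_of_dvd (Nat.pos_of_ne_zero hd0) ⟨s, hsb.symm⟩
    exact lt_of_pow_lt_pow_left₀ 2 (Nat.zero_le N) ((Nat.pow_le_pow_left h2 2).trans_lt (h3.trans_lt hNd))
  simp_rw [h1]
  rw [← sum_filter, hdiv]
  have h4 : ∑ a ∈ b.divisors, ArithmeticFunction.moebius a = if b = 1 then 1 else 0 := by
    rw [← ArithmeticFunction.coe_zeta_mul_apply, ArithmeticFunction.coe_zeta_mul_moebius,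
      ArithmeticFunction.one_apply]
  have h5 : Squarefree d ↔ b = 1 := by
    rw [← Int.squarefree_natAbs, ← hsb]
    constructor
    · intro h
      exact Nat.isUnit_iff.1 (h b ⟨s, by ring⟩)
    · rintro rfl
      simpa using hs
  rw [← Int.cast_sum, h4]
  simp only [h5]
  split_ifs <;> simp

open scoped Classical in
theorem finsum_odd_squarefree (F : ℤ → ℝ) {N : ℕ} (hF : ∀ d, F d ≠ 0 → |d| < (N : ℤ) ^ 2) :
    ∑ᶠ d ∈ {d : ℤ | Odd d ∧ Squarefree d}, F d =
      ∑ a ∈ range N, (if Odd a then (ArithmeticFunction.moebius a : ℝ) else 0) *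
        ∑' n : ℤ, (if Odd n then F ((a : ℤ) ^ 2 * n) else 0) := by
  set D : Finset ℤ := Ioo (-(N : ℤ) ^ 2) ((N : ℤ) ^ 2) with hD
  have hmem : ∀ d, F d ≠ 0 → d ∈ D := fun d h => mem_Ioo.2 (abs_lt.1 (hF d h))
  have hL : ∑ᶠ d ∈ {d : ℤ | Odd d ∧ Squarefree d}, F d =
      ∑ d ∈ D, (if Odd d then F d else 0) * (if Squarefree d then 1 else 0) := by
    rw [finsum_mem_def, finsum_eq_sum_of_support_subset (s := D)]
    · refine sum_congr rfl fun d _ => ?_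
      by_cases h1 : Odd d <;> by_cases h2 : Squarefree d <;> simp [h1, h2]
    · intro d hd
      rw [Function.mem_support, Set.indicator_apply_ne_zero] at hd
      exact hmem d hd.2
  rw [hL]
  have h1 : ∀ d ∈ D, (if Odd d then F d else 0) * (if Squarefree d then 1 else 0) =
      ∑ a ∈ range N, (if Odd d then F d else 0) *
        (if ((a : ℤ) ^ 2 ∣ d) then (ArithmeticFunction.moebius a : ℝ) else 0) := by
    intro d hd
    rw [← mul_sum]
    by_cases h : Odd d
    · rw [sum_moebius_sq_dvd]
      · rintro rfl
        simp at h
      · exact abs_lt.2 (mem_Ioo.1 hd)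
    · simp [h]
  rw [sum_congr rfl h1, sum_comm]
  refine sum_congr rfl fun a _ => ?_
  by_cases ha : Odd a
  · rw [if_pos ha]
    have ha0 : (a : ℤ) ^ 2 ≠ 0 := by
      have : a ≠ 0 := by rintro rfl; simp at ha
      positivity
    have hinj : Function.Injective fun n : ℤ => (a : ℤ) ^ 2 * n :=
      mul_right_injective₀ ha0
    have haZ : Odd ((a : ℤ) ^ 2) := ((Int.odd_coe_nat a).2 ha).pow
    have e1 : ∑' n : ℤ, (if Odd n then F ((a : ℤ) ^ 2 * n) else 0) =
        ∑' d : ℤ, (if Odd d ∧ (a : ℤ) ^ 2 ∣ d then F d else 0) := by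
      rw [← hinj.tsum_eq (f := fun d : ℤ => if Odd d ∧ (a : ℤ) ^ 2 ∣ d then F d else 0)]
      · refine tsum_congr fun n => ?_
        simp [Int.odd_mul, haZ]
      · intro d hd
        rw [Function.mem_support] at hd
        have : Odd d ∧ (a : ℤ) ^ 2 ∣ d := by
          by_contra h
          exact hd (if_neg h)
        obtain ⟨n, rfl⟩ := this.2
        exact ⟨n, rfl⟩
    rw [e1, tsum_eq_sum (s := D), mul_sum]
    · refine sum_congr rfl fun d _ => ?_
      by_cases h1 : Odd d <;> by_cases h2 : (a : ℤ) ^ 2 ∣ d <;> simp [h1, h2, mul_comm]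
    · intro d hd
      by_contra h
      apply hd
      apply hmem
      intro h0
      apply h
      simp [h0]
  · rw [if_neg ha, zero_mul]
    refine sum_eq_zero fun d _ => ?_
    by_cases h : Odd d
    · rw [if_neg (c := (a : ℤ) ^ 2 ∣ d), mul_zero]
      rintro ⟨n, rfl⟩
      rw [Int.odd_mul] at h
      have := Int.odd_pow' (two_ne_zero) |>.1 h.1
      exact ha ((Int.odd_coe_nat a).1 this)
    · simp [h]

/-- `√p` times the twisted sum of `Φ(a²n/X)` over odd `n`. -/
noncomputable def oddSum (Φ : ℝ → ℝ) (X : ℝ) (a p : ℕ) : ℝ :=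
  Real.sqrt p * ∑' n : ℤ, (if Odd n then (jacobiSym (8 * n) p : ℝ) * Φ ((a : ℝ) ^ 2 / X * n) else 0)

open scoped Classical in
/-- The contribution of the nonsquare frequencies to the dual side of `oddSum`. -/
noncomputable def nonsquareSum (ψ : ℝ → ℝ) (X : ℝ) (a p : ℕ) : ℝ :=
  ∑' k : ℤ, (if IsSquare k then 0 else (if Even k then 1 else -1) *
    ((jacobiSym k p : ℝ) * ψ (k * X / (2 * (a : ℝ) ^ 2 * p))))

theorem abs_sum_tsum_int_le {ε : ℝ} (hε : 0 < ε) (W : Finset ℕ) (f : ℤ → ℕ → ℝ)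
    (hf : ∀ p ∈ W, Summable fun n => f n p) {B : ℝ}
    (hB : ∀ n, |∑ p ∈ W, f n p| ≤ B * |(n : ℝ)| ^ (-(1 + ε))) :
    |∑ p ∈ W, ∑' n, f n p| ≤ B * ∑' n : ℤ, |(n : ℝ)| ^ (-(1 + ε)) := by
  rw [← Summable.tsum_finsetSum hf]
  have hs : Summable fun n : ℤ => |(n : ℝ)| ^ (-(1 + ε)) :=
    Real.summable_abs_int_rpow (by linarith)
  exact tsum_of_norm_bounded (f := fun n => ∑ p ∈ W, f n p) (hs.hasSum.mul_left B) hB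

theorem not_isSquare_eight_mul {n : ℤ} (hn : Odd n) : ¬ IsSquare (8 * n) := by
  rintro ⟨r, hr⟩
  have h1 : Even r := by
    by_contra h
    have h2 := (Int.not_even_iff_odd.1 h).mul (Int.not_even_iff_odd.1 h)
    rw [← hr] at h2
    exact (Int.not_even_iff_odd.2 h2) ⟨4 * n, by ring⟩
  obtain ⟨s, rfl⟩ := h1
  have hs : 2 * n = s * s := by linarith
  have h1 : Even s := by
    by_contra h
    have h2 := (Int.not_even_iff_odd.1 h).mul (Int.not_even_iff_odd.1 h)
    rw [← hs] at h2
    exact (Int.not_even_iff_odd.2 h2) ⟨n, by ring⟩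
  obtain ⟨u, rfl⟩ := h1
  exact (Int.not_even_iff_odd.2 hn) ⟨u * u, by linarith⟩

theorem abs_le_rpow_neg {f : ℝ → ℝ} {C : ℝ} (hC : 0 ≤ C) (h : ∀ x, |f x| ≤ C / (1 + |x|) ^ 2)
    {x s : ℝ} (hx : x ≠ 0) (hs0 : 0 ≤ s) (hs2 : s ≤ 2) : |f x| ≤ C * |x| ^ (-s) :=
  (h x).trans <| by
    rw [div_eq_mul_inv]
    gcongr
    exact inv_one_add_sq_le_rpow (abs_pos.2 hx) hs0 hs2

theorem abs_sum_oddSum_le (hGRH : GeneralizedRiemannHypothesis) {Φ : ℝ → ℝ}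
    (hΦsmooth : ContDiff ℝ (⊤ : ℕ∞) Φ) (hΦsupp : HasCompactSupport Φ) {ε : ℝ} (hε : 0 < ε)
    (hε1 : ε ≤ 1 / 2) {y δ : ℝ} (hy : 0 < y) (hδ : δ ≤ 1) :
    ∃ C > 0, ∀ᶠ X : ℝ in atTop, ∀ a : ℕ, 1 ≤ a →
      |∑ p ∈ windowPrimes y δ X, oddSum Φ X a p| ≤
        C * X ^ (2 + 3 * ε) * (a : ℝ) ^ (-(2 + 4 * ε)) := by
  obtain ⟨C, hC, hB⟩ := abs_sum_windowPrimes_le hGRH hε hε1 hy hδ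
  obtain ⟨-, C1, hC1, -, -, hΦ⟩ := exists_cosSinTransform_bound hΦsmooth hΦsupp
  set Z := ∑' n : ℤ, |(n : ℝ)| ^ (-(1 + ε)) with hZ
  have hZ0 : 0 ≤ Z := tsum_nonneg fun n => by positivity
  set c := √(y + 1) + 1 / (2 * √y) with hc
  have hc0 : 0 < c := by positivity
  refine ⟨C1 * C * 8 ^ ε * c * (Z + 1), by positivity, ?_⟩
  filter_upwards [hB, eventually_ge_atTop 1] with X hX hX1 a ha
  have hX0 : 0 < X := by linarith
  have ha0 : (0 : ℝ) < a := by exact_mod_cast ha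
  have hsqrt : ∀ k : ℤ, ¬ IsSquare k →
      |∑ p ∈ windowPrimes y δ X, (jacobiSym k p : ℝ) * √p| ≤
        C * |(k : ℝ)| ^ ε * X ^ (1 / 2 + ε) * (c * √X) := by
    intro k hk
    refine hX k hk Real.sqrt _ fun t ht => ?_
    have ht0 : 0 < t := lt_of_lt_of_le (by positivity) ht.1
    have hsX : 0 < √X := Real.sqrt_pos.2 hX0
    refine ⟨(Real.hasDerivAt_sqrt ht0.ne').differentiableAt, ?_, ?_⟩
    · rw [abs_of_nonneg (Real.sqrt_nonneg _)]
      calc √t ≤ √((y + 1) * X) := Real.sqrt_le_sqrt ht.2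
        _ = √(y + 1) * √X := Real.sqrt_mul (by positivity) _
        _ ≤ c * √X := by gcongr; rw [hc]; linarith [show 0 ≤ 1 / (2 * √y) by positivity]
    · rw [(Real.hasDerivAt_sqrt ht0.ne').deriv, abs_of_nonneg (by positivity)]
      calc 1 / (2 * √t) ≤ 1 / (2 * √(y * X)) := by
            gcongr; exact ht.1
        _ = 1 / (2 * √y) * √X / X := by
            rw [Real.sqrt_mul hy.le]
            nth_rewrite 3 [← Real.mul_self_sqrt hX0.le]
            field_simp
        _ ≤ c * √X / X := by gcongr; rw [hc]; linarith [Real.sqrt_nonneg (y + 1)]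
  have hcX : (a : ℝ) ^ 2 / X ≠ 0 := by positivity
  have key := abs_sum_tsum_int_le hε (windowPrimes y δ X)
    (fun n p => √p * (if Odd n then (jacobiSym (8 * n) p : ℝ) * Φ ((a : ℝ) ^ 2 / X * n) else 0))
    (fun p hp => by
      refine Summable.mul_left _ (Summable.of_norm_bounded
        (summable_abs_int hΦsmooth hΦsupp hcX) fun n => ?_)
      split_ifs
      · rw [norm_mul]
        exact mul_le_of_le_one_left (abs_nonneg _) (abs_jacobiSym_le_one _ p)
      · simp)
    (B := C1 * C * 8 ^ ε * c * (X ^ (2 + 3 * ε) * (a : ℝ) ^ (-(2 + 4 * ε))))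
    (fun n => by
      by_cases hn : Odd n
      · simp only [if_pos hn]
        have hn0 : (n : ℝ) ≠ 0 := by
          rintro h
          rw [Int.cast_eq_zero] at h
          simp [h] at hn
        have hn1 : 0 < |(n : ℝ)| := abs_pos.2 hn0
        have e : ∑ p ∈ windowPrimes y δ X,
            √p * ((jacobiSym (8 * n) p : ℝ) * Φ ((a : ℝ) ^ 2 / X * n)) =
            Φ ((a : ℝ) ^ 2 / X * n) *
              ∑ p ∈ windowPrimes y δ X, (jacobiSym (8 * n) p : ℝ) * √p := by
          rw [mul_sum]
          exact sum_congr rfl fun p _ => by ring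
        rw [e, abs_mul]
        have k1 := abs_le_rpow_neg hC1.le hΦ (mul_ne_zero hcX hn0) (s := 1 + 2 * ε)
          (by linarith) (by linarith)
        have k2 := hsqrt _ (not_isSquare_eight_mul hn)
        refine (mul_le_mul k1 k2 (abs_nonneg _) (by positivity)).trans (le_of_eq ?_)
        push_cast
        rw [abs_mul, abs_mul, abs_of_pos (by positivity : 0 < (a : ℝ) ^ 2 / X),
          abs_of_pos (by norm_num : (0 : ℝ) < 8), Real.mul_rpow (by positivity) hn1.le,
          Real.mul_rpow (by norm_num) hn1.le, Real.div_rpow (by positivity) hX0.le,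
          ← Real.rpow_natCast (a : ℝ) 2, ← Real.rpow_mul ha0.le, Real.sqrt_eq_rpow,
          Real.rpow_neg hX0.le, div_inv_eq_mul]
        have e1 : X ^ (2 + 3 * ε) = X ^ (1 + 2 * ε) * (X ^ (1 / 2 + ε) * X ^ (1 / 2 : ℝ)) := by
          rw [← Real.rpow_add hX0, ← Real.rpow_add hX0]; congr 1; ring
        have e2 : |(n : ℝ)| ^ (-(1 + ε)) = |(n : ℝ)| ^ (-(1 + 2 * ε)) * |(n : ℝ)| ^ ε := by
          rw [← Real.rpow_add hn1]; congr 1; ring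
        have e3 : ((2 : ℕ) : ℝ) * -(1 + 2 * ε) = -(2 + 4 * ε) := by push_cast; ring
        rw [e1, e2, e3]
        ring
      · simp only [if_neg hn]
        simp
        positivity)
  simp_rw [tsum_mul_left] at key
  refine key.trans ?_
  rw [← hZ]
  calc _ ≤ C1 * C * 8 ^ ε * c * (X ^ (2 + 3 * ε) * (a : ℝ) ^ (-(2 + 4 * ε))) * (Z + 1) := by
        gcongr; linarith
    _ = _ := by ring

theorem abs_sum_nonsquareSum_le (hGRH : GeneralizedRiemannHypothesis) {Φ : ℝ → ℝ}
    (hΦsmooth : ContDiff ℝ (⊤ : ℕ∞) Φ) (hΦsupp : HasCompactSupport Φ) {ε : ℝ} (hε : 0 < ε)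
    (hε1 : ε ≤ 1 / 2) {y δ : ℝ} (hy : 0 < y) (hδ : δ ≤ 1) :
    ∃ C > 0, ∀ᶠ X : ℝ in atTop, ∀ a : ℕ, 1 ≤ a →
      |∑ p ∈ windowPrimes y δ X, nonsquareSum (cosSinTransform Φ) X a p| ≤
        C * X ^ (1 / 2 + ε) * (a : ℝ) ^ (2 + 4 * ε) := by
  obtain ⟨C, hC, hB⟩ := abs_sum_windowPrimes_le hGRH hε hε1 hy hδ
  obtain ⟨hd, C1, hC1, h0, h1, -⟩ := exists_cosSinTransform_bound hΦsmooth hΦsupp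
  set ψ := cosSinTransform Φ with hψ
  set Z := ∑' n : ℤ, |(n : ℝ)| ^ (-(1 + ε)) with hZ
  have hZ0 : 0 ≤ Z := tsum_nonneg fun n => by positivity
  refine ⟨C * C1 * (1 + 1 / y) * (2 * (y + 1)) ^ (1 + 2 * ε) * (Z + 1), by positivity, ?_⟩
  filter_upwards [hB, eventually_ge_atTop 1] with X hX hX1 a ha
  have hX0 : 0 < X := by linarith
  have ha0 : (0 : ℝ) < a := by exact_mod_cast ha
  have hk : ∀ k : ℤ, ¬ IsSquare k →
      |∑ p ∈ windowPrimes y δ X, (jacobiSym k p : ℝ) * ψ (k * X / (2 * (a : ℝ) ^ 2 * p))| ≤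
        C * |(k : ℝ)| ^ ε * X ^ (1 / 2 + ε) *
          (C1 * (1 + 1 / y) * (2 * (y + 1) * (a : ℝ) ^ 2 / |(k : ℝ)|) ^ (1 + 2 * ε)) := by
    intro k hk
    have hk0 : (k : ℝ) ≠ 0 := by
      intro h
      rw [Int.cast_eq_zero] at h
      exact hk ⟨0, by simp [h]⟩
    have hk1 : 0 < |(k : ℝ)| := abs_pos.2 hk0
    set κ : ℝ := k * X / (2 * (a : ℝ) ^ 2) with hκ
    have hκ0 : κ ≠ 0 := by positivity
    have hκa : |κ| = |(k : ℝ)| * X / (2 * (a : ℝ) ^ 2) := by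
      rw [hκ, abs_div, abs_mul, abs_of_pos hX0,
        abs_of_pos (by positivity : 0 < 2 * (a : ℝ) ^ 2)]
    have := hX k hk (fun t => ψ (κ / t))
      (C1 * (1 + 1 / y) * (2 * (y + 1) * (a : ℝ) ^ 2 / |(k : ℝ)|) ^ (1 + 2 * ε)) fun t ht => by
        have ht0 : 0 < t := lt_of_lt_of_le (by positivity) ht.1
        have hder : HasDerivAt (fun t => ψ (κ / t)) (deriv ψ (κ / t) * (-κ / t ^ 2)) t := by
          have h2 : HasDerivAt (fun t : ℝ => κ / t) (-κ / t ^ 2) t := by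
            refine ((hasDerivAt_inv ht0.ne').const_mul κ).congr_deriv ?_
            ring
          exact (hd _).hasDerivAt.comp t h2
        have hbase : C1 / (1 + |κ / t|) ^ 2 ≤
            C1 * (2 * (y + 1) * (a : ℝ) ^ 2 / |(k : ℝ)|) ^ (1 + 2 * ε) := by
          rw [div_eq_mul_inv]
          gcongr
          refine (inv_one_add_sq_le_rpow (s := 1 + 2 * ε)
            (abs_pos.2 (div_ne_zero hκ0 ht0.ne')) (by linarith) (by linarith)).trans ?_
          rw [Real.rpow_neg (by positivity), ← Real.inv_rpow (by positivity)]
          refine Real.rpow_le_rpow (by positivity) ?_ (by linarith)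
          rw [abs_div, abs_of_pos ht0, inv_div, hκa]
          calc t / (|(k : ℝ)| * X / (2 * (a : ℝ) ^ 2)) ≤
              (y + 1) * X / (|(k : ℝ)| * X / (2 * (a : ℝ) ^ 2)) := by gcongr; exact ht.2
            _ = _ := by field_simp
        refine ⟨hder.differentiableAt, ?_, ?_⟩
        · refine (h0 _).trans (hbase.trans ?_)
          have : (1 : ℝ) ≤ 1 + 1 / y := by simp [hy.le]
          calc _ = C1 * 1 * (2 * (y + 1) * (a : ℝ) ^ 2 / |(k : ℝ)|) ^ (1 + 2 * ε) := by ring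
            _ ≤ _ := by gcongr
        · rw [hder.deriv, abs_mul]
          have e1 : |(-κ / t ^ 2)| = |κ / t| / t := by
            rw [abs_div, abs_div, abs_neg, abs_of_pos ht0,
              abs_of_pos (by positivity : 0 < t ^ 2)]
            field_simp
          rw [e1]
          have k0 : 0 ≤ |κ / t| := abs_nonneg _
          calc |deriv ψ (κ / t)| * (|κ / t| / t) ≤
                C1 / (1 + |κ / t|) ^ 3 * ((1 + |κ / t|) / t) := by
                gcongr
                · exact h1 _
                · linarith
            _ = C1 / (1 + |κ / t|) ^ 2 / t := by field_simp
            _ ≤ C1 * (2 * (y + 1) * (a : ℝ) ^ 2 / |(k : ℝ)|) ^ (1 + 2 * ε) / (y * X) := by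
                gcongr; exact ht.1
            _ = C1 * (1 / y) * (2 * (y + 1) * (a : ℝ) ^ 2 / |(k : ℝ)|) ^ (1 + 2 * ε) / X := by
                field_simp
            _ ≤ _ := by gcongr; linarith
    refine le_trans (le_of_eq ?_) this
    congr 1
    refine sum_congr rfl fun p _ => ?_
    rw [hκ, div_div]
  have hsum : ∀ p ∈ windowPrimes y δ X, Summable fun k : ℤ => (if IsSquare k then 0 else
      (if Even k then 1 else -1) *
        ((jacobiSym k p : ℝ) * ψ (k * X / (2 * (a : ℝ) ^ 2 * p)))) := by
    intro p hp
    have hp0 : (0 : ℝ) < p := by exact_mod_cast (mem_windowPrimes.1 hp).1.pos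
    have hq : X / (2 * (a : ℝ) ^ 2 * p) ≠ 0 := by positivity
    refine Summable.of_norm_bounded
      (summable_abs_cosSinTransform_int hΦsmooth hΦsupp hq) fun k => ?_
    have e1 : ∀ x : ℝ, ‖(if Even k then 1 else -1) * x‖ = |x| := by
      intro x; split_ifs <;> simp
    by_cases hsq : IsSquare k
    · simp [hsq]
    · rw [if_neg hsq, e1, abs_mul, show X / (2 * (a : ℝ) ^ 2 * p) * k = k * X / (2 * (a : ℝ) ^ 2 * p) by ring]
      exact mul_le_of_le_one_left (abs_nonneg _) (abs_jacobiSym_le_one k p)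
  have key := abs_sum_tsum_int_le hε (windowPrimes y δ X) _ hsum
    (B := C * C1 * (1 + 1 / y) * (2 * (y + 1)) ^ (1 + 2 * ε) *
      (X ^ (1 / 2 + ε) * (a : ℝ) ^ (2 + 4 * ε)))
    (fun k => by
      by_cases hsq : IsSquare k
      · simp only [if_pos hsq]
        simp
        positivity
      · simp only [if_neg hsq]
        have hk0 : (k : ℝ) ≠ 0 := by
          intro h
          rw [Int.cast_eq_zero] at h
          exact hsq ⟨0, by simp [h]⟩
        have hk1 : 0 < |(k : ℝ)| := abs_pos.2 hk0
        rw [← mul_sum, abs_mul]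
        have e1 : |(if Even k then 1 else -1 : ℝ)| = 1 := by split_ifs <;> simp
        rw [e1, one_mul]
        refine (hk k hsq).trans (le_of_eq ?_)
        rw [Real.div_rpow (by positivity) hk1.le, Real.mul_rpow (by positivity) (by positivity),
          ← Real.rpow_natCast (a : ℝ) 2, ← Real.rpow_mul ha0.le]
        have e2 : |(k : ℝ)| ^ (-(1 + ε)) = |(k : ℝ)| ^ ε / |(k : ℝ)| ^ (1 + 2 * ε) := by
          rw [← Real.rpow_sub hk1]; congr 1; ring
        have e3 : ((2 : ℕ) : ℝ) * (1 + 2 * ε) = 2 + 4 * ε := by push_cast; ring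
        rw [e2, e3]
        ring)
  unfold nonsquareSum
  refine le_trans (le_of_eq ?_) (key.trans ?_)
  · congr 1
  · rw [← hZ]
    calc _ ≤ C * C1 * (1 + 1 / y) * (2 * (y + 1)) ^ (1 + 2 * ε) *
        (X ^ (1 / 2 + ε) * (a : ℝ) ^ (2 + 4 * ε)) * (Z + 1) := by
          gcongr; linarith
      _ = _ := by ring

/-- The contribution of the square frequencies to the dual side of `oddSum`. -/
noncomputable def squareSum (ψ : ℝ → ℝ) (X : ℝ) (a p : ℕ) : ℝ :=
  ∑' m : ℕ, (-1 : ℝ) ^ (m + 1) * (jacobiSym (((m : ℤ) + 1) ^ 2) p : ℝ) *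
    ψ (((m : ℝ) + 1) ^ 2 * (X / (2 * (a : ℝ) ^ 2 * p)))

theorem oddSum_eq {Φ : ℝ → ℝ} (hΦsmooth : ContDiff ℝ (⊤ : ℕ∞) Φ) (hΦsupp : HasCompactSupport Φ)
    {X : ℝ} (hX : 0 < X) {a p : ℕ} (ha : a ≠ 0) (hp : p.Prime) (hp2 : p ≠ 2) :
    oddSum Φ X a p = X / (2 * (a : ℝ) ^ 2) *
      (squareSum (cosSinTransform Φ) X a p + nonsquareSum (cosSinTransform Φ) X a p) := by
  classical
  have hp0 : (0 : ℝ) < p := by exact_mod_cast hp.pos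
  have ha0 : (0 : ℝ) < a := by exact_mod_cast Nat.pos_of_ne_zero ha
  rw [oddSum, sqrt_mul_tsum_odd_jacobiSym hΦsmooth hΦsupp hp hp2 (by positivity)]
  have e0 : 1 / (2 * ((a : ℝ) ^ 2 / X)) = X / (2 * (a : ℝ) ^ 2) := by field_simp
  rw [e0]
  congr 1
  set F : ℤ → ℝ := fun k => (if Even k then 1 else -1) *
    ((jacobiSym k p : ℝ) * cosSinTransform Φ (k * X / (2 * (a : ℝ) ^ 2 * p))) with hF
  have e1 : ∀ k : ℤ, (if Even k then 1 else -1) *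
      ((jacobiSym k p : ℝ) * cosSinTransform Φ (k / (2 * ((a : ℝ) ^ 2 / X) * p))) =
      (if IsSquare k then F k else 0) + (if IsSquare k then 0 else F k) := by
    intro k
    have : (k : ℝ) / (2 * ((a : ℝ) ^ 2 / X) * p) = k * X / (2 * (a : ℝ) ^ 2 * p) := by field_simp
    rw [this]
    split_ifs <;> simp_all
  have hFs : Summable F := by
    have hq : X / (2 * (a : ℝ) ^ 2 * p) ≠ 0 := by positivity
    refine Summable.of_norm_bounded
      (summable_abs_cosSinTransform_int hΦsmooth hΦsupp hq) fun k => ?_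
    have e1 : ∀ x : ℝ, ‖(if Even k then 1 else -1) * x‖ = |x| := by
      intro x; split_ifs <;> simp
    rw [hF, e1, abs_mul, show X / (2 * (a : ℝ) ^ 2 * p) * k = k * X / (2 * (a : ℝ) ^ 2 * p) by ring]
    exact mul_le_of_le_one_left (abs_nonneg _) (abs_jacobiSym_le_one k p)
  have hs1 : Summable fun k : ℤ => if IsSquare k then F k else 0 :=
    (hFs.indicator {k | IsSquare k}).congr fun k => by simp [Set.indicator_apply]
  have hs2 : Summable fun k : ℤ => if IsSquare k then 0 else F k :=
    (hFs.indicator {k | ¬ IsSquare k}).congr fun k => by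
      by_cases h : IsSquare k <;> simp [h]
  simp_rw [e1]
  rw [hs1.tsum_add hs2]
  congr 1
  · have hinj : Function.Injective fun m : ℕ => ((m : ℤ) + 1) ^ 2 := by
      intro m n h
      simp only at h
      have := (sq_eq_sq₀ (by positivity) (by positivity)).1 h
      omega
    rw [← hinj.tsum_eq (f := fun k : ℤ => if IsSquare k then F k else 0), squareSum]
    · refine tsum_congr fun m => ?_
      rw [if_pos ⟨(m : ℤ) + 1, sq _⟩, hF]
      have h1 : (if Even (((m : ℤ) + 1) ^ 2) then 1 else -1 : ℝ) = (-1) ^ (m + 1) := by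
        by_cases h : Even (m + 1)
        · have h' : Even ((m : ℤ) + 1) := by exact_mod_cast h
          rw [if_pos (h'.pow_of_ne_zero two_ne_zero), h.neg_one_pow]
        · have h' : ¬ Even (((m : ℤ) + 1) ^ 2) := by
            rw [Int.even_pow' two_ne_zero]; exact_mod_cast h
          rw [if_neg h', (Nat.not_even_iff_odd.1 h).neg_one_pow]
      simp only [h1]
      push_cast
      rw [mul_div_assoc]
      exact (mul_assoc _ _ _).symm
    · intro k hk
      rw [Function.mem_support] at hk
      have hsq : IsSquare k := by
        by_contra h
        exact hk (if_neg h)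
      obtain ⟨r, rfl⟩ := hsq
      have hr : r ≠ 0 := by
        rintro rfl
        apply hk
        rw [hF]
        simp [jacobiSym.zero_left hp.one_lt]
      refine ⟨r.natAbs - 1, ?_⟩
      have h2 : 1 ≤ r.natAbs := Nat.one_le_iff_ne_zero.2 (Int.natAbs_ne_zero.2 hr)
      simp only
      rw [Nat.cast_sub h2, Nat.cast_one, sub_add_cancel, Int.natCast_natAbs, sq_abs, sq]

/-- The pairs `(X, p)` with `p` in the window of `X`, as `X → ∞`. -/
def windowFilter (y δ : ℝ) : Filter (ℝ × ℕ) :=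
  comap Prod.fst atTop ⊓ 𝓟 {q | q.2 ∈ windowPrimes y δ q.1}

theorem eventually_windowFilter {y δ : ℝ} {P : ℝ × ℕ → Prop} :
    (∀ᶠ q in windowFilter y δ, P q) ↔
      ∀ᶠ X : ℝ in atTop, ∀ p ∈ windowPrimes y δ X, P (X, p) := by
  rw [windowFilter, eventually_inf_principal, eventually_comap]
  refine eventually_congr (Eventually.of_forall fun X => ?_)
  constructor
  · intro h p hp
    exact h (X, p) rfl hp
  · rintro h ⟨X', p⟩ rfl hp
    exact h p hp

theorem tendsto_fst_windowFilter (y δ : ℝ) :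
    Tendsto Prod.fst (windowFilter y δ) atTop :=
  tendsto_comap.mono_left inf_le_left

theorem tendsto_snd_windowFilter {y : ℝ} (hy : 0 < y) (δ : ℝ) :
    Tendsto Prod.snd (windowFilter y δ) atTop := by
  rw [tendsto_atTop]
  intro b
  rw [eventually_windowFilter]
  filter_upwards [eventually_ge_atTop (b / y)] with X hX p hp
  rw [div_le_iff₀' hy] at hX
  exact_mod_cast hX.trans (mem_windowPrimes.1 hp).2.1

theorem tendsto_div_windowFilter {y δ : ℝ} (hy : 0 < y) (hδ : δ < 1) :
    Tendsto (fun q : ℝ × ℕ => q.1 / q.2) (windowFilter y δ) (𝓝 (1 / y)) := by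
  have h : Tendsto (fun q : ℝ × ℕ => (q.2 : ℝ) / q.1) (windowFilter y δ) (𝓝 y) := by
    have h0 : Tendsto (fun X : ℝ => y + X ^ (-(1 - δ))) atTop (𝓝 y) := by
      have := (tendsto_rpow_neg_atTop (by linarith : 0 < 1 - δ)).const_add y
      rwa [add_zero] at this
    refine tendsto_of_tendsto_of_tendsto_of_le_of_le' tendsto_const_nhds
      (h0.comp (tendsto_fst_windowFilter y δ)) ?_ ?_
    · rw [eventually_windowFilter]
      filter_upwards [eventually_gt_atTop 0] with X hX p hp
      rw [le_div_iff₀ hX]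
      exact (mem_windowPrimes.1 hp).2.1
    · rw [eventually_windowFilter]
      filter_upwards [eventually_gt_atTop 0] with X hX p hp
      simp only [Function.comp]
      rw [div_le_iff₀ hX, add_mul]
      nth_rewrite 3 [← Real.rpow_one X]
      rw [← Real.rpow_add hX, show -(1 - δ) + 1 = δ by ring]
      exact (mem_windowPrimes.1 hp).2.2
  have := h.inv₀ hy.ne'
  rw [← one_div] at this
  exact this.congr fun q => by rw [inv_div]

theorem jacobiSym_sq_eq_one_of_lt {m p : ℕ} (hp : p.Prime) (h : m + 1 < p) :
    jacobiSym (((m : ℤ) + 1) ^ 2) p = 1 := by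
  refine jacobiSym.sq_one' ?_
  rw [Int.gcd_eq_natAbs]
  have : ((m : ℤ) + 1).natAbs = m + 1 := by omega
  rw [this, Int.natAbs_natCast]
  exact (Nat.coprime_of_lt_prime (Nat.succ_ne_zero m) h hp).symm

theorem tendsto_squareSum {ψ : ℝ → ℝ} {C : ℝ} (hd : Differentiable ℝ ψ)
    (h0 : ∀ ξ, |ψ ξ| ≤ C / (1 + |ξ|) ^ 2) {y δ : ℝ} (hy : 0 < y) (hδ : δ < 1) {a : ℕ}
    (ha : a ≠ 0) :
    Tendsto (fun q : ℝ × ℕ => squareSum ψ q.1 a q.2) (windowFilter y δ)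
      (𝓝 (∑' m : ℕ, (-1 : ℝ) ^ (m + 1) * ψ (((m : ℝ) + 1) ^ 2 / (2 * (a : ℝ) ^ 2 * y)))) := by
  have hC : 0 ≤ C := by simpa using (abs_nonneg _).trans (h0 0)
  have ha0 : (0 : ℝ) < a := by exact_mod_cast Nat.pos_of_ne_zero ha
  unfold squareSum
  refine tendsto_tsum_of_dominated_convergence
    (bound := fun m : ℕ => C / (1 / (2 * (a : ℝ) ^ 2 * (y + 1))) * (1 / ((m : ℝ) + 1) ^ 2))
    (summable_one_div_succ_sq.mul_left _) (fun m => ?_) ?_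
  · have h1 : Tendsto (fun q : ℝ × ℕ => (-1 : ℝ) ^ (m + 1) *
        ψ (((m : ℝ) + 1) ^ 2 / (2 * (a : ℝ) ^ 2) * (q.1 / q.2))) (windowFilter y δ)
        (𝓝 ((-1 : ℝ) ^ (m + 1) * ψ (((m : ℝ) + 1) ^ 2 / (2 * (a : ℝ) ^ 2) * (1 / y)))) :=
      ((hd.continuous.tendsto _).comp ((tendsto_div_windowFilter hy hδ).const_mul _)).const_mul _
    rw [show ((m : ℝ) + 1) ^ 2 / (2 * (a : ℝ) ^ 2) * (1 / y) =
      ((m : ℝ) + 1) ^ 2 / (2 * (a : ℝ) ^ 2 * y) by field_simp] at h1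
    refine h1.congr' ?_
    have h2 : ∀ᶠ q : ℝ × ℕ in windowFilter y δ, q.2.Prime := by
      rw [eventually_windowFilter]
      exact Eventually.of_forall fun X p hp => (mem_windowPrimes.1 hp).1
    filter_upwards [(tendsto_snd_windowFilter hy δ).eventually_gt_atTop (m + 1), h2] with q hq hp
    rw [jacobiSym_sq_eq_one_of_lt hp hq, Int.cast_one, mul_one]
    congr 2
    have : (q.2 : ℝ) ≠ 0 := by exact_mod_cast hp.ne_zero
    field_simp
  · rw [eventually_windowFilter]
    filter_upwards [eventually_ge_atTop 1] with X hX p hp m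
    have hp0 : (0 : ℝ) < p := by exact_mod_cast (mem_windowPrimes.1 hp).1.pos
    have hpX := le_of_mem_windowPrimes hX hδ.le hp
    have hX0 : 0 < X := by linarith
    have ht : 0 < X / (2 * (a : ℝ) ^ 2 * p) := by positivity
    have ht1 : 1 / (2 * (a : ℝ) ^ 2 * (y + 1)) ≤ X / (2 * (a : ℝ) ^ 2 * p) := by
      rw [div_le_div_iff₀ (by positivity) (by positivity)]
      calc 1 * (2 * (a : ℝ) ^ 2 * p) ≤ 1 * (2 * (a : ℝ) ^ 2 * ((y + 1) * X)) := by gcongr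
        _ = _ := by ring
    rw [norm_mul, norm_mul, norm_pow, norm_neg, norm_one, one_pow, one_mul]
    refine (mul_le_of_le_one_left (norm_nonneg _) (abs_jacobiSym_le_one _ p)).trans
      ((summable_sq_bound h0 ht m).trans ?_)
    gcongr

/-- The Möbius weights of the odd sieve. -/
noncomputable def oddMoebius (a : ℕ) : ℝ :=
  if Odd a then (ArithmeticFunction.moebius a : ℝ) else 0

theorem abs_oddMoebius_le_one (a : ℕ) : |oddMoebius a| ≤ 1 := by
  rw [oddMoebius]
  split_ifs
  · exact_mod_cast ArithmeticFunction.abs_moebius_le_one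
  · simp

theorem oddMoebius_zero : oddMoebius 0 = 0 := by simp [oddMoebius]

theorem tendsto_sum_squareSum {ψ : ℝ → ℝ} {C : ℝ} (hd : Differentiable ℝ ψ)
    (h0 : ∀ ξ, |ψ ξ| ≤ C / (1 + |ξ|) ^ 2) (h1 : ∀ ξ, |deriv ψ ξ| ≤ C / (1 + |ξ|) ^ 3)
    {y δ : ℝ} (hy : 0 < y) (hδ : δ < 1) :
    Tendsto (fun q : ℝ × ℕ => ∑ a ∈ range (⌊q.1 ^ (1 / 4 : ℝ)⌋₊ + 1),
        oddMoebius a / (a : ℝ) ^ 2 * squareSum ψ q.1 a q.2) (windowFilter y δ)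
      (𝓝 (∑' a : ℕ, oddMoebius a / (a : ℝ) ^ 2 *
        ∑' m : ℕ, (-1 : ℝ) ^ (m + 1) * ψ (((m : ℝ) + 1) ^ 2 / (2 * (a : ℝ) ^ 2 * y)))) := by
  have hC : 0 ≤ C := by simpa using (abs_nonneg _).trans (h0 0)
  set Z := ∑' m : ℕ, 1 / ((m : ℝ) + 1) ^ 2 with hZ
  have hZ0 : 0 ≤ Z := tsum_nonneg fun m => by positivity
  have e : ∀ q : ℝ × ℕ, ∑ a ∈ range (⌊q.1 ^ (1 / 4 : ℝ)⌋₊ + 1),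
        oddMoebius a / (a : ℝ) ^ 2 * squareSum ψ q.1 a q.2 =
      ∑' a : ℕ, (if a ∈ range (⌊q.1 ^ (1 / 4 : ℝ)⌋₊ + 1) then
        oddMoebius a / (a : ℝ) ^ 2 * squareSum ψ q.1 a q.2 else 0) := by
    intro q
    rw [tsum_eq_sum (s := range (⌊q.1 ^ (1 / 4 : ℝ)⌋₊ + 1)) fun a ha => if_neg ha]
    exact sum_congr rfl fun a ha => (if_pos ha).symm
  simp_rw [e]
  refine tendsto_tsum_of_dominated_convergence
    (bound := fun a : ℕ => (C + C / (y / 2) * Z) * (1 / (a : ℝ) ^ 2))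
    ((Real.summable_one_div_nat_pow.2 one_lt_two).mul_left _) (fun a => ?_) ?_
  · rcases Nat.eq_zero_or_pos a with rfl | ha
    · simpa using tendsto_const_nhds
    · refine ((tendsto_squareSum hd h0 hy hδ ha.ne').const_mul _).congr' ?_
      have hlim := (tendsto_rpow_atTop (by norm_num : (0 : ℝ) < 1 / 4)).comp
        (tendsto_fst_windowFilter y δ)
      filter_upwards [hlim.eventually_ge_atTop (a : ℝ)] with q hq
      rw [if_pos]
      rw [mem_range, Nat.lt_succ_iff]
      exact Nat.le_floor hq
  · rw [eventually_windowFilter]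
    filter_upwards [eventually_ge_atTop 1] with X hX p hp a
    have hX0 : 0 < X := by linarith
    obtain ⟨hpp, hpX, -⟩ := mem_windowPrimes.1 hp
    have hp0 : (0 : ℝ) < p := by exact_mod_cast hpp.pos
    rcases Nat.eq_zero_or_pos a with rfl | ha
    · simp
    · have ha0 : (0 : ℝ) < a := by exact_mod_cast ha
      split_ifs with hmem
      · rw [mem_range, Nat.lt_succ_iff, Nat.le_floor_iff (by positivity)] at hmem
        have haX : (a : ℝ) ^ 2 ≤ X := by
          calc (a : ℝ) ^ 2 ≤ (X ^ (1 / 4 : ℝ)) ^ 2 := by gcongr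
            _ = X ^ (1 / 2 : ℝ) := by rw [← Real.rpow_natCast, ← Real.rpow_mul hX0.le]; norm_num
            _ ≤ X := Real.rpow_le_self_of_one_le hX (by norm_num)
        have ht : 0 < X / (2 * (a : ℝ) ^ 2 * p) := by positivity
        have hb := abs_tsum_jacobiSym_sq_le hd h0 h1 ht hpp
        rw [norm_mul, norm_div, norm_pow, Real.norm_natCast, mul_comm]
        refine mul_le_mul (hb.trans ?_) ?_ (by positivity) (by positivity)
        · gcongr
          calc y / 2 ≤ y * X / 2 := by gcongr; exact le_mul_of_one_le_right hy.le hX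
            _ = y * X * (X / (2 * X)) := by field_simp
            _ ≤ p * (X / (2 * (a : ℝ) ^ 2)) := by gcongr
            _ = _ := by field_simp
        · gcongr
          exact abs_oddMoebius_le_one a
      · simp
        positivity

theorem finsum_eq_sum_oddSum {Φ : ℝ → ℝ} {R X : ℝ} (hR : ∀ x, Φ x ≠ 0 → |x| ≤ R) (hX : 0 < X)
    {N p : ℕ} (hp : p.Prime) (hN : R * X < (N : ℝ) ^ 2) (hNp : N ≤ p) :
    ∑ᶠ d ∈ {d : ℤ | Odd d ∧ Squarefree d},
        Φ ((d : ℝ) / X) * (jacobiSym (8 * d) p : ℝ) * Real.sqrt p =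
      ∑ a ∈ range N, oddMoebius a * oddSum Φ X a p := by
  rw [finsum_odd_squarefree (fun d : ℤ => Φ ((d : ℝ) / X) * (jacobiSym (8 * d) p : ℝ) *
    Real.sqrt p) (N := N)]
  · refine sum_congr rfl fun a ha => ?_
    rcases Nat.eq_zero_or_pos a with rfl | ha0
    · simp [oddMoebius]
    rw [oddMoebius, oddSum]
    congr 1
    rw [← tsum_mul_left]
    refine tsum_congr fun n => ?_
    split_ifs
    · have hcop : Int.gcd (a : ℤ) (p : ℤ) = 1 := by
        rw [Int.gcd_natCast_natCast]
        exact (Nat.Coprime.symm ((Nat.Prime.coprime_iff_not_dvd hp).2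
          (Nat.not_dvd_of_pos_of_lt ha0 ((mem_range.1 ha).trans_le hNp))))
      have hJ : jacobiSym (8 * ((a : ℤ) ^ 2 * n)) p = jacobiSym (8 * n) p := by
        rw [show 8 * ((a : ℤ) ^ 2 * n) = (a : ℤ) ^ 2 * (8 * n) by ring, jacobiSym.mul_left,
          jacobiSym.sq_one' hcop, one_mul]
      rw [hJ]
      push_cast
      rw [show (a : ℝ) ^ 2 * n / X = (a : ℝ) ^ 2 / X * n by ring]
      ring
    · simp
  · intro d hd
    have h1 := hR _ (left_ne_zero_of_mul (left_ne_zero_of_mul hd))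
    rw [abs_div, abs_of_pos hX, div_le_iff₀ hX] at h1
    have h2 : |(d : ℝ)| < (N : ℝ) ^ 2 := h1.trans_lt hN
    exact_mod_cast h2

theorem exists_abs_le_of_hasCompactSupport {Φ : ℝ → ℝ} (h : HasCompactSupport Φ) :
    ∃ R, ∀ x, Φ x ≠ 0 → |x| ≤ R := by
  obtain ⟨R, hR⟩ := h.isCompact.isBounded.exists_norm_le
  exact ⟨R, fun x hx => hR x (subset_tsupport _ hx)⟩

theorem eventually_finsum_eq_sum_oddSum {Φ : ℝ → ℝ} (hΦ : HasCompactSupport Φ) {y : ℝ}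
    (hy : 0 < y) (δ : ℝ) :
    ∀ᶠ X : ℝ in atTop, ∀ p ∈ windowPrimes y δ X,
      ∑ᶠ d ∈ {d : ℤ | Odd d ∧ Squarefree d},
          Φ ((d : ℝ) / X) * (jacobiSym (8 * d) p : ℝ) * Real.sqrt p =
        ∑ a ∈ range (⌊X ^ (3 / 4 : ℝ)⌋₊ + 1), oddMoebius a * oddSum Φ X a p := by
  obtain ⟨R, hR⟩ := exists_abs_le_of_hasCompactSupport hΦ
  have hlim : Tendsto (fun X : ℝ => X ^ (1 / 4 : ℝ)) atTop atTop :=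
    tendsto_rpow_atTop (by norm_num)
  have hlim2 : Tendsto (fun X : ℝ => X ^ (1 / 2 : ℝ)) atTop atTop :=
    tendsto_rpow_atTop (by norm_num)
  filter_upwards [eventually_ge_atTop 1, hlim.eventually_ge_atTop (2 / y),
    hlim2.eventually_ge_atTop R] with X hX h1 h2 p hp
  have hX0 : 0 < X := by linarith
  obtain ⟨hpp, hpX, -⟩ := mem_windowPrimes.1 hp
  have h34 : 1 ≤ X ^ (3 / 4 : ℝ) := Real.one_le_rpow hX (by norm_num)
  refine finsum_eq_sum_oddSum hR hX0 hpp ?_ ?_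
  · have hlt : X ^ (3 / 4 : ℝ) < ((⌊X ^ (3 / 4 : ℝ)⌋₊ + 1 : ℕ) : ℝ) := by
      push_cast; exact Nat.lt_floor_add_one _
    calc R * X ≤ X ^ (1 / 2 : ℝ) * X := by gcongr
      _ = (X ^ (3 / 4 : ℝ)) ^ 2 := by
        rw [← Real.rpow_add_one hX0.ne', ← Real.rpow_natCast, ← Real.rpow_mul hX0.le]; norm_num
      _ < _ := by gcongr
  · have h3 : (⌊X ^ (3 / 4 : ℝ)⌋₊ : ℝ) ≤ X ^ (3 / 4 : ℝ) := Nat.floor_le (by positivity)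
    have h4 : X ^ (1 / 4 : ℝ) * X ^ (3 / 4 : ℝ) = X := by
      rw [← Real.rpow_add hX0]; norm_num
    rw [div_le_iff₀ hy] at h1
    have h5 : 2 * X ^ (3 / 4 : ℝ) ≤ y * X := by
      calc 2 * X ^ (3 / 4 : ℝ) ≤ X ^ (1 / 4 : ℝ) * y * X ^ (3 / 4 : ℝ) := by gcongr
        _ = y * (X ^ (1 / 4 : ℝ) * X ^ (3 / 4 : ℝ)) := by ring
        _ = y * X := by rw [h4]
    have : ((⌊X ^ (3 / 4 : ℝ)⌋₊ + 1 : ℕ) : ℝ) ≤ p := by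
      push_cast; linarith
    exact_mod_cast this

theorem abs_sum_Ico_oddSum_le (hGRH : GeneralizedRiemannHypothesis) {Φ : ℝ → ℝ}
    (hΦsmooth : ContDiff ℝ (⊤ : ℕ∞) Φ) (hΦsupp : HasCompactSupport Φ) {ε : ℝ} (hε : 0 < ε)
    (hε1 : ε ≤ 1 / 2) {y δ : ℝ} (hy : 0 < y) (hδ : δ ≤ 1) :
    ∃ C > 0, ∀ᶠ X : ℝ in atTop, ∀ N : ℕ,
      |∑ a ∈ Ico (⌊X ^ (1 / 4 : ℝ)⌋₊ + 1) N, oddMoebius a *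
        ∑ p ∈ windowPrimes y δ X, oddSum Φ X a p| ≤ C * X ^ (7 / 4 + 3 * ε) := by
  obtain ⟨C, hC, h⟩ := abs_sum_oddSum_le hGRH hΦsmooth hΦsupp hε hε1 hy hδ
  have hsum : Summable fun a : ℕ => (a : ℝ) ^ (-(1 + 4 * ε)) :=
    Real.summable_nat_rpow.2 (by linarith)
  set Z := ∑' a : ℕ, (a : ℝ) ^ (-(1 + 4 * ε)) with hZ
  have hZ0 : 0 ≤ Z := tsum_nonneg fun a => by positivity
  refine ⟨C * (Z + 1), by positivity, ?_⟩
  filter_upwards [h, eventually_ge_atTop 1] with X hX hX1 N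
  have hX0 : 0 < X := by linarith
  have hterm : ∀ a ∈ Ico (⌊X ^ (1 / 4 : ℝ)⌋₊ + 1) N,
      |oddMoebius a * ∑ p ∈ windowPrimes y δ X, oddSum Φ X a p| ≤
        C * X ^ (7 / 4 + 3 * ε) * (a : ℝ) ^ (-(1 + 4 * ε)) := by
    intro a ha
    have ha1 := (mem_Ico.1 ha).1
    have haX : X ^ (1 / 4 : ℝ) ≤ a := by
      have := Nat.lt_floor_add_one (X ^ (1 / 4 : ℝ))
      have h2 : ((⌊X ^ (1 / 4 : ℝ)⌋₊ + 1 : ℕ) : ℝ) ≤ a := by exact_mod_cast ha1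
      push_cast at h2
      linarith
    have ha0 : (0 : ℝ) < a := lt_of_lt_of_le (by positivity) haX
    rw [abs_mul]
    calc |oddMoebius a| * |∑ p ∈ windowPrimes y δ X, oddSum Φ X a p|
        ≤ 1 * (C * X ^ (2 + 3 * ε) * (a : ℝ) ^ (-(2 + 4 * ε))) := by
          gcongr
          · exact abs_oddMoebius_le_one a
          · exact hX a (by omega)
      _ = C * X ^ (2 + 3 * ε) * (a : ℝ) ^ (-(1 + 4 * ε)) * (a : ℝ)⁻¹ := by
          rw [show -(2 + 4 * ε) = -(1 + 4 * ε) + (-1) by ring, Real.rpow_add ha0,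
            Real.rpow_neg_one]
          ring
      _ ≤ C * X ^ (2 + 3 * ε) * (a : ℝ) ^ (-(1 + 4 * ε)) * (X ^ (1 / 4 : ℝ))⁻¹ := by
          gcongr
      _ = _ := by
          rw [← Real.rpow_neg hX0.le, show 7 / 4 + 3 * ε = 2 + 3 * ε + -(1 / 4) by ring,
            Real.rpow_add hX0 (2 + 3 * ε)]
          ring
  calc _ ≤ ∑ a ∈ Ico (⌊X ^ (1 / 4 : ℝ)⌋₊ + 1) N,
        |oddMoebius a * ∑ p ∈ windowPrimes y δ X, oddSum Φ X a p| := abs_sum_le_sum_abs _ _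
    _ ≤ ∑ a ∈ Ico (⌊X ^ (1 / 4 : ℝ)⌋₊ + 1) N,
        C * X ^ (7 / 4 + 3 * ε) * (a : ℝ) ^ (-(1 + 4 * ε)) := sum_le_sum hterm
    _ = C * X ^ (7 / 4 + 3 * ε) * ∑ a ∈ Ico (⌊X ^ (1 / 4 : ℝ)⌋₊ + 1) N,
        (a : ℝ) ^ (-(1 + 4 * ε)) := by rw [mul_sum]
    _ ≤ C * X ^ (7 / 4 + 3 * ε) * (Z + 1) := by
        gcongr
        exact (hsum.sum_le_tsum _ fun a _ => by positivity).trans (by linarith)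
    _ = _ := by ring

theorem abs_sum_range_nonsquareSum_le (hGRH : GeneralizedRiemannHypothesis) {Φ : ℝ → ℝ}
    (hΦsmooth : ContDiff ℝ (⊤ : ℕ∞) Φ) (hΦsupp : HasCompactSupport Φ) {ε : ℝ} (hε : 0 < ε)
    (hε1 : ε ≤ 1 / 2) {y δ : ℝ} (hy : 0 < y) (hδ : δ ≤ 1) :
    ∃ C > 0, ∀ᶠ X : ℝ in atTop,
      |∑ a ∈ range (⌊X ^ (1 / 4 : ℝ)⌋₊ + 1), oddMoebius a * (X / (2 * (a : ℝ) ^ 2) *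
        ∑ p ∈ windowPrimes y δ X, nonsquareSum (cosSinTransform Φ) X a p)| ≤
        C * X ^ (7 / 4 + 3 * ε) := by
  obtain ⟨C, hC, h⟩ := abs_sum_nonsquareSum_le hGRH hΦsmooth hΦsupp hε hε1 hy hδ
  refine ⟨C, hC, ?_⟩
  filter_upwards [h, eventually_ge_atTop 1] with X hX hX1
  have hX0 : 0 < X := by linarith
  have h14 : 1 ≤ X ^ (1 / 4 : ℝ) := Real.one_le_rpow hX1 (by norm_num)
  have hterm : ∀ a ∈ range (⌊X ^ (1 / 4 : ℝ)⌋₊ + 1),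
      |oddMoebius a * (X / (2 * (a : ℝ) ^ 2) *
        ∑ p ∈ windowPrimes y δ X, nonsquareSum (cosSinTransform Φ) X a p)| ≤
        C / 2 * X ^ (3 / 2 + 2 * ε) := by
    intro a ha
    rcases Nat.eq_zero_or_pos a with rfl | ha0
    · simp only [oddMoebius_zero, zero_mul, abs_zero]
      positivity
    rw [mem_range, Nat.lt_succ_iff, Nat.le_floor_iff (by positivity)] at ha
    have hapos : (0 : ℝ) < a := by exact_mod_cast ha0
    rw [abs_mul, abs_mul, abs_of_nonneg (show 0 ≤ X / (2 * (a : ℝ) ^ 2) by positivity)]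
    calc |oddMoebius a| * (X / (2 * (a : ℝ) ^ 2) *
          |∑ p ∈ windowPrimes y δ X, nonsquareSum (cosSinTransform Φ) X a p|)
        ≤ 1 * (X / (2 * (a : ℝ) ^ 2) * (C * X ^ (1 / 2 + ε) * (a : ℝ) ^ (2 + 4 * ε))) := by
          gcongr
          · exact abs_oddMoebius_le_one a
          · exact hX a ha0
      _ = C / 2 * (X ^ (1 / 2 + ε) * X) * (a : ℝ) ^ (4 * ε) := by
          rw [Real.rpow_add hapos, Real.rpow_ofNat]
          field_simp
      _ ≤ C / 2 * (X ^ (1 / 2 + ε) * X) * (X ^ (1 / 4 : ℝ)) ^ (4 * ε) := by gcongr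
      _ = _ := by
          rw [← Real.rpow_mul hX0.le, ← Real.rpow_add_one hX0.ne', mul_assoc,
            ← Real.rpow_add hX0]
          congr 2
          ring
  calc _ ≤ ∑ a ∈ range (⌊X ^ (1 / 4 : ℝ)⌋₊ + 1), |oddMoebius a * (X / (2 * (a : ℝ) ^ 2) *
        ∑ p ∈ windowPrimes y δ X, nonsquareSum (cosSinTransform Φ) X a p)| :=
        abs_sum_le_sum_abs _ _
    _ ≤ ∑ a ∈ range (⌊X ^ (1 / 4 : ℝ)⌋₊ + 1), C / 2 * X ^ (3 / 2 + 2 * ε) := sum_le_sum hterm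
    _ = ((⌊X ^ (1 / 4 : ℝ)⌋₊ + 1 : ℕ) : ℝ) * (C / 2 * X ^ (3 / 2 + 2 * ε)) := by
        rw [sum_const, card_range, nsmul_eq_mul]
    _ ≤ (2 * X ^ (1 / 4 : ℝ)) * (C / 2 * X ^ (3 / 2 + 2 * ε)) := by
        gcongr
        push_cast
        have := Nat.floor_le (show 0 ≤ X ^ (1 / 4 : ℝ) by positivity)
        linarith
    _ = C * X ^ (7 / 4 + 2 * ε) := by
        rw [show 7 / 4 + 2 * ε = 1 / 4 + (3 / 2 + 2 * ε) by ring, Real.rpow_add hX0 (1 / 4)]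
        ring
    _ ≤ _ := by
        gcongr
        norm_num

theorem tendsto_log_mul_rpow_neg {s : ℝ} (hs : 0 < s) :
    Tendsto (fun X : ℝ => Real.log X * X ^ (-s)) atTop (𝓝 0) := by
  refine ((isLittleO_log_rpow_atTop hs).tendsto_div_nhds_zero).congr' ?_
  filter_upwards [eventually_gt_atTop 0] with X hX
  rw [Real.rpow_neg hX.le, div_eq_mul_inv]

/-- Averages over the prime window of quantities tending to `L` along it. -/
theorem tendsto_sum_windowPrimes (hGRH : GeneralizedRiemannHypothesis) {y δ : ℝ} (hy : 0 < y)
    (hδ : δ ∈ Set.Ioo (3 / 4 : ℝ) 1) {f : ℝ × ℕ → ℝ} {L : ℝ}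
    (hf : Tendsto f (windowFilter y δ) (𝓝 L)) :
    Tendsto (fun X : ℝ => Real.log X / X ^ δ * ∑ p ∈ windowPrimes y δ X, f (X, p)) atTop
      (𝓝 L) := by
  have hcard := tendsto_card_windowPrimes hGRH hy hδ
  have hdiff : Tendsto (fun X : ℝ => Real.log X / X ^ δ *
      ∑ p ∈ windowPrimes y δ X, (f (X, p) - L)) atTop (𝓝 0) := by
    rw [Metric.tendsto_nhds]
    intro η hη
    have h1 := eventually_windowFilter.1 (Metric.tendsto_nhds.1 hf (η / 2) (by positivity))
    filter_upwards [h1, hcard.eventually (gt_mem_nhds (show (1 : ℝ) < 2 by norm_num)),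
      eventually_ge_atTop 1] with X hX hX2 hX1
    have hc : 0 ≤ Real.log X / X ^ δ :=
      div_nonneg (Real.log_nonneg hX1) (by positivity)
    rw [Real.dist_0_eq_abs, abs_mul, abs_of_nonneg hc]
    calc Real.log X / X ^ δ * |∑ p ∈ windowPrimes y δ X, (f (X, p) - L)|
        ≤ Real.log X / X ^ δ * ∑ p ∈ windowPrimes y δ X, η / 2 := by
          gcongr
          refine (abs_sum_le_sum_abs _ _).trans (sum_le_sum fun p hp => ?_)
          exact (hX p hp).le
      _ = (Real.log X / X ^ δ * #(windowPrimes y δ X)) * (η / 2) := by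
          rw [sum_const, nsmul_eq_mul]; ring
      _ < 2 * (η / 2) := by gcongr
      _ = η := by ring
  have := hdiff.add (hcard.mul_const L)
  rw [zero_add, one_mul] at this
  refine this.congr fun X => ?_
  rw [sum_sub_distrib, sum_const, nsmul_eq_mul]
  ring

theorem murmuration_real_characters (hGRH : GeneralizedRiemannHypothesis)
    (y δ : ℝ) (hy : 0 < y) (hδ : δ ∈ Set.Ioo (3 / 4 : ℝ) 1)
    (Φ : ℝ → ℝ) (hΦsmooth : ContDiff ℝ (⊤ : ℕ∞) Φ) (hΦsupp : HasCompactSupport Φ)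
    (hΦpos : ∀ x, 0 ≤ Φ x) :
    Tendsto (fun X : ℝ => MPhi Φ y X δ) atTop
      (𝓝 ((1 / 2) * ∑' a : ℕ,
        (if Odd a then (ArithmeticFunction.moebius a : ℝ) / (a : ℝ) ^ 2 else 0) *
          ∑' m : ℕ, (-1 : ℝ) ^ (m + 1) *
            cosSinTransform Φ (((m : ℝ) + 1) ^ 2 / (2 * (a : ℝ) ^ 2 * y)))) := by
  obtain ⟨hδ0, hδ1⟩ := id hδ
  set ε := (δ - 3 / 4) / 4 with hε
  have hε0 : 0 < ε := by rw [hε]; linarith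
  have hε1 : ε ≤ 1 / 2 := by rw [hε]; linarith
  obtain ⟨hd, C, -, h0, h1, -⟩ := exists_cosSinTransform_bound hΦsmooth hΦsupp
  have hmain := tendsto_sum_windowPrimes hGRH hy hδ (tendsto_sum_squareSum hd h0 h1 hy hδ1)
  obtain ⟨C₁, hC₁, hT⟩ := abs_sum_Ico_oddSum_le hGRH hΦsmooth hΦsupp hε0 hε1 hy hδ1.le
  obtain ⟨C₂, hC₂, hS⟩ := abs_sum_range_nonsquareSum_le hGRH hΦsmooth hΦsupp hε0 hε1 hy hδ1.le
  set T : ℝ → ℝ := fun X => ∑ a ∈ Ico (⌊X ^ (1 / 4 : ℝ)⌋₊ + 1) (⌊X ^ (3 / 4 : ℝ)⌋₊ + 1),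
    oddMoebius a * ∑ p ∈ windowPrimes y δ X, oddSum Φ X a p with hTdef
  set S : ℝ → ℝ := fun X => ∑ a ∈ range (⌊X ^ (1 / 4 : ℝ)⌋₊ + 1), oddMoebius a *
    (X / (2 * (a : ℝ) ^ 2) *
      ∑ p ∈ windowPrimes y δ X, nonsquareSum (cosSinTransform Φ) X a p) with hSdef
  have herr : Tendsto (fun X : ℝ => Real.log X / X ^ (1 + δ) * (S X + T X)) atTop (𝓝 0) := by
    have hlim := (tendsto_log_mul_rpow_neg hε0).const_mul (C₂ + C₁)
    rw [mul_zero] at hlim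
    refine squeeze_zero_norm' ?_ hlim
    filter_upwards [hT, hS, eventually_ge_atTop 1] with X hTX hSX hX1
    have hX0 : 0 < X := by linarith
    have hc : 0 ≤ Real.log X / X ^ (1 + δ) :=
      div_nonneg (Real.log_nonneg hX1) (by positivity)
    rw [Real.norm_eq_abs, abs_mul, abs_of_nonneg hc]
    calc Real.log X / X ^ (1 + δ) * |S X + T X|
        ≤ Real.log X / X ^ (1 + δ) * (C₂ * X ^ (7 / 4 + 3 * ε) + C₁ * X ^ (7 / 4 + 3 * ε)) := by
          gcongr
          exact (abs_add_le _ _).trans (add_le_add hSX (hTX _))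
      _ = (C₂ + C₁) * (Real.log X * (X ^ (7 / 4 + 3 * ε) / X ^ (1 + δ))) := by ring
      _ = _ := by
          rw [← Real.rpow_sub hX0]
          congr 3
          rw [hε]
          ring
  have htot := (hmain.const_mul (1 / 2)).add herr
  rw [add_zero] at htot
  have hlimit : ∀ a : ℕ, (if Odd a then (ArithmeticFunction.moebius a : ℝ) / (a : ℝ) ^ 2 else 0) =
      oddMoebius a / (a : ℝ) ^ 2 := by
    intro a
    rw [oddMoebius]
    split_ifs <;> simp
  simp_rw [hlimit]
  refine htot.congr' ?_
  filter_upwards [eventually_finsum_eq_sum_oddSum hΦsupp hy δ, eventually_ge_atTop 1,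
    eventually_gt_atTop (2 / y)] with X hX hX1 hXy
  have hX0 : 0 < X := by linarith
  have hexp : X ^ (1 + δ) = X * X ^ δ := by rw [Real.rpow_add hX0, Real.rpow_one]
  have hle : ⌊X ^ (1 / 4 : ℝ)⌋₊ + 1 ≤ ⌊X ^ (3 / 4 : ℝ)⌋₊ + 1 :=
    Nat.succ_le_succ (Nat.floor_le_floor (Real.rpow_le_rpow_of_exponent_le hX1 (by norm_num)))
  have hM : MPhi Φ y X δ = Real.log X / X ^ (1 + δ) * ∑ p ∈ windowPrimes y δ X,
      ∑ a ∈ range (⌊X ^ (3 / 4 : ℝ)⌋₊ + 1), oddMoebius a * oddSum Φ X a p :=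
    congrArg (Real.log X / X ^ (1 + δ) * ·) (sum_congr rfl hX)
  have hswap : ∑ p ∈ windowPrimes y δ X, ∑ a ∈ range (⌊X ^ (3 / 4 : ℝ)⌋₊ + 1),
      oddMoebius a * oddSum Φ X a p = ∑ a ∈ range (⌊X ^ (3 / 4 : ℝ)⌋₊ + 1),
        oddMoebius a * ∑ p ∈ windowPrimes y δ X, oddSum Φ X a p := by
    rw [sum_comm]
    simp_rw [mul_sum]
  rw [hM, hswap, ← sum_range_add_sum_Ico _ hle]
  have hlow : ∑ a ∈ range (⌊X ^ (1 / 4 : ℝ)⌋₊ + 1), oddMoebius a *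
      ∑ p ∈ windowPrimes y δ X, oddSum Φ X a p =
      X / 2 * ∑ p ∈ windowPrimes y δ X, ∑ a ∈ range (⌊X ^ (1 / 4 : ℝ)⌋₊ + 1),
        oddMoebius a / (a : ℝ) ^ 2 * squareSum (cosSinTransform Φ) X a p + S X := by
    rw [sum_comm, mul_sum, hSdef, ← sum_add_distrib]
    refine sum_congr rfl fun a _ => ?_
    rcases Nat.eq_zero_or_pos a with rfl | ha
    · simp [oddMoebius_zero]
    have hodd : ∀ p ∈ windowPrimes y δ X, oddSum Φ X a p = X / (2 * (a : ℝ) ^ 2) *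
        (squareSum (cosSinTransform Φ) X a p + nonsquareSum (cosSinTransform Φ) X a p) := by
      intro p hp
      obtain ⟨hpp, hpX, -⟩ := mem_windowPrimes.1 hp
      refine oddSum_eq hΦsmooth hΦsupp hX0 ha.ne' hpp ?_
      rintro rfl
      rw [div_lt_iff₀ hy] at hXy
      push_cast at hpX
      linarith
    rw [sum_congr rfl hodd, ← mul_sum, sum_add_distrib, ← mul_sum]
    field_simp
  rw [hlow]
  change _ = Real.log X / X ^ (1 + δ) * (_ + S X + T X)
  rw [hexp]
  field_simp
  ring
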